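/- Let α ∈ (0,1/2), let γ be an integer with γ > max{9, (3α−1)/(1−2α)}, let (1−α)/k_γ < C₁ < C₂ < 1, and let (n_i) be a strictly increasing sequence of positive integers such that for every i there exists an integer a_i ≥ 1 with C₁·k_γ·f(n_i) ≤ a_i + (γ+1)(4^{a_i}−1)/3 ≤ C₂·k_γ·f(n_i). Then P(there is an induced copy F of W_{a_i}^γ in G(n_i, n_i^{−α}) such that every vertex outside F has a neighbor in F) → 1 as i → ∞. -/

import Mathlib

open Filter FirstOrder

noncomputable section

/-! ### The binomial random graph `G(n,p)` -/

/-- The number of edges of a simple graph. -/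
noncomputable def edgeCt {n : ℕ} (G : SimpleGraph (Fin n)) : ℕ := Nat.card G.edgeSet

open scoped Classical in
/-- `prob n p Q` is the probability that the binomial random graph `G(n,p)` (on vertex set
`Fin n`) has property `Q`: the sum over all graphs `G` with `Q G` of
`p^{e(G)} (1-p)^{n(n-1)/2 - e(G)}`. -/
noncomputable def prob (n : ℕ) (p : ℝ) (Q : SimpleGraph (Fin n) → Prop) : ℝ :=
  ∑ G : SimpleGraph (Fin n),
    if Q G then p ^ edgeCt G * (1 - p) ^ (n * (n - 1) / 2 - edgeCt G) else 0

/-- `expec n p W` is the expectation of a real-valued function `W` of the binomial random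
graph `G(n,p)`. -/
noncomputable def expec (n : ℕ) (p : ℝ) (W : SimpleGraph (Fin n) → ℝ) : ℝ :=
  ∑ G : SimpleGraph (Fin n),
    W G * (p ^ edgeCt G * (1 - p) ^ (n * (n - 1) / 2 - edgeCt G))

/-! ### The graphs `W_a^γ` and `W_a^{γ,*}` -/

/-- `ωr r a = (r^a − 1)/(r−1)`, the number of vertices of the perfect `r`-ary tree of
depth `a − 1`. -/
def ωr (r a : ℕ) : ℕ := (r ^ a - 1) / (r - 1)

/-- The depth of the node with (0-based) breadth-first (heap) index `j` in the infinite
`r`-ary tree: the root has index 0, and the parent of node `j ≥ 1` is node `(j−1)/r`. -/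
def heapDepth (r : ℕ) : ℕ → ℕ
  | 0 => 0
  | j + 1 => heapDepth r (j / r) + 1
  decreasing_by exact Nat.lt_succ_of_le (Nat.div_le_self _ _)

/-- The vertex set of `W_a^γ`: the path `F₁` on `a` vertices (`Sum.inl`), together with,
for each of the `(4^a−1)/3` vertices `i` of the perfect 4-ary tree `F₂` (in breadth-first
order), the vertex `(i,0)` of `F₂` itself and the `γ` inner vertices `(i,1),…,(i,γ)` of the
path `P_{γ+2}` joining `i` to the vertex of `F₁` at the same distance from the root. -/
abbrev WVert (γ a : ℕ) := Fin a ⊕ (Fin (ωr 4 a) × Fin (γ + 1))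

/-- Base (directed) adjacency relation generating `W_a^γ`: consecutive `F₁`-vertices;
the last inner path vertex `(i,γ)` is joined to the `F₁`-vertex at depth of `i`;
consecutive vertices along each `P_{γ+2}`; and tree edges of the perfect 4-ary tree
(in heap indexing, `j` is the parent of `i ≥ 1` iff `j = (i−1)/4`). -/
def Wbase (γ a : ℕ) : WVert γ a → WVert γ a → Prop
  | Sum.inl u, Sum.inl v => (v : ℕ) = (u : ℕ) + 1
  | Sum.inl u, Sum.inr iv => (iv.2 : ℕ) = γ ∧ heapDepth 4 (iv.1 : ℕ) = (u : ℕ)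
  | Sum.inr _, Sum.inl _ => False
  | Sum.inr iv, Sum.inr jw =>
      (iv.1 = jw.1 ∧ (jw.2 : ℕ) = (iv.2 : ℕ) + 1) ∨
      ((iv.2 : ℕ) = 0 ∧ (jw.2 : ℕ) = 0 ∧ 1 ≤ (iv.1 : ℕ) ∧ (jw.1 : ℕ) = ((iv.1 : ℕ) - 1) / 4)

/-- The graph `W_a^γ`. -/
def WG (γ a : ℕ) : SimpleGraph (WVert γ a) := SimpleGraph.fromRel (Wbase γ a)

/-- The vertex set of `W_a^{γ,*}` (with `ω₁ = ωr r a`, `ω₂ = ωr r ω₁`), as five pieces: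
the path `F₁` on `a` vertices; the tree `F₂` together with the inner vertices of the
paths `P_{γ+2}` joining `F₂` to `F₁` (pairs `(i,k)`, `k = 0` being the `F₂`-vertex itself);
the `γ` inner vertices of the paths `P_{γ+2}` joining the `i`-th vertex of `F₂` (in
breadth-first order) to the `i`-th vertex of the path `F̃₁`; the path `F̃₁` on `ω₁`
vertices; and the tree `F̃₂` together with the inner vertices of the paths `P_{γ+2}`
joining `F̃₂` to `F̃₁`. -/
abbrev WSVert (γ r a : ℕ) :=
  Fin a ⊕ ((Fin (ωr r a) × Fin (γ + 1)) ⊕ ((Fin (ωr r a) × Fin γ) ⊕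
    (Fin (ωr r a) ⊕ (Fin (ωr r (ωr r a)) × Fin (γ + 1)))))

/-- Base (directed) adjacency relation generating `W_a^{γ,*}`. -/
def WSbase (γ r a : ℕ) : WSVert γ r a → WSVert γ r a → Prop
  | .inl u, .inl v => (v : ℕ) = (u : ℕ) + 1
  | .inl u, .inr (.inl iv) => (iv.2 : ℕ) = γ ∧ heapDepth r (iv.1 : ℕ) = (u : ℕ)
  | .inr (.inl iv), .inr (.inl jw) =>
      (iv.1 = jw.1 ∧ (jw.2 : ℕ) = (iv.2 : ℕ) + 1) ∨
      ((iv.2 : ℕ) = 0 ∧ (jw.2 : ℕ) = 0 ∧ 1 ≤ (iv.1 : ℕ) ∧ (jw.1 : ℕ) = ((iv.1 : ℕ) - 1) / r)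
  | .inr (.inl iv), .inr (.inr (.inl jm)) => (iv.2 : ℕ) = 0 ∧ iv.1 = jm.1 ∧ (jm.2 : ℕ) = 0
  | .inr (.inl iv), .inr (.inr (.inr (.inl d))) => γ = 0 ∧ (iv.2 : ℕ) = 0 ∧ (iv.1 : ℕ) = (d : ℕ)
  | .inr (.inr (.inl im)), .inr (.inr (.inl jm)) => im.1 = jm.1 ∧ (jm.2 : ℕ) = (im.2 : ℕ) + 1
  | .inr (.inr (.inl im)), .inr (.inr (.inr (.inl d))) =>
      (im.2 : ℕ) + 1 = γ ∧ (im.1 : ℕ) = (d : ℕ)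
  | .inr (.inr (.inr (.inl d))), .inr (.inr (.inr (.inl e))) => (e : ℕ) = (d : ℕ) + 1
  | .inr (.inr (.inr (.inl d))), .inr (.inr (.inr (.inr jw))) =>
      (jw.2 : ℕ) = γ ∧ heapDepth r (jw.1 : ℕ) = (d : ℕ)
  | .inr (.inr (.inr (.inr iv))), .inr (.inr (.inr (.inr jw))) =>
      (iv.1 = jw.1 ∧ (jw.2 : ℕ) = (iv.2 : ℕ) + 1) ∨
      ((iv.2 : ℕ) = 0 ∧ (jw.2 : ℕ) = 0 ∧ 1 ≤ (iv.1 : ℕ) ∧ (jw.1 : ℕ) = ((iv.1 : ℕ) - 1) / r)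
  | _, _ => False

/-- The graph `W_a^{γ,*}`. -/
def WSG (γ r a : ℕ) : SimpleGraph (WSVert γ r a) := SimpleGraph.fromRel (WSbase γ r a)

/-- `Vnum γ r a = V_{γ,r}(a) = a + 2(γ+1)ω_r(a) + (γ+1)ω_r(ω_r(a))`,
the number of vertices of `W_a^{γ,*}`. -/
def Vnum (γ r a : ℕ) : ℕ := a + 2 * (γ + 1) * ωr r a + (γ + 1) * ωr r (ωr r a)

/-- `s` is (the vertex set of) an induced copy of `H` in `G`. -/
def IsInducedCopy {V W : Type} (H : SimpleGraph W) (G : SimpleGraph V) (s : Set V) : Prop :=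
  Nonempty (H ≃g G.induce s)

/-! ### The quantities `k_γ` and `f` -/

/-- `kcoef α γ = k_γ = 2(1 − α(γ+2)/(γ+1))`. -/
def kcoef (α : ℝ) (γ : ℕ) : ℝ := 2 * (1 - α * ((γ : ℝ) + 2) / ((γ : ℝ) + 1))

/-- `ff α x = f(x) = x^α · ln x`. -/
def ff (α x : ℝ) : ℝ := x ^ α * Real.log x

/-! ### The language `L_m` and EMSO satisfaction -/

/-- Relation symbols of the language `L_m`: `m` unary symbols and one binary symbol. -/
def LRel (m : ℕ) : ℕ → Type
  | 1 => Fin m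
  | 2 => Unit
  | _ => Empty

/-- The first-order language `L_m`: one binary relation symbol, `m` unary relation symbols
and no function symbols. -/
def Lang (m : ℕ) : Language where
  Functions := fun _ => Empty
  Relations := LRel m

/-- The `L_m`-structure on `Fin n` whose binary relation is adjacency in the graph `G` and
whose `i`-th unary relation is membership in `S i`. -/
def structOf {n m : ℕ} (G : SimpleGraph (Fin n)) (S : Fin m → Set (Fin n)) :
    (Lang m).Structure (Fin n) where
  funMap := fun f _ => Empty.elim f
  RelMap := fun {k} r v =>
    match k, r, v with
    | 1, i, v => v 0 ∈ S i
    | 2, _, v => G.Adj (v 0) (v 1)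
    | 0, r, _ => Empty.elim r
    | (_ + 3), r, _ => Empty.elim r

/-- `G` EMSO-satisfies the `L_m`-sentence `φ`: there are sets `S 0, …, S (m-1)` of vertices
such that the structure on `Fin n` given by adjacency in `G` and membership in the `S i`
satisfies `φ`. -/
def EMSOSat {n m : ℕ} (G : SimpleGraph (Fin n)) (φ : (Lang m).Sentence) : Prop :=
  ∃ S : Fin m → Set (Fin n),
    @FirstOrder.Language.Sentence.Realize (Lang m) (Fin n) (structOf G S) φ

/-! ### Product Bernoulli measures on `E → Bool` -/

section Bernoulli

open Finset

/-- The indicator of a proposition. -/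
def ind (Q : Prop) : ℝ := open scoped Classical in if Q then 1 else 0

lemma ind_of {Q : Prop} (h : Q) : ind Q = 1 := by simp [ind, h]

lemma ind_of_not {Q : Prop} (h : ¬ Q) : ind Q = 0 := by simp [ind, h]

lemma ind_nonneg (Q : Prop) : 0 ≤ ind Q := by unfold ind; split_ifs <;> norm_num

lemma ind_le_one (Q : Prop) : ind Q ≤ 1 := by unfold ind; split_ifs <;> norm_num

lemma ind_mono {P Q : Prop} (h : P → Q) : ind P ≤ ind Q := by
  by_cases hP : P
  · rw [ind_of hP, ind_of (h hP)]
  · rw [ind_of_not hP]; exact ind_nonneg Q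

lemma ind_and (P Q : Prop) : ind (P ∧ Q) = ind P * ind Q := by
  by_cases hP : P <;> by_cases hQ : Q <;> simp [ind, hP, hQ]

lemma ind_not (P : Prop) : ind (¬ P) = 1 - ind P := by
  by_cases hP : P <;> simp [ind, hP]

lemma ind_or_le (P Q : Prop) : ind (P ∨ Q) ≤ ind P + ind Q := by
  by_cases hP : P <;> by_cases hQ : Q <;> simp [ind, hP, hQ]

lemma ind_mul_self (P : Prop) : ind P * ind P = ind P := by
  by_cases hP : P <;> simp [ind, hP]

lemma ind_forall {κ : Type*} (s : Finset κ) (P : κ → Prop) :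
    ind (∀ i ∈ s, P i) = ∏ i ∈ s, ind (P i) := by
  by_cases h : ∀ i ∈ s, P i
  · rw [ind_of h, Finset.prod_eq_one fun i hi => ind_of (h i hi)]
  · rw [ind_of_not h]
    push Not at h
    obtain ⟨i, hi, hPi⟩ := h
    rw [Finset.prod_eq_zero hi (ind_of_not hPi)]

lemma ind_exists_le {κ : Type*} (s : Finset κ) (P : κ → Prop) :
    ind (∃ i ∈ s, P i) ≤ ∑ i ∈ s, ind (P i) := by
  by_cases h : ∃ i ∈ s, P i
  · obtain ⟨i, hi, hPi⟩ := h
    rw [ind_of ⟨i, hi, hPi⟩, ← ind_of hPi]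
    exact Finset.single_le_sum (f := fun i => ind (P i)) (fun j _ => ind_nonneg _) hi
  · rw [ind_of_not h]
    exact Finset.sum_nonneg fun j _ => ind_nonneg _

lemma sum_ind_eq_card {κ : Type*} (s : Finset κ) (P : κ → Prop) [DecidablePred P] :
    ∑ i ∈ s, ind (P i) = #{i ∈ s | P i} := by
  rw [Finset.card_filter]
  push_cast
  refine Finset.sum_congr rfl fun i _ => ?_
  unfold ind; congr

variable {E : Type*}

/-- The weight of one Bernoulli outcome. -/
def bw (p : ℝ) (b : Bool) : ℝ := if b then p else 1 - p

/-- The Bernoulli product weight of a configuration. -/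
def wt [Fintype E] (p : ℝ) (ω : E → Bool) : ℝ := ∏ e, bw p (ω e)

/-- Expectation with respect to the Bernoulli product measure. -/
def ex [Fintype E] (p : ℝ) (F : (E → Bool) → ℝ) : ℝ :=
  open scoped Classical in ∑ ω, wt p ω * F ω

/-- Probability with respect to the Bernoulli product measure. -/
def pr [Fintype E] (p : ℝ) (Q : (E → Bool) → Prop) : ℝ := ex p fun ω => ind (Q ω)

/-- The configuration equal to `ω` on `S` and to `τ` off `S`. -/
def pw (S : Set E) (ω τ : E → Bool) : E → Bool :=
  open scoped Classical in fun e => if e ∈ S then ω e else τ e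

/-- `F` only depends on the coordinates in `S`. -/
def Dep {β : Type*} (S : Set E) (F : (E → Bool) → β) : Prop :=
  ∀ ω ω', (∀ e ∈ S, ω e = ω' e) → F ω = F ω'

lemma pw_of_mem {S : Set E} {e : E} (h : e ∈ S) (ω ω' : E → Bool) : pw S ω ω' e = ω e := by
  simp [pw, h]

lemma pw_of_notMem {S : Set E} {e : E} (h : e ∉ S) (ω ω' : E → Bool) : pw S ω ω' e = ω' e := by
  simp [pw, h]

lemma Dep.mono {β : Type*} {S T : Set E} (h : S ⊆ T) {F : (E → Bool) → β} (hF : Dep S F) :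
    Dep T F := fun ω ω' H => hF ω ω' fun e he => H e (h he)

lemma Dep.comp {β γ : Type*} {S : Set E} {F : (E → Bool) → β} (hF : Dep S F) (φ : β → γ) :
    Dep S (fun ω => φ (F ω)) := fun ω ω' H => by simp only; rw [hF ω ω' H]

lemma Dep.prod {κ : Type*} {S : Set E} {s : Finset κ} {F : κ → (E → Bool) → ℝ}
    (hF : ∀ i ∈ s, Dep S (F i)) : Dep S (fun ω => ∏ i ∈ s, F i ω) :=
  fun ω ω' H => Finset.prod_congr rfl fun i hi => hF i hi ω ω' H

lemma Dep.pw_left {β : Type*} {S : Set E} {F : (E → Bool) → β} (hF : Dep S F) (ω ω' : E → Bool) :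
    F (pw S ω ω') = F ω := hF _ _ fun _ he => pw_of_mem he _ _

lemma Dep.pw_right {β : Type*} {S T : Set E} {F : (E → Bool) → β} (hF : Dep T F)
    (h : Disjoint S T) (ω ω' : E → Bool) :
    F (pw S ω ω') = F ω' :=
  hF _ _ fun _ he => pw_of_notMem (Set.disjoint_right.mp h he) _ _

lemma bw_nonneg {p : ℝ} (h0 : 0 ≤ p) (h1 : p ≤ 1) (b : Bool) : 0 ≤ bw p b := by
  cases b <;> simp [bw] <;> linarith

variable [Fintype E]

lemma wt_nonneg {p : ℝ} (h0 : 0 ≤ p) (h1 : p ≤ 1) (ω : E → Bool) : 0 ≤ wt p ω :=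
  Finset.prod_nonneg fun _ _ => bw_nonneg h0 h1 _

lemma ex_prod_coord (p : ℝ) (φ : E → Bool → ℝ) :
    ex p (fun ω => ∏ e, φ e (ω e)) = ∏ e, (p * φ e true + (1 - p) * φ e false) := by
  classical
  have h := Finset.prod_univ_sum (fun _ : E => (Finset.univ : Finset Bool))
    (fun e b => bw p b * φ e b)
  rw [Fintype.piFinset_univ] at h
  simp only [Fintype.sum_bool, Finset.prod_mul_distrib] at h
  rw [ex]
  convert h.symm using 1 <;> simp [bw, wt]

lemma ex_const (p : ℝ) (c : ℝ) : ex (E := E) p (fun _ => c) = c := by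
  have h := ex_prod_coord (E := E) p (fun _ _ => 1)
  simp only [Finset.prod_const_one, mul_one, add_sub_cancel] at h
  simp only [ex, ← Finset.sum_mul, mul_one] at h ⊢
  rw [h, one_mul]

lemma ex_mono {p : ℝ} (h0 : 0 ≤ p) (h1 : p ≤ 1) {F G : (E → Bool) → ℝ} (h : ∀ ω, F ω ≤ G ω) :
    ex p F ≤ ex p G :=
  Finset.sum_le_sum fun ω _ => mul_le_mul_of_nonneg_left (h ω) (wt_nonneg h0 h1 ω)

lemma ex_nonneg {p : ℝ} (h0 : 0 ≤ p) (h1 : p ≤ 1) {F : (E → Bool) → ℝ} (h : ∀ ω, 0 ≤ F ω) :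
    0 ≤ ex p F :=
  Finset.sum_nonneg fun ω _ => mul_nonneg (wt_nonneg h0 h1 ω) (h ω)

lemma ex_add (p : ℝ) (F G : (E → Bool) → ℝ) : ex p (fun ω => F ω + G ω) = ex p F + ex p G := by
  simp [ex, mul_add, Finset.sum_add_distrib]

lemma ex_sub (p : ℝ) (F G : (E → Bool) → ℝ) : ex p (fun ω => F ω - G ω) = ex p F - ex p G := by
  simp [ex, mul_sub, Finset.sum_sub_distrib]

lemma ex_const_mul (p c : ℝ) (F : (E → Bool) → ℝ) : ex p (fun ω => c * F ω) = c * ex p F := by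
  simp only [ex, Finset.mul_sum]
  exact Finset.sum_congr rfl fun _ _ => by ring

lemma ex_mul_const (p c : ℝ) (F : (E → Bool) → ℝ) : ex p (fun ω => F ω * c) = ex p F * c := by
  simp only [ex, Finset.sum_mul]
  exact Finset.sum_congr rfl fun _ _ => by ring

lemma ex_sum {κ : Type*} (p : ℝ) (s : Finset κ) (F : κ → (E → Bool) → ℝ) :
    ex p (fun ω => ∑ i ∈ s, F i ω) = ∑ i ∈ s, ex p (F i) := by
  simp only [ex, Finset.mul_sum]
  exact Finset.sum_comm

lemma pr_nonneg {p : ℝ} (h0 : 0 ≤ p) (h1 : p ≤ 1) (Q : (E → Bool) → Prop) : 0 ≤ pr p Q :=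
  ex_nonneg h0 h1 fun _ => ind_nonneg _

lemma pr_le_one {p : ℝ} (h0 : 0 ≤ p) (h1 : p ≤ 1) (Q : (E → Bool) → Prop) : pr p Q ≤ 1 :=
  (ex_mono h0 h1 fun _ => ind_le_one _).trans (ex_const (E := E) p 1).le

lemma pr_mono {p : ℝ} (h0 : 0 ≤ p) (h1 : p ≤ 1) {Q R : (E → Bool) → Prop} (h : ∀ ω, Q ω → R ω) :
    pr p Q ≤ pr p R := ex_mono h0 h1 fun ω => ind_mono (h ω)

lemma pr_not (p : ℝ) (Q : (E → Bool) → Prop) : pr p (fun ω => ¬ Q ω) = 1 - pr p Q := by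
  simp only [pr, ind_not]
  rw [ex_sub, ex_const]

lemma pr_exists_le {κ : Type*} {p : ℝ} (h0 : 0 ≤ p) (h1 : p ≤ 1) (s : Finset κ)
    (Q : κ → (E → Bool) → Prop) :
    pr p (fun ω => ∃ i ∈ s, Q i ω) ≤ ∑ i ∈ s, pr p (Q i) := by
  simp only [pr]
  rw [← ex_sum]
  exact ex_mono h0 h1 fun ω => ind_exists_le s fun i => Q i ω

lemma pr_markov {p : ℝ} (h0 : 0 ≤ p) (h1 : p ≤ 1) {F : (E → Bool) → ℝ} (hF : ∀ ω, 0 ≤ F ω)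
    {t : ℝ} (ht : 0 < t) : pr p (fun ω => t ≤ F ω) ≤ ex p F / t := by
  rw [le_div_iff₀ ht, pr, ← ex_mul_const]
  refine ex_mono h0 h1 fun ω => ?_
  by_cases h : t ≤ F ω
  · rw [ind_of h, one_mul]; exact h
  · rw [ind_of_not h, zero_mul]; exact hF ω

/-- Resampling the coordinates off `S` does not change the law. -/
lemma ex_glue (p : ℝ) (S : Set E) (F : (E → Bool) → ℝ) :
    ex p F = ex p fun ω => ex p fun ω' => F (pw S ω ω') := by
  classical
  have hF : ex p F = ex p fun ω => ex p fun _ : E → Bool => F ω := by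
    congr 1; ext ω; rw [ex_const]
  rw [hF]
  simp only [ex, Finset.mul_sum]
  rw [← Fintype.sum_prod_type', ← Fintype.sum_prod_type']
  refine Fintype.sum_bijective (fun q : (E → Bool) × (E → Bool) => (pw S q.1 q.2, pw S q.2 q.1))
    (Function.Involutive.bijective ?_) _ _ ?_
  · rintro ⟨ω, ω'⟩
    ext e <;> by_cases h : e ∈ S <;> simp [pw, h]
  · rintro ⟨ω, ω'⟩
    have h1 : pw S (pw S ω ω') (pw S ω' ω) = ω := by
      ext e; by_cases h : e ∈ S <;> simp [pw, h]
    have h2 : wt p ω * wt p ω' = wt p (pw S ω ω') * wt p (pw S ω' ω) := by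
      rw [wt, wt, wt, wt, ← Finset.prod_mul_distrib, ← Finset.prod_mul_distrib]
      refine Finset.prod_congr rfl fun e _ => ?_
      by_cases h : e ∈ S <;> simp [pw, h, mul_comm]
    simp only
    rw [h1, ← mul_assoc, ← mul_assoc, h2]

lemma ex_mul_of_dep (p : ℝ) {S T : Set E} (hST : Disjoint S T) {F G : (E → Bool) → ℝ}
    (hF : Dep S F) (hG : Dep T G) : ex p (fun ω => F ω * G ω) = ex p F * ex p G := by
  rw [ex_glue p S]
  simp only [hF.pw_left, hG.pw_right hST, ex_const_mul, ex_mul_const]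

lemma ex_prod_of_dep {κ : Type*} (p : ℝ) (s : Finset κ) {S : κ → Set E}
    (hS : (s : Set κ).PairwiseDisjoint S) {F : κ → (E → Bool) → ℝ}
    (hF : ∀ i ∈ s, Dep (S i) (F i)) :
    ex p (fun ω => ∏ i ∈ s, F i ω) = ∏ i ∈ s, ex p (F i) := by
  classical
  induction s using Finset.induction_on with
  | empty => simp [ex_const]
  | insert a s ha ih =>
    simp only [Finset.prod_insert ha]
    rw [← ih (hS.subset (by simp)) fun i hi => hF i (Finset.mem_insert_of_mem hi)]
    refine ex_mul_of_dep p (S := S a) (T := ⋃ i ∈ s, S i) ?_ (hF a (by simp)) ?_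
    · rw [Set.disjoint_iUnion₂_right]
      intro i hi
      refine hS (by simp) (by simp [hi]) ?_
      rintro rfl; exact ha hi
    · exact Dep.prod fun i hi =>
        (hF i (Finset.mem_insert_of_mem hi)).mono (Set.subset_biUnion_of_mem (u := S) hi)

/-- If `A` is likely and, given the coordinates in `S`, `Q` is likely on `A`, then `Q` is likely. -/
lemma pr_ge_of_glue {p : ℝ} (h0 : 0 ≤ p) (h1 : p ≤ 1) (S : Set E) {A Q : (E → Bool) → Prop}
    {ε₁ ε₂ : ℝ} (hε : 0 ≤ ε₂) (hA : 1 - ε₁ ≤ pr p A)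
    (hQ : ∀ ω, A ω → 1 - ε₂ ≤ pr p fun ω' => Q (pw S ω ω')) :
    1 - ε₁ - ε₂ ≤ pr p Q := by
  rw [pr, ex_glue p S]
  have h : ∀ ω, ind (A ω) - ε₂ ≤ ex p fun ω' => ind (Q (pw S ω ω')) := by
    intro ω
    by_cases hω : A ω
    · rw [ind_of hω]; exact hQ ω hω
    · rw [ind_of_not hω]
      have := pr_nonneg h0 h1 fun ω' => Q (pw S ω ω')
      simp only [pr] at this
      linarith
  have := ex_mono h0 h1 h
  rw [ex_sub, ex_const] at this
  simp only [pr] at hA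
  linarith

/-- Cauchy–Schwarz lower bound for the probability that a random variable is nonzero. -/
lemma sq_ex_le_pr_ne_zero {p : ℝ} (h0 : 0 ≤ p) (h1 : p ≤ 1) (X : (E → Bool) → ℝ) :
    (ex p X) ^ 2 ≤ pr p (fun ω => X ω ≠ 0) * ex p (fun ω => X ω ^ 2) := by
  classical
  have h := Finset.sum_mul_sq_le_sq_mul_sq (Finset.univ : Finset (E → Bool))
    (fun ω => √(wt p ω) * ind (X ω ≠ 0)) (fun ω => √(wt p ω) * X ω)
  have e1 : ∀ ω, √(wt p ω) * ind (X ω ≠ 0) * (√(wt p ω) * X ω) = wt p ω * X ω := by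
    intro ω
    have := Real.mul_self_sqrt (wt_nonneg h0 h1 ω)
    by_cases hx : X ω = 0
    · simp [hx]
    · rw [ind_of hx]; linear_combination X ω * this
  have e2 : ∀ ω, (√(wt p ω) * ind (X ω ≠ 0)) ^ 2 = wt p ω * ind (X ω ≠ 0) := by
    intro ω
    rw [mul_pow, Real.sq_sqrt (wt_nonneg h0 h1 ω), sq (ind _), ind_mul_self]
  have e3 : ∀ ω, (√(wt p ω) * X ω) ^ 2 = wt p ω * X ω ^ 2 := by
    intro ω
    rw [mul_pow, Real.sq_sqrt (wt_nonneg h0 h1 ω)]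
  simp only [e1, e2, e3] at h
  exact h

/-- The probability of prescribing the values on two disjoint sets of coordinates. -/
lemma pr_prescribed [DecidableEq E] (p : ℝ) {A B : Finset E} (h : Disjoint A B) :
    pr p (fun ω => (∀ e ∈ A, ω e = true) ∧ ∀ e ∈ B, ω e = false) = p ^ #A * (1 - p) ^ #B := by
  have key := ex_prod_coord p (fun e b => (if e ∈ A then (if b then 1 else 0) else 1) *
    (if e ∈ B then (if b then (0 : ℝ) else 1) else 1))
  have e1 : ∀ ω : E → Bool, ind ((∀ e ∈ A, ω e = true) ∧ ∀ e ∈ B, ω e = false) =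
      ∏ e, (if e ∈ A then (if ω e then 1 else 0) else 1) *
        (if e ∈ B then (if ω e then (0 : ℝ) else 1) else 1) := by
    intro ω
    rw [ind_and, ind_forall, ind_forall, Finset.prod_mul_distrib, Finset.prod_ite_mem,
      Finset.prod_ite_mem, Finset.univ_inter, Finset.univ_inter]
    congr 1 <;> refine Finset.prod_congr rfl fun e _ => ?_ <;> cases ω e <;> simp [ind]
  rw [pr, funext e1, key]
  have e2 : ∀ e, (p * ((if e ∈ A then (if (true : Bool) then 1 else 0) else 1) *
    (if e ∈ B then (if (true : Bool) then (0 : ℝ) else 1) else 1)) +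
    (1 - p) * ((if e ∈ A then (if (false : Bool) then 1 else 0) else 1) *
    (if e ∈ B then (if (false : Bool) then (0 : ℝ) else 1) else 1))) =
    (if e ∈ A then p else 1) * (if e ∈ B then 1 - p else 1) := by
    intro e
    by_cases hA : e ∈ A
    · have hB : e ∉ B := Finset.disjoint_left.mp h hA
      simp [hA, hB]
    · by_cases hB : e ∈ B <;> simp [hA, hB]
  rw [Finset.prod_congr rfl fun e _ => e2 e, Finset.prod_mul_distrib, Finset.prod_ite_mem,
    Finset.prod_ite_mem, Finset.univ_inter, Finset.univ_inter, Finset.prod_const,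
    Finset.prod_const]

lemma pr_all_false (p : ℝ) (B : Finset E) :
    pr p (fun ω => ∀ e ∈ B, ω e = false) = (1 - p) ^ #B := by
  classical
  simpa using pr_prescribed p (Finset.disjoint_empty_left B)

/-- The joint probability of meeting each of two sets of coordinates. -/
lemma pr_exists_true_and [DecidableEq E] (p : ℝ) (B C : Finset E) :
    pr p (fun ω => (∃ e ∈ B, ω e = true) ∧ ∃ e ∈ C, ω e = true) =
      1 - (1 - p) ^ #B - (1 - p) ^ #C + (1 - p) ^ #(B ∪ C) := by
  rw [← pr_all_false p B, ← pr_all_false p C, ← pr_all_false p (B ∪ C), pr, pr, pr, pr]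
  rw [← ex_const (E := E) p 1, ← ex_sub, ← ex_sub, ← ex_add]
  congr 1; ext ω
  have e1 : ind (∃ e ∈ B, ω e = true) = 1 - ind (∀ e ∈ B, ω e = false) := by
    rw [← ind_not]; congr 1; simp
  have e2 : ind (∃ e ∈ C, ω e = true) = 1 - ind (∀ e ∈ C, ω e = false) := by
    rw [← ind_not]; congr 1; simp
  have e3 : ind (∀ e ∈ B ∪ C, ω e = false) =
      ind (∀ e ∈ B, ω e = false) * ind (∀ e ∈ C, ω e = false) := by
    rw [← ind_and]; congr 1; simp only [Finset.mem_union, eq_iff_iff]; constructor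
    · exact fun h => ⟨fun e he => h e (.inl he), fun e he => h e (.inr he)⟩
    · rintro ⟨h, h'⟩ e (he | he); exacts [h e he, h' e he]
  rw [ind_and, e1, e2, e3]; ring

/-- A Chebyshev lower bound for the number of independent events that occur. -/
lemma pr_count_ge {κ : Type*} {p π : ℝ} (h0 : 0 ≤ p) (h1 : p ≤ 1)
    (s : Finset κ) {S : κ → Set E} (hS : (s : Set κ).PairwiseDisjoint S)
    {Q : κ → (E → Bool) → Prop} (hQ : ∀ i ∈ s, Dep (S i) (Q i))
    (hπ : ∀ i ∈ s, pr p (Q i) = π) (hpos : 0 < #s * π) :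
    1 - 4 / (#s * π) ≤ pr p (fun ω => #s * π / 2 ≤ ∑ i ∈ s, ind (Q i ω)) := by
  classical
  set μ := (#s : ℝ) * π with hμ
  set Z : (E → Bool) → ℝ := fun ω => ∑ i ∈ s, ind (Q i ω) with hZ
  have hEZ : ex p Z = μ := by
    rw [hZ, ex_sum, hμ, ← nsmul_eq_mul, ← Finset.sum_const]
    exact Finset.sum_congr rfl fun i hi => hπ i hi
  have hEZ2 : ex p (fun ω => Z ω ^ 2) ≤ μ ^ 2 + μ := by
    have e1 : ∀ ω, Z ω ^ 2 = ∑ i ∈ s, ∑ j ∈ s, ind (Q i ω) * ind (Q j ω) := by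
      intro ω; rw [sq, hZ, Finset.sum_mul_sum]
    simp only [e1, ex_sum]
    have e2 : ∀ i ∈ s, ∑ j ∈ s, ex p (fun ω => ind (Q i ω) * ind (Q j ω)) ≤ μ * π + π := by
      intro i hi
      have : ∀ j ∈ s, ex p (fun ω => ind (Q i ω) * ind (Q j ω)) ≤
          π * π + (if i = j then π else 0) := by
        intro j hj
        by_cases hij : i = j
        · subst hij
          simp only [ind_mul_self, if_true]
          have h2 := hπ i hi
          rw [pr] at h2
          rw [h2]
          nlinarith [sq_nonneg π]
        · rw [ex_mul_of_dep p (hS hi hj hij) ((hQ i hi).comp ind) ((hQ j hj).comp ind)]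
          have h2 := hπ i hi
          have h3 := hπ j hj
          rw [pr] at h2 h3
          rw [h2, h3]; simp [hij]
      refine (Finset.sum_le_sum this).trans ?_
      rw [Finset.sum_add_distrib, Finset.sum_ite_eq s i, if_pos hi, Finset.sum_const, nsmul_eq_mul,
        hμ, mul_assoc]
    refine (Finset.sum_le_sum e2).trans ?_
    rw [Finset.sum_const, nsmul_eq_mul, hμ]
    apply le_of_eq; ring
  have hvar : ex p (fun ω => (Z ω - μ) ^ 2) ≤ μ := by
    have : ∀ ω, (Z ω - μ) ^ 2 = (Z ω ^ 2 - 2 * μ * Z ω) + μ ^ 2 := fun ω => by ring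
    simp only [this]
    rw [ex_add, ex_sub, ex_const, ex_const_mul, hEZ]
    nlinarith
  have hmk := pr_markov h0 h1 (F := fun ω => (Z ω - μ) ^ 2) (fun ω => sq_nonneg _)
    (t := (μ / 2) ^ 2) (by positivity)
  have hle : ex p (fun ω => (Z ω - μ) ^ 2) / (μ / 2) ^ 2 ≤ 4 / μ := by
    rw [div_le_div_iff₀ (by positivity) hpos]
    nlinarith
  have := pr_mono h0 h1 (E := E) (Q := fun ω => ¬ (μ / 2 ≤ Z ω)) (R := fun ω => (μ / 2) ^ 2 ≤ (Z ω - μ) ^ 2)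
    (fun ω h => by push Not at h; nlinarith)
  rw [pr_not] at this
  linarith

end Bernoulli

section RandomGraph

open Finset

/-- The graph encoded by a configuration on unordered pairs (loops are ignored). -/
def gr {V : Type*} (ω : Sym2 V → Bool) : SimpleGraph V where
  Adj u v := u ≠ v ∧ ω s(u, v) = true
  symm := ⟨fun u v h => ⟨h.1.symm, by rw [Sym2.eq_swap]; exact h.2⟩⟩
  loopless := ⟨fun u h => h.1 rfl⟩

lemma gr_adj {V : Type*} {ω : Sym2 V → Bool} {u v : V} :
    (gr ω).Adj u v ↔ u ≠ v ∧ ω s(u, v) = true := Iff.rfl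

lemma pr_gr_eq {V : Type*} [Fintype V] [DecidableEq V] (p : ℝ) (G : SimpleGraph V)
    [DecidableRel G.Adj] :
    pr p (fun ω => gr ω = G) =
      p ^ #G.edgeFinset * (1 - p) ^ ((Fintype.card V).choose 2 - #G.edgeFinset) := by
  have hsub : G.edgeFinset ⊆ (⊤ : SimpleGraph V).edgeFinset :=
    SimpleGraph.edgeFinset_mono le_top
  have h := pr_prescribed p (A := G.edgeFinset)
    (B := (⊤ : SimpleGraph V).edgeFinset \ G.edgeFinset) disjoint_sdiff
  rw [card_sdiff_of_subset hsub, SimpleGraph.card_edgeFinset_top_eq_card_choose_two] at h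
  rw [← h]
  congr 1; ext ω
  constructor
  · rintro rfl
    constructor
    · intro e
      induction e with | _ u v => simp [gr_adj]
    · intro e
      induction e with | _ u v => simp +contextual [gr_adj]
  · rintro ⟨h1, h2⟩
    ext u v
    rw [gr_adj]
    constructor
    · rintro ⟨huv, hω⟩
      by_contra hn
      have := h2 s(u, v) (by simp [huv, hn])
      simp [this] at hω
    · intro hadj
      exact ⟨hadj.ne, h1 _ (by simpa using hadj)⟩

lemma prob_eq_pr (n : ℕ) (p : ℝ) (Q : SimpleGraph (Fin n) → Prop) :
    prob n p Q = pr p (fun ω : Sym2 (Fin n) → Bool => Q (gr ω)) := by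
  classical
  have e1 : ∀ ω : Sym2 (Fin n) → Bool,
      ind (Q (gr ω)) = ∑ G : SimpleGraph (Fin n), ind (Q G) * ind (gr ω = G) := by
    intro ω
    rw [Finset.sum_eq_single (gr ω)]
    · rw [ind_of (rfl : gr ω = gr ω), mul_one]
    · intro G _ hG
      rw [ind_of_not hG.symm, mul_zero]
    · simp
  rw [pr, funext e1, ex_sum, prob]
  refine Finset.sum_congr rfl fun G _ => ?_
  have e2 : edgeCt G = #G.edgeFinset := by
    rw [edgeCt, Nat.card_eq_fintype_card, SimpleGraph.edgeFinset_card]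
  have e3 := pr_gr_eq p G
  rw [pr] at e3
  rw [ex_const_mul, e3, Fintype.card_fin, Nat.choose_two_right, e2]
  by_cases hQ : Q G <;> simp [hQ, ind]

end RandomGraph

section BoundedDifferences

variable {E σ : Type*} [Fintype E]

/-- Changing the coordinates owned by `s` changes `f` by at most one. -/
def BddDiff (owner : E → σ) (f : (E → Bool) → ℝ) (s : σ) : Prop :=
  ∀ ω ω', (∀ e, owner e ≠ s → ω e = ω' e) → |f ω - f ω'| ≤ 1

lemma abs_ex_le_one {p : ℝ} (h0 : 0 ≤ p) (h1 : p ≤ 1) {F : (E → Bool) → ℝ}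
    (h : ∀ ω, |F ω| ≤ 1) : |ex p F| ≤ 1 := by
  rw [abs_le]
  constructor
  · rw [← ex_const (E := E) p (-1)]
    exact ex_mono h0 h1 fun ω => (abs_le.mp (h ω)).1
  · refine (ex_mono h0 h1 fun ω => (abs_le.mp (h ω)).2).trans (ex_const p 1).le

lemma exp_mul_le_cosh_add_sinh {x : ℝ} (l : ℝ) (hx : |x| ≤ 1) :
    Real.exp (l * x) ≤ Real.cosh l + x * Real.sinh l := by
  obtain ⟨h1, h2⟩ := abs_le.mp hx
  have hc : ConvexOn ℝ Set.univ Real.exp := convexOn_exp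
  have h : Real.exp (((1 + x) / 2) • l + ((1 - x) / 2) • -l) ≤ _ :=
    hc.2 (Set.mem_univ l) (Set.mem_univ (-l)) (by linarith) (by linarith) (by ring)
  simp only [smul_eq_mul] at h
  rw [Real.cosh_eq, Real.sinh_eq]
  calc Real.exp (l * x) = Real.exp ((1 + x) / 2 * l + (1 - x) / 2 * -l) := by congr 1; ring
    _ ≤ _ := h
    _ = _ := by ring

/-- One step of the exponential martingale bound. -/
lemma ex_exp_le_step {p : ℝ} (h0 : 0 ≤ p) (h1 : p ≤ 1) (owner : E → σ) {f : (E → Bool) → ℝ}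
    {s : σ} (hf : BddDiff owner f s) (l : ℝ) :
    ex p (fun ω => Real.exp (l * f ω)) ≤ Real.exp (l ^ 2 / 2) *
      ex p (fun ω => Real.exp (l * ex p fun ω' => f (pw {e | owner e ≠ s} ω ω'))) := by
  rw [ex_glue p {e | owner e ≠ s}, ← ex_const_mul]
  refine ex_mono h0 h1 fun ω => ?_
  set μ := ex p fun ω' => f (pw {e | owner e ≠ s} ω ω') with hμ
  have key : ∀ ω', Real.exp (l * f (pw {e | owner e ≠ s} ω ω')) ≤ Real.exp (l * μ) *
      (Real.cosh l + (f (pw {e | owner e ≠ s} ω ω') - μ) * Real.sinh l) := by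
    intro ω'
    have hd : |f (pw {e | owner e ≠ s} ω ω') - μ| ≤ 1 := by
      rw [hμ, ← ex_const (E := E) p (f (pw {e | owner e ≠ s} ω ω')), ← ex_sub]
      refine abs_ex_le_one h0 h1 fun ω'' => hf _ _ fun e he => ?_
      rw [pw_of_mem (by exact he), pw_of_mem (by exact he)]
    have := exp_mul_le_cosh_add_sinh l hd
    calc Real.exp (l * f (pw {e | owner e ≠ s} ω ω'))
        = Real.exp (l * μ) * Real.exp (l * (f (pw {e | owner e ≠ s} ω ω') - μ)) := by
          rw [← Real.exp_add]; congr 1; ring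
      _ ≤ _ := mul_le_mul_of_nonneg_left this (Real.exp_pos _).le
  refine (ex_mono h0 h1 key).trans ?_
  rw [ex_const_mul, ex_add, ex_const, ex_mul_const, ex_sub, ex_const, ← hμ, sub_self, zero_mul,
    add_zero, mul_comm]
  exact mul_le_mul_of_nonneg_right (Real.cosh_le_exp_half_sq l) (Real.exp_pos _).le

lemma ex_exp_le_of_bddDiff [DecidableEq σ] {p : ℝ} (h0 : 0 ≤ p) (h1 : p ≤ 1) (owner : E → σ)
    {f : (E → Bool) → ℝ} (hf : ∀ s, BddDiff owner f s) (l : ℝ) (T : Finset σ) :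
    ex p (fun ω => Real.exp (l * f ω)) ≤ Real.exp (T.card * (l ^ 2 / 2)) *
      ex p (fun ω => Real.exp (l * ex p fun ω' => f (pw {e | owner e ∉ T} ω ω'))) := by
  induction T using Finset.induction_on with
  | empty =>
    have : ∀ ω ω' : E → Bool, pw {e | owner e ∉ (∅ : Finset σ)} ω ω' = ω := fun ω ω' => by
      ext e; rw [pw_of_mem (by simp)]
    simp only [this, ex_const]
    simp
  | insert s T hs ih =>
    refine ih.trans ?_
    rw [Finset.card_insert_of_notMem hs]
    have hb : BddDiff owner (fun ω => ex p fun ω' => f (pw {e | owner e ∉ T} ω ω')) s := by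
      intro ω ω' h
      rw [← ex_sub]
      refine abs_ex_le_one h0 h1 fun ω'' => hf s _ _ fun e he => ?_
      by_cases hT : owner e ∉ T
      · rw [pw_of_mem (by exact hT), pw_of_mem (by exact hT), h e he]
      · rw [pw_of_notMem (by exact hT), pw_of_notMem (by exact hT)]
    have hstep := ex_exp_le_step h0 h1 owner hb l
    have e1 : ∀ ω, (ex p fun ω' => ex p fun ω'' =>
        f (pw {e | owner e ∉ T} (pw {e | owner e ≠ s} ω ω') ω'')) =
        ex p fun ω' => f (pw {e | owner e ∉ insert s T} ω ω') := by
      intro ω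
      rw [ex_glue p {e | owner e ∉ T} fun ω' => f (pw {e | owner e ∉ insert s T} ω ω')]
      congr 1; ext ω'; congr 1; ext ω''; congr 1; ext e
      by_cases hT : owner e ∈ T <;> by_cases hse : owner e = s <;> simp [pw, hT, hse]
    simp only [e1] at hstep
    calc _ ≤ Real.exp (T.card * (l ^ 2 / 2)) * (Real.exp (l ^ 2 / 2) * _) :=
          mul_le_mul_of_nonneg_left hstep (Real.exp_pos _).le
      _ = _ := by
          rw [← mul_assoc, ← Real.exp_add]; congr 2; push_cast; ring

/-- McDiarmid's inequality, in exponential moment form. -/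
lemma ex_exp_le_mcdiarmid [Fintype σ] {p : ℝ} (h0 : 0 ≤ p) (h1 : p ≤ 1) (owner : E → σ)
    {f : (E → Bool) → ℝ} (hf : ∀ s, BddDiff owner f s) (l : ℝ) :
    ex p (fun ω => Real.exp (l * f ω)) ≤
      Real.exp (Fintype.card σ * (l ^ 2 / 2) + l * ex p f) := by
  classical
  have h := ex_exp_le_of_bddDiff h0 h1 owner hf l Finset.univ
  have : ∀ ω ω' : E → Bool, pw {e | owner e ∉ (Finset.univ : Finset σ)} ω ω' = ω' :=
    fun ω ω' => by ext e; rw [pw_of_notMem (by simp)]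
  simp only [this, ex_const, Finset.card_univ] at h
  rwa [Real.exp_add]

lemma pr_upper_tail_le [Fintype σ] [Nonempty σ] {p : ℝ} (h0 : 0 ≤ p) (h1 : p ≤ 1) (owner : E → σ)
    {f : (E → Bool) → ℝ} (hf : ∀ s, BddDiff owner f s) {t : ℝ} (ht : 0 ≤ t) :
    pr p (fun ω => ex p f + t ≤ f ω) ≤ Real.exp (-t ^ 2 / (2 * Fintype.card σ)) := by
  have hm : (0 : ℝ) < Fintype.card σ := by exact_mod_cast Fintype.card_pos
  set m : ℝ := (Fintype.card σ : ℝ) with hmdef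
  have h := ex_exp_le_mcdiarmid h0 h1 owner hf (t / m)
  have hmk := pr_markov h0 h1 (F := fun ω => Real.exp (t / m * f ω)) (fun _ => (Real.exp_pos _).le)
    (Real.exp_pos (t / m * (ex p f + t)))
  have hle : pr p (fun ω => ex p f + t ≤ f ω) ≤
      pr p (fun ω => Real.exp (t / m * (ex p f + t)) ≤ Real.exp (t / m * f ω)) :=
    pr_mono h0 h1 fun ω hω => Real.exp_le_exp.mpr
      (mul_le_mul_of_nonneg_left hω (div_nonneg ht hm.le))
  refine hle.trans (hmk.trans ?_)
  rw [div_le_iff₀ (Real.exp_pos _), ← Real.exp_add]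
  refine h.trans (Real.exp_le_exp.mpr (le_of_eq ?_))
  rw [← hmdef]; field_simp; ring

lemma pr_lower_tail_le [Fintype σ] [Nonempty σ] {p : ℝ} (h0 : 0 ≤ p) (h1 : p ≤ 1) (owner : E → σ)
    {f : (E → Bool) → ℝ} (hf : ∀ s, BddDiff owner f s) {t : ℝ} (ht : 0 ≤ t) :
    pr p (fun ω => f ω ≤ ex p f - t) ≤ Real.exp (-t ^ 2 / (2 * Fintype.card σ)) := by
  have h := pr_upper_tail_le h0 h1 owner (f := fun ω => -f ω)
    (fun s ω ω' H => by
      have := hf s ω ω' H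
      rwa [neg_sub_neg, abs_sub_comm]) ht
  refine (pr_mono h0 h1 fun ω hω => ?_).trans h
  have : ex p (fun ω => -f ω) = - ex p f := by
    have := ex_const_mul p (-1) f
    simpa using this
  rw [this]; linarith

/-- If `f` attains the value `m` with probability more than `exp (-t²/(2m))`, where `m` is the
number of owners, then it is within `2 * t` of `m` with high probability. -/
lemma pr_ge_sub_of_bddDiff [Fintype σ] [Nonempty σ] {p : ℝ} (h0 : 0 ≤ p) (h1 : p ≤ 1)
    (owner : E → σ) {f : (E → Bool) → ℝ} (hf : ∀ s, BddDiff owner f s) {t m : ℝ} (ht : 0 ≤ t)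
    (hm : Real.exp (-t ^ 2 / (2 * Fintype.card σ)) < pr p fun ω => m ≤ f ω) :
    1 - Real.exp (-t ^ 2 / (2 * Fintype.card σ)) ≤ pr p fun ω => m - 2 * t ≤ f ω := by
  have hmean : m < ex p f + t := by
    by_contra hcon
    push Not at hcon
    refine absurd hm (not_lt.mpr ((pr_mono h0 h1 fun ω hω => ?_).trans
      (pr_upper_tail_le h0 h1 owner hf ht)))
    exact hcon.trans hω
  have h := pr_lower_tail_le h0 h1 owner hf ht
  have h2 : pr p (fun ω => ¬ (m - 2 * t ≤ f ω)) ≤ pr p (fun ω => f ω ≤ ex p f - t) :=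
    pr_mono h0 h1 fun ω hω => by push Not at hω; linarith
  rw [pr_not] at h2
  linarith

end BoundedDifferences

section Pairs

open Finset

variable {V : Type*} [DecidableEq V]

/-- The unordered pairs of distinct elements of `D`. -/
def prs (D : Finset V) : Finset (Sym2 V) := D.offDiag.image fun q => s(q.1, q.2)

lemma mem_prs {D : Finset V} {u v : V} : s(u, v) ∈ prs D ↔ u ∈ D ∧ v ∈ D ∧ u ≠ v := by
  simp only [prs, mem_image, mem_offDiag, Prod.exists, Sym2.eq_iff]
  constructor
  · rintro ⟨a, b, ⟨ha, hb, hab⟩, (⟨rfl, rfl⟩ | ⟨rfl, rfl⟩)⟩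
    exacts [⟨ha, hb, hab⟩, ⟨hb, ha, hab.symm⟩]
  · rintro ⟨hu, hv, huv⟩
    exact ⟨u, v, ⟨hu, hv, huv⟩, .inl ⟨rfl, rfl⟩⟩

lemma card_prs (D : Finset V) : #(prs D) = (#D).choose 2 := Sym2.card_image_offDiag D

lemma prs_inter (D D' : Finset V) : prs D ∩ prs D' = prs (D ∩ D') := by
  ext e
  induction e with | _ u v =>
  simp only [mem_inter, mem_prs]; tauto

lemma prs_mono {D D' : Finset V} (h : D ⊆ D') : prs D ⊆ prs D' := by
  intro e
  induction e with | _ u v =>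
  simp only [mem_prs]
  rintro ⟨hu, hv, huv⟩
  exact ⟨h hu, h hv, huv⟩

/-- No pair in `D` is present. -/
def Indep (D : Finset V) (ω : Sym2 V → Bool) : Prop := ∀ e ∈ prs D, ω e = false

lemma Indep.mono {D D' : Finset V} (h : D ⊆ D') {ω : Sym2 V → Bool} (hI : Indep D' ω) :
    Indep D ω := fun e he => hI e (prs_mono h he)

variable [Fintype V]

lemma pr_indep (p : ℝ) (D : Finset V) : pr p (Indep D) = (1 - p) ^ (#D).choose 2 := by
  rw [← card_prs, ← pr_all_false]; rfl

lemma pr_indep_and (p : ℝ) (D D' : Finset V) :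
    pr p (fun ω => Indep D ω ∧ Indep D' ω) * (1 - p) ^ (#(D ∩ D')).choose 2 =
      (1 - p) ^ (#D).choose 2 * (1 - p) ^ (#D').choose 2 := by
  have : pr p (fun ω => Indep D ω ∧ Indep D' ω) = (1 - p) ^ #(prs D ∪ prs D') := by
    rw [← pr_all_false]
    congr 1; ext ω
    simp only [Indep, mem_union]
    exact ⟨fun h e he => he.elim (h.1 e) (h.2 e), fun h => ⟨fun e he => h e (.inl he),
      fun e he => h e (.inr he)⟩⟩
  rw [this, ← pow_add, ← pow_add, ← card_prs, ← card_prs, ← card_prs, ← prs_inter,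
    card_union_add_card_inter]

end Pairs

section Transversals

open Finset

variable {V σ : Type*} [DecidableEq V] {b : ℕ}

/-- The points selected by `r` in the blocks indexed by `J`. -/
def selected (B : σ → Fin b → V) (J : Finset σ) (r : σ → Fin b) : Finset V :=
  J.image fun s => B s (r s)

lemma card_selected {B : σ → Fin b → V} (hB : Function.Injective fun q : σ × Fin b => B q.1 q.2)
    (J : Finset σ) (r : σ → Fin b) : #(selected B J r) = #J := by
  refine card_image_of_injective _ fun s t h => ?_
  exact congrArg Prod.fst (@hB (s, r s) (t, r t) h)

variable [Fintype σ]

open scoped Classical in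
/-- The largest number of blocks admitting an independent partial transversal. -/
def maxTransversal (B : σ → Fin b → V) (ω : Sym2 V → Bool) : ℕ :=
  (Finset.univ.filter fun J : Finset σ => ∃ r, Indep (selected B J r) ω).sup Finset.card

lemma card_le_maxTransversal {B : σ → Fin b → V} {ω : Sym2 V → Bool} {J : Finset σ}
    {r : σ → Fin b} (h : Indep (selected B J r) ω) : #J ≤ maxTransversal B ω := by
  classical
  exact Finset.le_sup (f := Finset.card) (by simpa using ⟨r, h⟩)

lemma exists_of_le_maxTransversal {B : σ → Fin b → V} {ω : Sym2 V → Bool} (hb : 0 < b) {k : ℕ}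
    (h : k ≤ maxTransversal B ω) : ∃ J r, k ≤ #J ∧ Indep (selected B J r) ω := by
  classical
  have hne : (Finset.univ.filter fun J : Finset σ => ∃ r, Indep (selected B J r) ω).Nonempty :=
    ⟨∅, by simpa using ⟨fun _ => ⟨0, hb⟩, by simp [Indep, selected, prs]⟩⟩
  obtain ⟨J, hJ, hJ'⟩ := Finset.exists_mem_eq_sup _ hne Finset.card
  obtain ⟨r, hr⟩ := (Finset.mem_filter.mp hJ).2
  exact ⟨J, r, h.trans hJ'.le, hr⟩

omit [DecidableEq V] [Fintype σ] in
lemma exists_owner [Nonempty σ] {B : σ → Fin b → V}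
    (hB : Function.Injective fun q : σ × Fin b => B q.1 q.2) :
    ∃ owner : Sym2 V → σ, ∀ s c t d, s ≠ t → owner s(B s c, B t d) = s ∨
      owner s(B s c, B t d) = t := by
  classical
  refine ⟨fun e => if h : ∃ s c, B s c ∈ e then h.choose else Classical.arbitrary σ, ?_⟩
  intro s c t d _
  have h : ∃ s' c', B s' c' ∈ s(B s c, B t d) := ⟨s, c, by simp⟩
  simp only [dif_pos h]
  obtain ⟨c', hc'⟩ := h.choose_spec
  rcases Sym2.mem_iff.mp hc' with h' | h'
  · exact .inl (congrArg Prod.fst (@hB (_, c') (s, c) h'))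
  · exact .inr (congrArg Prod.fst (@hB (_, c') (t, d) h'))

lemma maxTransversal_le_add_one [DecidableEq σ] {B : σ → Fin b → V} (hb : 0 < b)
    {owner : Sym2 V → σ}
    (ho : ∀ s c t d, s ≠ t → owner s(B s c, B t d) = s ∨ owner s(B s c, B t d) = t) (s : σ)
    {ω ω' : Sym2 V → Bool} (h : ∀ e, owner e ≠ s → ω e = ω' e) :
    maxTransversal B ω ≤ maxTransversal B ω' + 1 := by
  obtain ⟨J, r, hJ, hI⟩ := exists_of_le_maxTransversal hb (le_refl (maxTransversal B ω))
  have hI' : Indep (selected B (J.erase s) r) ω' := by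
    intro e
    induction e with | _ u v =>
    rw [mem_prs]
    rintro ⟨hu, hv, huv⟩
    obtain ⟨t, ht, rfl⟩ := mem_image.mp hu
    obtain ⟨t', ht', rfl⟩ := mem_image.mp hv
    have htt : t ≠ t' := fun h => huv (by rw [h])
    rw [mem_erase] at ht ht'
    rw [← h]
    · exact hI _ (mem_prs.mpr ⟨mem_image_of_mem _ ht.2, mem_image_of_mem _ ht'.2, huv⟩)
    · rcases ho t (r t) t' (r t') htt with h | h
      · rw [h]; exact ht.1
      · rw [h]; exact ht'.1
  have h1 := card_le_maxTransversal hI'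
  have h2 := Finset.pred_card_le_card_erase (s := J) (a := s)
  omega

lemma selected_inter [DecidableEq σ] {B : σ → Fin b → V}
    (hB : Function.Injective fun q : σ × Fin b => B q.1 q.2) (r r' : σ → Fin b) :
    #(selected B univ r ∩ selected B univ r') = #{s | r s = r' s} := by
  rw [← card_selected hB ({s | r s = r' s} : Finset σ) r]
  congr 1
  ext v
  simp only [selected, mem_inter, mem_image, mem_univ, true_and, mem_filter]
  constructor
  · rintro ⟨⟨s, hs⟩, ⟨s', hs'⟩⟩
    have h := @hB (s, r s) (s', r' s') (hs.trans hs'.symm)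
    simp only [Prod.mk.injEq] at h
    obtain ⟨rfl, h⟩ := h
    exact ⟨s, h, hs⟩
  · rintro ⟨s, h, hs⟩
    exact ⟨⟨s, hs⟩, ⟨s, by rw [← h]; exact hs⟩⟩

lemma pow_le_prod_ite [DecidableEq σ] {q y : ℝ} (hq0 : 0 < q) (hy : 1 ≤ y)
    (hqy : 1 ≤ y ^ 2 * q ^ Fintype.card σ) (hq1 : q ≤ 1) (A : Finset σ) :
    1 ≤ y ^ #A * q ^ (#A).choose 2 := by
  have hy0 : 0 < y := by linarith
  have h2 : (1 : ℝ) ≤ (y ^ #A * q ^ (#A).choose 2) ^ 2 := by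
    have hc : (#A).choose 2 * 2 = #A * (#A - 1) := Nat.choose_two_right _ ▸
      Nat.div_mul_cancel (Nat.even_mul_pred_self _).two_dvd
    have : (y ^ #A * q ^ (#A).choose 2) ^ 2 = (y ^ 2 * q ^ (#A - 1)) ^ #A := by
      rw [mul_pow, mul_pow, ← pow_mul, ← pow_mul, ← pow_mul, ← pow_mul, hc, mul_comm 2,
        mul_comm (#A) (#A - 1)]
    rw [this]
    refine one_le_pow₀ (hqy.trans (mul_le_mul_of_nonneg_left ?_ (by positivity)))
    exact pow_le_pow_of_le_one hq0.le hq1 (by have := Finset.card_le_univ A; omega)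
  by_contra hcon
  push Not at hcon
  have : 0 ≤ y ^ #A * q ^ (#A).choose 2 := by positivity
  nlinarith

variable [Fintype V] [DecidableEq σ]

/-- Second moment bound for the existence of a full independent transversal. -/
lemma pow_le_pr_transversal {p y : ℝ} (h0 : 0 ≤ p) (h1 : p < 1) {B : σ → Fin b → V}
    (hB : Function.Injective fun q : σ × Fin b => B q.1 q.2) (hb : 0 < b) (hy : 1 ≤ y)
    (hqy : 1 ≤ y ^ 2 * (1 - p) ^ Fintype.card σ) :
    (b : ℝ) ^ Fintype.card σ ≤ pr p (fun ω => (Fintype.card σ : ℝ) ≤ maxTransversal B ω) *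
      (b + y) ^ Fintype.card σ := by
  set m := Fintype.card σ with hm
  set q := 1 - p with hq
  have hq0 : 0 < q := by rw [hq]; linarith
  have hq1 : q ≤ 1 := by rw [hq]; linarith
  set X : (Sym2 V → Bool) → ℝ := fun ω => ∑ r : σ → Fin b, ind (Indep (selected B univ r) ω)
    with hX
  have hEX : ex p X = b ^ m * q ^ m.choose 2 := by
    rw [hX, ex_sum]
    have : ∀ r : σ → Fin b, ex p (fun ω => ind (Indep (selected B univ r) ω)) = q ^ m.choose 2 := by
      intro r
      have := pr_indep p (selected B univ r)
      rwa [card_selected hB, card_univ] at this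
    rw [Finset.sum_congr rfl fun r _ => this r, sum_const, nsmul_eq_mul, card_univ,
      Fintype.card_fun, Fintype.card_fin]
    push_cast; rfl
  have hEX2 : ex p (fun ω => X ω ^ 2) ≤ b ^ m * (q ^ m.choose 2) ^ 2 * (b + y) ^ m := by
    have e1 : ∀ ω, X ω ^ 2 = ∑ r : σ → Fin b, ∑ r' : σ → Fin b,
        ind (Indep (selected B univ r) ω ∧ Indep (selected B univ r') ω) := by
      intro ω; rw [sq, hX, Finset.sum_mul_sum]; simp only [ind_and]
    rw [funext e1, ex_sum]
    have e2 : ∀ r r' : σ → Fin b,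
        ex p (fun ω => ind (Indep (selected B univ r) ω ∧ Indep (selected B univ r') ω)) ≤
        (q ^ m.choose 2) ^ 2 * ∏ s, (if r s = r' s then y else 1) := by
      intro r r'
      have h := pr_indep_and p (selected B univ r) (selected B univ r')
      rw [card_selected hB, card_selected hB, selected_inter hB, card_univ, ← hq, ← hm] at h
      have h' := pow_le_prod_ite hq0 hy hqy hq1 ({s | r s = r' s} : Finset σ)
      rw [Finset.prod_ite, prod_const, prod_const_one, mul_one, sq]
      set A := #({s | r s = r' s} : Finset σ)
      change pr p (fun ω => Indep (selected B univ r) ω ∧ Indep (selected B univ r') ω) ≤ _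
      set P := pr p (fun ω => Indep (selected B univ r) ω ∧ Indep (selected B univ r') ω)
      have hP : 0 ≤ P := pr_nonneg h0 h1.le _
      calc P ≤ P * (y ^ A * q ^ A.choose 2) := le_mul_of_one_le_right hP h'
        _ = (P * q ^ A.choose 2) * y ^ A := by ring
        _ = _ := by rw [h]
    have e3 : ∀ r : σ → Fin b, ∑ r' : σ → Fin b, ∏ s, (if r s = r' s then y else 1) ≤
        (b + y) ^ m := by
      intro r
      have h := Finset.prod_univ_sum (fun _ : σ => (Finset.univ : Finset (Fin b)))
        (fun s c => if r s = c then y else (1 : ℝ))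
      rw [Fintype.piFinset_univ] at h
      rw [← h, hm, ← card_univ, ← prod_const]
      refine Finset.prod_le_prod (fun s _ => Finset.sum_nonneg fun c _ => by
        split_ifs <;> linarith) fun s _ => ?_
      calc ∑ c : Fin b, (if r s = c then y else (1 : ℝ))
          ≤ ∑ c : Fin b, (1 + if r s = c then y else (0 : ℝ)) :=
            Finset.sum_le_sum fun c _ => by split_ifs <;> linarith
        _ = b + y := by rw [Finset.sum_add_distrib]; simp
    calc _ ≤ ∑ r : σ → Fin b, (q ^ m.choose 2) ^ 2 * (b + y) ^ m := by
          refine Finset.sum_le_sum fun r _ => ?_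
          rw [ex_sum]
          refine (Finset.sum_le_sum fun r' _ => e2 r r').trans ?_
          rw [← Finset.mul_sum]
          exact mul_le_mul_of_nonneg_left (e3 r) (by positivity)
      _ = _ := by
        rw [sum_const, nsmul_eq_mul, card_univ, Fintype.card_fun, Fintype.card_fin]
        push_cast; ring
  have hcs := sq_ex_le_pr_ne_zero h0 h1.le X
  have hle : pr p (fun ω => X ω ≠ 0) ≤ pr p (fun ω => (m : ℝ) ≤ maxTransversal B ω) := by
    refine pr_mono h0 h1.le fun ω hω => ?_
    obtain ⟨r, _, hr⟩ := Finset.exists_ne_zero_of_sum_ne_zero hω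
    have hI : Indep (selected B univ r) ω := by
      by_contra hcon; exact hr (ind_of_not hcon)
    have := card_le_maxTransversal hI
    rw [card_univ] at this
    exact_mod_cast this
  rw [hEX] at hcs
  set P := pr p (fun ω => (m : ℝ) ≤ maxTransversal B ω)
  have hb0 : (0 : ℝ) < b := by exact_mod_cast hb
  have hpos : 0 < (b : ℝ) ^ m * (q ^ m.choose 2) ^ 2 := by positivity
  have : (b ^ m * (q ^ m.choose 2) ^ 2) * (b : ℝ) ^ m ≤
      (b ^ m * (q ^ m.choose 2) ^ 2) * (P * (b + y) ^ m) := by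
    calc _ = (b ^ m * q ^ m.choose 2) ^ 2 := by ring
      _ ≤ _ := hcs
      _ ≤ P * (b ^ m * (q ^ m.choose 2) ^ 2 * (b + y) ^ m) := by
        have hnn : 0 ≤ ex p fun ω => X ω ^ 2 := ex_nonneg h0 h1.le fun ω => sq_nonneg _
        have := pr_nonneg h0 h1.le (fun ω => X ω ≠ 0)
        exact mul_le_mul hle hEX2 hnn (this.trans hle)
      _ = _ := by ring
  exact le_of_mul_le_mul_left this hpos

/-- Almost full independent transversals exist with high probability. -/
lemma pr_almost_transversal [Nonempty σ] {p y t : ℝ} (h0 : 0 ≤ p) (h1 : p < 1)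
    {B : σ → Fin b → V}
    (hB : Function.Injective fun q : σ × Fin b => B q.1 q.2) (hb : 0 < b) (hy : 1 ≤ y)
    (hqy : 1 ≤ y ^ 2 * (1 - p) ^ Fintype.card σ) (ht : 0 ≤ t)
    (hty : 2 * (Fintype.card σ : ℝ) ^ 2 * y < t ^ 2 * b) :
    1 - Real.exp (-t ^ 2 / (2 * Fintype.card σ)) ≤
      pr p (fun ω => ∃ J r, (Fintype.card σ : ℝ) - 2 * t ≤ #J ∧ Indep (selected B J r) ω) := by
  obtain ⟨owner, ho⟩ := exists_owner hB
  have hbd : ∀ s, BddDiff owner (fun ω => (maxTransversal B ω : ℝ)) s := by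
    intro s ω ω' h
    have h1 := maxTransversal_le_add_one hb ho s h
    have h2 := maxTransversal_le_add_one hb ho s fun e he => (h e he).symm
    have h1' : (maxTransversal B ω : ℝ) ≤ maxTransversal B ω' + 1 := by exact_mod_cast h1
    have h2' : (maxTransversal B ω' : ℝ) ≤ maxTransversal B ω + 1 := by exact_mod_cast h2
    rw [abs_le]; constructor <;> linarith
  have hb0 : (0 : ℝ) < b := by exact_mod_cast hb
  have hm : (0 : ℝ) < Fintype.card σ := by exact_mod_cast Fintype.card_pos
  have hlow : Real.exp (-t ^ 2 / (2 * Fintype.card σ)) <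
      pr p fun ω => (Fintype.card σ : ℝ) ≤ maxTransversal B ω := by
    have h := pow_le_pr_transversal h0 h1 hB hb hy hqy
    set P := pr p (fun ω => (Fintype.card σ : ℝ) ≤ maxTransversal B ω)
    have hby : 0 < (b : ℝ) + y := by linarith
    have h3 : ((b : ℝ) / (b + y)) ^ Fintype.card σ ≤ P := by
      rw [div_pow, div_le_iff₀ (by positivity)]; exact h
    refine lt_of_lt_of_le ?_ h3
    have h4 : Real.exp (-(y / b)) ≤ b / (b + y) := by
      rw [Real.exp_neg, ← one_div, div_le_div_iff₀ (Real.exp_pos _) hby, one_mul]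
      have := Real.add_one_le_exp (y / b)
      calc (b : ℝ) + y = b * (y / b + 1) := by field_simp; ring
        _ ≤ _ := mul_le_mul_of_nonneg_left this hb0.le
    refine lt_of_lt_of_le ?_ (pow_le_pow_left₀ (Real.exp_pos _).le h4 _)
    rw [← Real.exp_nat_mul, Real.exp_lt_exp, div_lt_iff₀ (by positivity)]
    have : (Fintype.card σ : ℝ) * -(y / b) * (2 * Fintype.card σ) =
        -(2 * (Fintype.card σ : ℝ) ^ 2 * y) / b := by field_simp
    rw [this, lt_div_iff₀ hb0]
    linarith
  refine (pr_ge_sub_of_bddDiff h0 h1.le owner hbd ht hlow).trans (pr_mono h0 h1.le fun ω hω => ?_)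
  obtain ⟨J, r, hJ, hI⟩ := exists_of_le_maxTransversal hb (le_refl (maxTransversal B ω))
  exact ⟨J, r, hω.trans (by exact_mod_cast hJ), hI⟩

end Transversals

section LabelCount

open Finset

variable {V I A : Type*} [Fintype V] [DecidableEq V] [Fintype I] [DecidableEq I]
  [Fintype A] [DecidableEq A] {N b t₀ : ℕ}

/-- The depth of a slot: a slot is either an index or one of `t₀` spare slots at a given depth. -/
def slotDepth (d : I → A) : I ⊕ A × Fin t₀ → A := Sum.elim d Prod.fst

omit [Fintype V] [DecidableEq V] in
lemma exists_depth_injection (d : I → A) (J : Finset (I ⊕ A × Fin t₀)) (hJ : #Jᶜ ≤ t₀) :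
    ∃ c : I → I ⊕ A × Fin t₀, Function.Injective c ∧ (∀ i, c i ∈ J) ∧
      ∀ i, slotDepth d (c i) = d i := by
  have hcard : ∀ k : A, Fintype.card {i // d i = k} ≤
      Fintype.card {s // s ∈ J ∧ slotDepth d s = k} := by
    intro k
    have h1 : Fintype.card ({i // d i = k} ⊕ Fin t₀) ≤
        Fintype.card {s : I ⊕ A × Fin t₀ // slotDepth d s = k} := by
      refine Fintype.card_le_of_injective (Sum.elim (fun i => ⟨.inl i.1, i.2⟩)
        fun t => ⟨.inr (k, t), rfl⟩) ?_
      rintro (i | t) (i' | t') h <;> have h := congrArg Subtype.val h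
      · exact congrArg _ (Subtype.ext (Sum.inl_injective h))
      · exact absurd h Sum.inl_ne_inr
      · exact absurd h Sum.inr_ne_inl
      · exact congrArg _ (congrArg Prod.snd (Sum.inr_injective h))
    have h2 : #{s | slotDepth (t₀ := t₀) d s = k} ≤ #{s ∈ J | slotDepth d s = k} + #Jᶜ := by
      rw [← card_union_of_disjoint]
      · refine card_le_card fun s hs => ?_
        by_cases hsJ : s ∈ J <;> simp_all
      · rw [disjoint_left]; intro s hs; simp at hs; simp [hs.1]
    rw [Fintype.card_sum, Fintype.card_fin, Fintype.card_subtype, Fintype.card_subtype] at h1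
    rw [Fintype.card_subtype, Fintype.card_subtype]
    have h3 : #{s | s ∈ J ∧ slotDepth d s = k} = #{s ∈ J | slotDepth d s = k} := by
      congr 1; ext s; simp
    omega
  have hemb : ∀ k : A, Nonempty ({i // d i = k} ↪ {s // s ∈ J ∧ slotDepth d s = k}) :=
    fun k => Function.Embedding.nonempty_of_card_le (hcard k)
  let emb := fun k => (hemb k).some
  have hd : ∀ i, slotDepth d (emb (d i) ⟨i, rfl⟩).1 = d i := fun i => (emb (d i) ⟨i, rfl⟩).2.2
  refine ⟨fun i => (emb (d i) ⟨i, rfl⟩).1, fun i j h => ?_, fun i => (emb (d i) ⟨i, rfl⟩).2.1, hd⟩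
  have hij : d i = d j := by rw [← hd i, ← hd j]; simp only at h; rw [h]
  have key : ∀ (k : A) (h1 : d i = k) (h2 : d j = k), (emb k ⟨i, h1⟩).1 = (emb k ⟨j, h2⟩).1 →
      i = j := fun k h1 h2 h => congrArg Subtype.val ((emb k).injective (Subtype.ext h))
  refine key (d i) rfl hij.symm (h.trans ?_)
  have : ∀ (k : A) (h : d j = k), (emb (d j) ⟨j, rfl⟩).1 = (emb k ⟨j, h⟩).1 := by
    rintro k rfl; rfl
  exact this _ _

omit [Fintype V] [DecidableEq V] [DecidableEq I] in
lemma card_perm_prescribed_le {φ L : I → Fin N} (hφ : Function.Injective φ) :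
    #{τ : Equiv.Perm (Fin N) | ∀ i, τ (φ i) = L i} ≤ (N - Fintype.card I).factorial := by
  classical
  by_cases hne : ∃ τ₀ : Equiv.Perm (Fin N), ∀ i, τ₀ (φ i) = L i
  swap
  · push Not at hne
    rw [Finset.filter_false_of_mem]
    · simp
    · intro τ _; push Not; exact hne τ
  obtain ⟨τ₀, h₀⟩ := hne
  have hiff : ∀ τ : Equiv.Perm (Fin N), (∀ i, τ (φ i) = L i) →
      ∀ x, x ∉ Set.range φ ↔ τ x ∉ Set.range L := by
    intro τ h x
    rw [not_iff_not]
    constructor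
    · rintro ⟨i, rfl⟩; exact ⟨i, (h i).symm⟩
    · rintro ⟨i, hi⟩; exact ⟨i, τ.injective (by rw [h i, hi])⟩
  have hcard : Fintype.card {x // x ∉ Set.range φ} = N - Fintype.card I := by
    rw [Fintype.card_subtype_compl, Fintype.card_fin]
    congr 1
    exact Set.card_range_of_injective hφ
  rw [← hcard, ← Fintype.card_equiv (τ₀.subtypeEquiv (p := fun x => x ∉ Set.range φ)
    (q := fun x => x ∉ Set.range L) (hiff τ₀ h₀)), ← Fintype.card_coe]
  refine Fintype.card_le_of_injective
    (fun τ => τ.1.subtypeEquiv (p := fun x => x ∉ Set.range φ)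
      (q := fun x => x ∉ Set.range L) (hiff τ.1 (Finset.mem_filter.mp τ.2).2)) ?_
  intro τ τ' h
  refine Subtype.ext (Equiv.ext fun x => ?_)
  by_cases hx : x ∈ Set.range φ
  · obtain ⟨i, rfl⟩ := hx
    rw [(Finset.mem_filter.mp τ.2).2 i, (Finset.mem_filter.mp τ'.2).2 i]
  · exact congrArg Subtype.val (Equiv.congr_fun h ⟨x, hx⟩)

/-- The admissible labellings: injective with independent image. -/
def labellings (ν : A → Fin N → V) (d : I → A) (ω : Sym2 V → Bool) : Finset (I → Fin N) :=
  open scoped Classical in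
  {L | (Function.Injective fun i => ν (d i) (L i)) ∧ Indep (univ.image fun i => ν (d i) (L i)) ω}

/-- The blocks obtained by permuting the pools. -/
def permBlock (ν : A → Fin N → V) (d : I → A) (e : (I ⊕ A × Fin t₀) × Fin b ↪ Fin N)
    (τ : Equiv.Perm (Fin N)) (s : I ⊕ A × Fin t₀) (c : Fin b) : V :=
  ν (slotDepth d s) (τ (e (s, c)))

omit [Fintype V] [DecidableEq V] [Fintype I] [DecidableEq I] [Fintype A] [DecidableEq A] in
lemma permBlock_injective {ν : A → Fin N → V}
    (hν : Function.Injective fun q : A × Fin N => ν q.1 q.2) (d : I → A)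
    (e : (I ⊕ A × Fin t₀) × Fin b ↪ Fin N) (τ : Equiv.Perm (Fin N)) :
    Function.Injective fun q : (I ⊕ A × Fin t₀) × Fin b => permBlock ν d e τ q.1 q.2 := by
  intro q q' h
  have h1 := @hν (slotDepth d q.1, τ (e q)) (slotDepth d q'.1, τ (e q')) h
  simp only [Prod.mk.injEq] at h1
  exact e.injective (τ.injective h1.2)

omit [Fintype V] in
/-- If many permuted block systems have almost full independent transversals, then there are many
admissible labellings. -/
lemma card_perm_good_le {ν : A → Fin N → V}
    (hν : Function.Injective fun q : A × Fin N => ν q.1 q.2) (d : I → A)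
    (e : (I ⊕ A × Fin t₀) × Fin b ↪ Fin N) (ω : Sym2 V → Bool)
    (good : Finset (Equiv.Perm (Fin N)))
    (hgood : ∀ τ ∈ good, ∃ J r, #Jᶜ ≤ t₀ ∧ Indep (selected (permBlock ν d e τ) J r) ω) :
    #good ≤ #(labellings ν d ω) * (2 * b) ^ Fintype.card (I ⊕ A × Fin t₀) *
      (N - Fintype.card I).factorial := by
  classical
  have hc : ∀ J : Finset (I ⊕ A × Fin t₀), ∃ c : I → I ⊕ A × Fin t₀, Function.Injective c ∧
      (#Jᶜ ≤ t₀ → (∀ i, c i ∈ J) ∧ ∀ i, slotDepth d (c i) = d i) := by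
    intro J
    by_cases hJ : #Jᶜ ≤ t₀
    · obtain ⟨c, h1, h2⟩ := exists_depth_injection d J hJ
      exact ⟨c, h1, fun _ => h2⟩
    · exact ⟨Sum.inl, Sum.inl_injective, fun h => absurd h hJ⟩
  choose c hcinj hc using hc
  have hsub : good ⊆ (labellings ν d ω ×ˢ (univ : Finset (Finset (I ⊕ A × Fin t₀))) ×ˢ
      (univ : Finset (I ⊕ A × Fin t₀ → Fin b))).biUnion fun q =>
        {τ : Equiv.Perm (Fin N) | ∀ i, τ (e (c q.2.1 i, q.2.2 (c q.2.1 i))) = q.1 i} := by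
    intro τ hτ
    obtain ⟨J, r, hJ, hI⟩ := hgood τ hτ
    obtain ⟨h1, h2⟩ := hc J hJ
    have heq : ∀ i, ν (d i) (τ (e (c J i, r (c J i)))) =
        permBlock ν d e τ (c J i) (r (c J i)) := by
      intro i; rw [permBlock, h2]
    rw [mem_biUnion]
    refine ⟨(fun i => τ (e (c J i, r (c J i))), J, r), ?_, by simp⟩
    simp only [mem_product, mem_univ, and_self, and_true, labellings, mem_filter, true_and]
    constructor
    · intro i j hij
      simp only [heq] at hij
      have := @permBlock_injective _ _ _ _ _ _ ν hν d e τ (c J i, r (c J i)) (c J j, r (c J j)) hij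
      exact hcinj J (congrArg Prod.fst this)
    · refine hI.mono fun v hv => ?_
      obtain ⟨i, _, rfl⟩ := mem_image.mp hv
      simp only [heq]
      exact mem_image_of_mem _ (h1 i)
  refine (card_le_card hsub).trans ((card_biUnion_le_card_mul _ _ (N - Fintype.card I).factorial
    fun q _ => ?_).trans (le_of_eq ?_))
  · exact card_perm_prescribed_le (φ := fun i => e (c q.2.1 i, q.2.2 (c q.2.1 i)))
      fun i j h => hcinj q.2.1 (congrArg Prod.fst (e.injective h))
  · rw [card_product, card_product, card_univ, card_univ, Fintype.card_finset, Fintype.card_fun,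
      Fintype.card_fin, mul_pow]

/-- With high probability there are many admissible labellings. -/
lemma pr_labellings_ge [Nonempty I] {p y t : ℝ} (h0 : 0 ≤ p) (h1 : p < 1) {ν : A → Fin N → V}
    (hν : Function.Injective fun q : A × Fin N => ν q.1 q.2) (d : I → A) {m : ℕ}
    (hm : m = Fintype.card I + Fintype.card A * t₀) (hN : m * b ≤ N) (hb : 0 < b) (hy : 1 ≤ y)
    (hqy : 1 ≤ y ^ 2 * (1 - p) ^ m) (ht : 0 ≤ t) (htt : 2 * t ≤ t₀)
    (hty : 2 * (m : ℝ) ^ 2 * y < t ^ 2 * b) (hIN : 2 * Fintype.card I ≤ N) :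
    1 - 2 * Real.exp (-t ^ 2 / (2 * m)) ≤ pr p (fun ω => ((N : ℝ) / 2) ^ Fintype.card I ≤
      2 * (2 * b) ^ m * #(labellings ν d ω)) := by
  classical
  have hcard : Fintype.card (I ⊕ A × Fin t₀) = m := by
    rw [Fintype.card_sum, Fintype.card_prod, Fintype.card_fin, hm]
  obtain ⟨e⟩ : Nonempty ((I ⊕ A × Fin t₀) × Fin b ↪ Fin N) :=
    Function.Embedding.nonempty_of_card_le (by
      rw [Fintype.card_prod, hcard, Fintype.card_fin, Fintype.card_fin]; exact hN)
  set Q : Equiv.Perm (Fin N) → (Sym2 V → Bool) → Prop := fun τ ω =>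
    ∃ J r, (m : ℝ) - 2 * t ≤ #J ∧ Indep (selected (permBlock ν d e τ) J r) ω with hQ
  set ε := Real.exp (-t ^ 2 / (2 * m)) with hε
  have hQp : ∀ τ, 1 - ε ≤ pr p (Q τ) := by
    intro τ
    have := pr_almost_transversal h0 h1 (permBlock_injective hν d e τ) hb hy (t := t)
      (by rw [hcard]; exact hqy) ht (by rw [hcard]; exact hty)
    simpa only [hcard] using this
  set F : (Sym2 V → Bool) → ℝ := fun ω => ∑ τ : Equiv.Perm (Fin N), ind (¬ Q τ ω) with hF
  have hfac : (0 : ℝ) < N.factorial := by exact_mod_cast N.factorial_pos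
  have hEF : ex p F ≤ N.factorial * ε := by
    rw [hF, ex_sum]
    have : ∀ τ : Equiv.Perm (Fin N), ex p (fun ω => ind (¬ Q τ ω)) ≤ ε := by
      intro τ
      have h2 := pr_not p (Q τ)
      rw [pr] at h2
      rw [h2]; linarith [hQp τ]
    refine (Finset.sum_le_sum fun τ _ => this τ).trans (le_of_eq ?_)
    rw [sum_const, nsmul_eq_mul, card_univ, Fintype.card_perm, Fintype.card_fin]
  have hmk := pr_markov h0 h1.le (F := F) (fun ω => Finset.sum_nonneg fun _ _ => ind_nonneg _)
    (t := N.factorial / 2) (by positivity)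
  have hmk' : pr p (fun ω => (N.factorial : ℝ) / 2 ≤ F ω) ≤ 2 * ε := by
    refine hmk.trans ?_
    rw [div_le_iff₀ (by positivity)]; linarith
  have hnot := pr_not p (fun ω => (N.factorial : ℝ) / 2 ≤ F ω)
  have : 1 - 2 * ε ≤ pr p (fun ω => ¬ ((N.factorial : ℝ) / 2 ≤ F ω)) := by linarith
  refine this.trans (pr_mono h0 h1.le fun ω hω => ?_)
  push Not at hω
  have hsum : (#{τ | Q τ ω} : ℝ) + F ω = N.factorial := by
    rw [← sum_ind_eq_card, hF, ← Finset.sum_add_distrib]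
    simp only [ind_not, add_sub_cancel, sum_const, nsmul_eq_mul, mul_one, card_univ,
      Fintype.card_perm, Fintype.card_fin]
  have hle := card_perm_good_le hν d e ω {τ | Q τ ω} (by
    intro τ hτ
    obtain ⟨J, r, hJ, hI⟩ := (mem_filter.mp hτ).2
    refine ⟨J, r, ?_, hI⟩
    rw [card_compl, hcard]
    have h3 : (m : ℝ) ≤ #J + t₀ := by linarith
    have h4 : m ≤ #J + t₀ := by exact_mod_cast h3
    omega)
  rw [hcard] at hle
  set w := Fintype.card I
  have hle' : (#{τ | Q τ ω} : ℝ) ≤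
      #(labellings ν d ω) * (2 * b) ^ m * (N - w).factorial := by exact_mod_cast hle
  have hdf : (N - w).factorial * N.descFactorial w = N.factorial :=
    Nat.factorial_mul_descFactorial (by omega)
  have hdf' : ((N - w).factorial : ℝ) * N.descFactorial w = N.factorial := by exact_mod_cast hdf
  have hpow : ((N : ℝ) / 2) ^ w ≤ N.descFactorial w := by
    have h5 := Nat.pow_sub_le_descFactorial N w
    have h6 : ((N + 1 - w : ℕ) : ℝ) ^ w ≤ N.descFactorial w := by exact_mod_cast h5
    refine (pow_le_pow_left₀ (by positivity) ?_ w).trans h6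
    rw [div_le_iff₀ (by norm_num)]
    have : N ≤ (N + 1 - w) * 2 := by omega
    exact_mod_cast this
  have hf2 : (0 : ℝ) < (N - w).factorial := by exact_mod_cast (N - w).factorial_pos
  refine le_of_mul_le_mul_left (a := ((N - w).factorial : ℝ)) ?_ hf2
  calc ((N - w).factorial : ℝ) * ((N : ℝ) / 2) ^ w
      ≤ (N - w).factorial * N.descFactorial w := mul_le_mul_of_nonneg_left hpow hf2.le
    _ = N.factorial := hdf'
    _ ≤ 2 * #{τ | Q τ ω} := by linarith
    _ ≤ 2 * (#(labellings ν d ω) * (2 * b) ^ m * (N - w).factorial) := by linarith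
    _ = _ := by ring

end LabelCount

section Exposure

open Finset

variable {V : Type*} [DecidableEq V]

/-- The pairs joining `v` to the elements of `U`. -/
def spokes (v : V) (U : Finset V) : Finset (Sym2 V) := U.image fun u => s(v, u)

lemma mem_spokes {v : V} {U : Finset V} {e : Sym2 V} : e ∈ spokes v U ↔ ∃ u ∈ U, s(v, u) = e := by
  simp [spokes]

lemma card_spokes (v : V) (U : Finset V) : #(spokes v U) = #U := by
  refine card_image_of_injOn fun u _ w _ h => ?_
  simp only [Sym2.eq_iff] at h
  rcases h with ⟨_, h⟩ | ⟨h1, h2⟩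
  · exact h
  · rw [h2, h1]

lemma disjoint_spokes {v v' : V} {U U' : Finset V} (h : v ≠ v') (hv : v ∉ U') :
    Disjoint (spokes v U) (spokes v' U') := by
  rw [disjoint_left]
  intro e he he'
  obtain ⟨u, hu, rfl⟩ := mem_spokes.mp he
  obtain ⟨u', hu', heq⟩ := mem_spokes.mp he'
  rw [Sym2.eq_iff] at heq
  rcases heq with ⟨h1, _⟩ | ⟨_, h2⟩
  · exact h h1.symm
  · exact hv (h2 ▸ hu')

lemma disjoint_spokes_of_disjoint {v : V} {U U' : Finset V} (h : Disjoint U U') :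
    Disjoint (spokes v U) (spokes v U') := by
  rw [disjoint_left]
  intro e he he'
  obtain ⟨u, hu, rfl⟩ := mem_spokes.mp he
  obtain ⟨u', hu', heq⟩ := mem_spokes.mp he'
  have : u' = u := by
    rw [Sym2.eq_iff] at heq
    rcases heq with ⟨_, h2⟩ | ⟨h1, h2⟩
    · exact h2
    · rw [h2, h1]
  exact disjoint_left.mp h hu (this ▸ hu')

lemma disjoint_spokes_prs {v : V} {U D : Finset V} (hv : v ∉ D) : Disjoint (spokes v U) (prs D) := by
  rw [disjoint_left]
  intro e he he'
  obtain ⟨u, hu, rfl⟩ := mem_spokes.mp he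
  exact hv (mem_prs.mp he').1

/-- At least one of many independent events occurs. -/
lemma pr_exists_ge {E κ : Type*} [Fintype E] {p π : ℝ} (h0 : 0 ≤ p) (h1 : p ≤ 1)
    (s : Finset κ) {S : κ → Set E} (hS : (s : Set κ).PairwiseDisjoint S)
    {Q : κ → (E → Bool) → Prop} (hQ : ∀ i ∈ s, Dep (S i) (Q i)) (hπ : ∀ i ∈ s, π ≤ pr p (Q i)) :
    1 - (1 - π) ^ #s ≤ pr p (fun ω => ∃ i ∈ s, Q i ω) := by
  have h : pr p (fun ω => ¬ ∃ i ∈ s, Q i ω) ≤ (1 - π) ^ #s := by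
    have e1 : ∀ ω, ind (¬ ∃ i ∈ s, Q i ω) = ∏ i ∈ s, ind (¬ Q i ω) := by
      intro ω; rw [← ind_forall]; congr 1; simp
    rw [pr, funext e1, ex_prod_of_dep p s hS fun i hi => (hQ i hi).comp fun P => ind (¬ P),
      ← prod_const]
    refine Finset.prod_le_prod (fun i _ => ex_nonneg h0 h1 fun _ => ind_nonneg _) fun i hi => ?_
    have := pr_not p (Q i)
    rw [pr] at this
    rw [this]; linarith [hπ i hi]
  rw [pr_not] at h; linarith

lemma dep_prescribed {E : Type*} {A B : Finset E} {S : Set E} (hA : (A : Set E) ⊆ S)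
    (hB : (B : Set E) ⊆ S) :
    Dep S fun ω : E → Bool => (∀ e ∈ A, ω e = true) ∧ ∀ e ∈ B, ω e = false := by
  intro ω ω' h
  simp only [eq_iff_iff]
  refine and_congr (forall₂_congr fun e he => ?_) (forall₂_congr fun e he => ?_)
  · rw [h e (hA he)]
  · rw [h e (hB he)]

/-- There is an induced path with `k` vertices, the `j`-th one in `R j`. -/
def PathEvent (R : ℕ → Finset V) (k : ℕ) (ω : Sym2 V → Bool) : Prop :=
  ∃ x : ℕ → V, (∀ j < k, x j ∈ R j) ∧ ∀ i j, i < j → j < k → ω s(x i, x j) = decide (i + 1 = j)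

variable [Fintype V]

lemma pr_pathEvent_ge [Nonempty V] {p : ℝ} (h0 : 0 ≤ p) (h1 : p ≤ 1) {R : ℕ → Finset V} {r a : ℕ}
    (hR : Pairwise fun i j => Disjoint (R i) (R j)) (hr : ∀ j < a, r ≤ #(R j)) {k : ℕ} (hk : k ≤ a) :
    1 - k * (1 - p * (1 - p) ^ a) ^ r ≤ pr p (PathEvent R k) := by
  have hq0 : 0 ≤ 1 - p := by linarith
  have hπ0 : 0 ≤ p * (1 - p) ^ a := by positivity
  have hπ1 : p * (1 - p) ^ a ≤ 1 :=
    mul_le_one₀ h1 (by positivity) (pow_le_one₀ hq0 (by linarith))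
  induction k with
  | zero =>
    have : ∀ ω : Sym2 V → Bool, PathEvent R 0 ω :=
      fun ω => ⟨fun _ => Classical.arbitrary V, by simp, by simp⟩
    have h : pr p (PathEvent R 0) = 1 := by
      rw [pr, funext fun ω => ind_of (this ω), ex_const]
    rw [h]; simp
  | succ k ih =>
    have hstep := pr_ge_of_glue h0 h1 (prs ((range k).biUnion R) : Set (Sym2 V))
      (A := PathEvent R k) (Q := PathEvent R (k + 1)) (ε₂ := (1 - p * (1 - p) ^ a) ^ r)
      (by have : 0 ≤ 1 - p * (1 - p) ^ a := by linarith
          positivity) (ih (by omega)) ?_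
    · refine le_trans (le_of_eq ?_) hstep
      push_cast; ring
    rintro ω ⟨x, hx, hω⟩
    set P : Finset V := (range k).image x with hP
    have hPR : ∀ v ∈ R k, v ∉ (range k).biUnion R := by
      intro v hv hv'
      obtain ⟨j, hj, hvj⟩ := mem_biUnion.mp hv'
      exact disjoint_left.mp (hR (by have := mem_range.mp hj; omega : k ≠ j)) hv hvj
    have hPsub : P ⊆ (range k).biUnion R := by
      intro v hv
      obtain ⟨j, hj, rfl⟩ := mem_image.mp hv
      exact mem_biUnion.mpr ⟨j, hj, hx j (mem_range.mp hj)⟩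
    set A : Finset V := ((range k).filter fun i => i + 1 = k).image x with hA
    set B : Finset V := ((range k).filter fun i => ¬ (i + 1 = k)).image x with hB
    have hxinj : Set.InjOn x (range k : Set ℕ) := by
      intro i hi j hj hij
      by_contra hne
      have hi := hx i (by simpa using hi)
      have hj := hx j (by simpa using hj)
      exact disjoint_left.mp (hR hne) hi (hij ▸ hj)
    have hAB : Disjoint A B := by
      rw [disjoint_left]
      intro v hv hv'
      obtain ⟨i, hi, rfl⟩ := mem_image.mp hv
      obtain ⟨j, hj, hij⟩ := mem_image.mp hv'
      rw [mem_filter] at hi hj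
      have := hxinj (by simpa using hj.1) (by simpa using hi.1) hij
      exact hj.2 (this ▸ hi.2)
    have hAP : A ⊆ P := image_subset_image (filter_subset _ _)
    have hBP : B ⊆ P := image_subset_image (filter_subset _ _)
    have hcA : #A ≤ 1 := by
      refine card_image_le.trans (card_le_one.mpr fun i hi j hj => ?_)
      have := (mem_filter.mp hi).2
      have := (mem_filter.mp hj).2
      omega
    have hcB : #B ≤ a := card_image_le.trans ((card_filter_le _ _).trans (by simp; omega))
    have hPk : ∀ v ∈ R k, v ∉ P := fun v hv hvP => hPR v hv (hPsub hvP)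
    have hmain := pr_exists_ge h0 h1 (π := p * (1 - p) ^ a) (R k)
      (S := fun v => (spokes v P : Set (Sym2 V)))
      (Q := fun v ω' => (∀ e ∈ spokes v A, ω' e = true) ∧ ∀ e ∈ spokes v B, ω' e = false)
      (by intro v hv v' hv' hne
          have := disjoint_spokes (U := P) (U' := P) hne (hPk v hv)
          exact disjoint_coe.mpr this)
      (fun v hv => dep_prescribed (by exact_mod_cast image_subset_image hAP)
        (by exact_mod_cast image_subset_image hBP))
      (fun v hv => by
        rw [pr_prescribed p (disjoint_spokes_of_disjoint hAB), card_spokes, card_spokes]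
        refine mul_le_mul ?_ (pow_le_pow_of_le_one hq0 (by linarith) hcB) (by positivity)
          (by positivity)
        calc p = p ^ 1 := (pow_one p).symm
          _ ≤ _ := pow_le_pow_of_le_one h0 h1 hcA)
    have hle : (1 - p * (1 - p) ^ a) ^ #(R k) ≤ (1 - p * (1 - p) ^ a) ^ r :=
      pow_le_pow_of_le_one (by linarith) (by linarith) (hr k (by omega))
    have : 1 - (1 - p * (1 - p) ^ a) ^ r ≤ 1 - (1 - p * (1 - p) ^ a) ^ #(R k) := by linarith
    refine this.trans (hmain.trans (pr_mono h0 h1 ?_))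
    rintro ω' ⟨v, hv, hvA, hvB⟩
    refine ⟨fun j => if j = k then v else x j, ?_, ?_⟩
    · intro j hj
      by_cases hjk : j = k
      · subst hjk; simpa using hv
      · simpa [hjk] using hx j (by omega)
    · intro i j hij hj
      have hik : i ≠ k := by omega
      have hiP : x i ∈ (range k).biUnion R :=
        mem_biUnion.mpr ⟨i, mem_range.mpr (by omega), hx i (by omega)⟩
      simp only [hik, if_false]
      by_cases hjk : j = k
      · subst hjk
        simp only [if_true]
        rw [pw_of_notMem]
        · rw [Sym2.eq_swap]
          by_cases hij1 : i + 1 = j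
          · rw [hvA _ (mem_spokes.mpr ⟨x i, mem_image_of_mem _ (by simp; omega), rfl⟩)]
            simp [hij1]
          · rw [hvB _ (mem_spokes.mpr ⟨x i, mem_image_of_mem _ (by simp; omega), rfl⟩)]
            simp [hij1]
        · intro hmem
          exact hPR v hv (mem_prs.mp (mem_coe.mp hmem)).2.1
      · simp only [hjk, if_false]
        rw [pw_of_mem]
        · exact hω i j hij (by omega)
        · refine mem_coe.mpr (mem_prs.mpr ⟨hiP, mem_biUnion.mpr ⟨j, mem_range.mpr (by omega),
            hx j (by omega)⟩, fun h => ?_⟩)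
          have := hxinj (by simp; omega) (by simp; omega) h
          omega

/-- The vertices of `W` joined to `U` exactly at `u`. -/
def privateNbrs (W U : Finset V) (u : V) (ω : Sym2 V → Bool) : Finset V :=
  {v ∈ W | ω s(v, u) = true ∧ ∀ w ∈ U.erase u, ω s(v, w) = false}

/-- The vertices of `W` joined to no vertex of `U`. -/
def nonNbrs (W U : Finset V) (ω : Sym2 V → Bool) : Finset V :=
  {v ∈ W | ∀ w ∈ U, ω s(v, w) = false}

lemma pr_neighbourhoods_ge {p : ℝ} (h0 : 0 < p) (h1 : p < 1) {W U : Finset V}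
    (hWU : Disjoint W U) (hW : W.Nonempty) :
    1 - (#U + 1) * (4 / (#W * (p * (1 - p) ^ #U))) ≤
      pr p (fun ω => (∀ u ∈ U, #W * (p * (1 - p) ^ #U) / 2 ≤ #(privateNbrs W U u ω)) ∧
        #W * (1 - p) ^ #U / 2 ≤ #(nonNbrs W U ω)) := by
  have hq0 : 0 < 1 - p := by linarith
  have hWpos : (0 : ℝ) < #W := by exact_mod_cast hW.card_pos
  set π := p * (1 - p) ^ #U with hπ
  have hπ0 : 0 < π := by positivity
  have hdis : (W : Set V).PairwiseDisjoint fun v => (spokes v U : Set (Sym2 V)) := by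
    intro v hv v' hv' hne
    exact disjoint_coe.mpr (disjoint_spokes (U := U) (U' := U) hne (disjoint_left.mp hWU hv))
  have hgen : ∀ A B : Finset V, A ⊆ U → B ⊆ U → Disjoint A B → #A ≤ 1 →
      pr p (fun ω => ¬ (#W * (p ^ #A * (1 - p) ^ #U) / 2 ≤
        (#{v ∈ W | (∀ w ∈ A, ω s(v, w) = true) ∧ ∀ w ∈ B, ω s(v, w) = false} : ℝ))) ≤
        4 / (#W * π) := by
    intro A B hA hB hAB hA1
    have hAU : p ^ #A * (1 - p) ^ #U ≤ p ^ #A * (1 - p) ^ #B :=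
      mul_le_mul_of_nonneg_left
        (pow_le_pow_of_le_one hq0.le (by linarith) (card_le_card hB)) (by positivity)
    have hπAB : π ≤ p ^ #A * (1 - p) ^ #B := by
      refine le_trans ?_ hAU
      rw [hπ]
      refine mul_le_mul_of_nonneg_right ?_ (by positivity)
      calc p = p ^ 1 := (pow_one p).symm
        _ ≤ _ := pow_le_pow_of_le_one h0.le h1.le hA1
    have hpos : 0 < (#W : ℝ) * (p ^ #A * (1 - p) ^ #B) := by
      have := hπ0.trans_le hπAB
      positivity
    have h := pr_count_ge h0.le h1.le W hdis (π := p ^ #A * (1 - p) ^ #B)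
      (Q := fun v ω => (∀ e ∈ spokes v A, ω e = true) ∧ ∀ e ∈ spokes v B, ω e = false)
      (fun v hv => dep_prescribed (by exact_mod_cast image_subset_image hA)
        (by exact_mod_cast image_subset_image hB))
      (fun v hv => by rw [pr_prescribed p (disjoint_spokes_of_disjoint hAB), card_spokes, card_spokes])
      hpos
    rw [pr_not]
    have hle : 4 / ((#W : ℝ) * (p ^ #A * (1 - p) ^ #B)) ≤ 4 / (#W * π) := by
      gcongr
    have hmono : pr p (fun ω => #W * (p ^ #A * (1 - p) ^ #B) / 2 ≤ ∑ v ∈ W,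
        ind ((∀ e ∈ spokes v A, ω e = true) ∧ ∀ e ∈ spokes v B, ω e = false)) ≤
        pr p (fun ω => #W * (p ^ #A * (1 - p) ^ #U) / 2 ≤
        (#{v ∈ W | (∀ w ∈ A, ω s(v, w) = true) ∧ ∀ w ∈ B, ω s(v, w) = false} : ℝ)) := by
      refine pr_mono h0.le h1.le fun ω hω => ?_
      have e : ∑ v ∈ W, ind ((∀ e ∈ spokes v A, ω e = true) ∧ ∀ e ∈ spokes v B, ω e = false) =
          (#{v ∈ W | (∀ w ∈ A, ω s(v, w) = true) ∧ ∀ w ∈ B, ω s(v, w) = false} : ℝ) := by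
        rw [← sum_ind_eq_card]
        refine Finset.sum_congr rfl fun v _ => ?_
        congr 1
        simp [spokes]
      rw [← e]
      refine le_trans ?_ hω
      gcongr
    linarith
  have hnot : pr p (fun ω => ¬ ((∀ u ∈ U, #W * π / 2 ≤ #(privateNbrs W U u ω)) ∧
        #W * (1 - p) ^ #U / 2 ≤ #(nonNbrs W U ω))) ≤ (#U + 1) * (4 / (#W * π)) := by
    calc _ ≤ pr p (fun ω => ∃ o ∈ insertNone U, ¬ (#W *
          (p ^ #(o.elim ∅ fun u => {u} : Finset V) * (1 - p) ^ #U) / 2 ≤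
          (#{v ∈ W | (∀ w ∈ (o.elim ∅ fun u => {u} : Finset V), ω s(v, w) = true) ∧
            ∀ w ∈ (o.elim U fun u => U.erase u : Finset V), ω s(v, w) = false} : ℝ))) := by
          refine pr_mono h0.le h1.le fun ω hω => ?_
          by_contra hcon
          push Not at hcon
          refine hω ⟨fun u hu => ?_, ?_⟩
          · simpa [privateNbrs, hπ] using hcon (some u) (by simpa using hu)
          · simpa [nonNbrs] using hcon none (by simp)
      _ ≤ _ := pr_exists_le h0.le h1.le _ _
      _ ≤ ∑ _o ∈ insertNone U, 4 / (#W * π) := by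
          refine Finset.sum_le_sum fun o ho => ?_
          cases o with
          | none => exact hgen ∅ U (by simp) subset_rfl (by simp) (by simp)
          | some u =>
            have hu : u ∈ U := by simpa using ho
            exact hgen {u} (U.erase u) (by simpa using hu) (erase_subset _ _) (by simp) (by simp)
      _ = _ := by rw [sum_const, card_insertNone, nsmul_eq_mul]; push_cast; ring
  rw [pr_not] at hnot
  linarith

end Exposure

section Peel

open Finset

variable {ι V : Type*} [Fintype ι] [DecidableEq ι] [DecidableEq V]

omit [DecidableEq V] in
lemma sum_piFinset_update (P : ι → Finset V) (x : ι) (Φ : (ι → V) → ℝ) :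
    ∑ g ∈ Fintype.piFinset P, ∑ v ∈ P x, Φ (Function.update g x v) =
      #(P x) * ∑ g ∈ Fintype.piFinset P, Φ g := by
  have h1 : ∑ g ∈ Fintype.piFinset P, ∑ v ∈ P x, Φ (Function.update g x v) =
      ∑ g ∈ Fintype.piFinset P, ∑ _v ∈ P x, Φ g := by
    rw [← Finset.sum_product', ← Finset.sum_product']
    refine Finset.sum_nbij' (fun q => (Function.update q.1 x q.2, q.1 x))
      (fun q => (Function.update q.1 x q.2, q.1 x)) ?_ ?_ ?_ ?_ ?_
    · rintro ⟨g, v⟩ h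
      simp only [mem_product, Fintype.mem_piFinset] at h ⊢
      refine ⟨fun y => ?_, h.1 x⟩
      by_cases hy : y = x
      · subst hy; simpa using h.2
      · simpa [hy] using h.1 y
    · rintro ⟨g, v⟩ h
      simp only [mem_product, Fintype.mem_piFinset] at h ⊢
      refine ⟨fun y => ?_, h.1 x⟩
      by_cases hy : y = x
      · subst hy; simpa using h.2
      · simpa [hy] using h.1 y
    · rintro ⟨g, v⟩ _; simp
    · rintro ⟨g, v⟩ _; simp
    · rintro ⟨g, v⟩ _; rfl
  rw [h1, Finset.mul_sum]
  exact Finset.sum_congr rfl fun g _ => by rw [sum_const, nsmul_eq_mul]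

omit [DecidableEq V] in
/-- Summing a product of local weights over a product set, one coordinate at a time, in order of
decreasing rank. -/
lemma sum_prod_le_of_peel (P : ι → Finset V) (rk : ι → ℕ) (F : ι → (ι → V) → ℝ) (c : ι → ℝ)
    (hF0 : ∀ x g, 0 ≤ F x g) (hc : ∀ x, 0 ≤ c x)
    (hF : ∀ x y, y ≠ x → rk x ≤ rk y → ∀ g v, F x (Function.update g y v) = F x g)
    (hsum : ∀ x, ∀ g ∈ Fintype.piFinset P, ∑ v ∈ P x, F x (Function.update g x v) ≤ c x) :
    ∑ g ∈ Fintype.piFinset P, ∏ x, F x g ≤ ∏ x, c x := by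
  by_cases hP : ∃ x, P x = ∅
  · rw [Fintype.piFinset_eq_empty.mpr hP, sum_empty]
    exact Finset.prod_nonneg fun x _ => hc x
  push Not at hP
  have hPpos : ∀ x, (0 : ℝ) < #(P x) := fun x => by
    exact_mod_cast Finset.card_pos.mpr (hP x)
  have key : ∀ (k : ℕ) (s : Finset ι), #s = k →
      ∑ g ∈ Fintype.piFinset P, ∏ x ∈ s, F x g ≤ (∏ x ∈ s, c x) * ∏ x ∈ sᶜ, (#(P x) : ℝ) := by
    intro k
    induction k with
    | zero =>
      intro s hs
      rw [card_eq_zero] at hs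
      subst hs
      simp
    | succ k ih =>
      intro s hs
      obtain ⟨x, hx, hmax⟩ := s.exists_max_image rk (card_pos.mp (by omega))
      have h2 : #(s.erase x) = k := by rw [card_erase_of_mem hx, hs]; rfl
      have h3 := ih _ h2
      have h4 := sum_piFinset_update P x fun g => ∏ y ∈ s, F y g
      have h5 : ∀ g ∈ Fintype.piFinset P, ∑ v ∈ P x, ∏ y ∈ s, F y (Function.update g x v) ≤
          c x * ∏ y ∈ s.erase x, F y g := by
        intro g hg
        have : ∀ v, ∏ y ∈ s, F y (Function.update g x v) =
            F x (Function.update g x v) * ∏ y ∈ s.erase x, F y g := by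
          intro v
          rw [← Finset.mul_prod_erase s _ hx]
          congr 1
          refine Finset.prod_congr rfl fun y hy => ?_
          rw [mem_erase] at hy
          exact hF y x hy.1.symm (hmax y hy.2) g v
        simp only [this]
        rw [← Finset.sum_mul]
        exact mul_le_mul_of_nonneg_right (hsum x g hg) (Finset.prod_nonneg fun y _ => hF0 y g)
      have h6 := Finset.sum_le_sum h5
      rw [h4, ← Finset.mul_sum] at h6
      have h7 : (s.erase x)ᶜ = insert x sᶜ := by ext y; simp
      rw [h7, Finset.prod_insert (by simp [hx])] at h3
      refine le_of_mul_le_mul_left (h6.trans ?_) (hPpos x)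
      calc _ ≤ c x * ((∏ y ∈ s.erase x, c y) * (#(P x) * ∏ y ∈ sᶜ, (#(P y) : ℝ))) :=
            mul_le_mul_of_nonneg_left h3 (hc x)
        _ = _ := by rw [← Finset.mul_prod_erase s c hx]; ring
  simpa using key _ Finset.univ rfl

end Peel

section Tree

open Finset

/-- A finite rooted forest, given by parents, with a distinguished set of leaves at the end of
long pendant paths. -/
structure LabelledTree (ι : Type*) [Fintype ι] [DecidableEq ι] where
  par : ι → ι
  rk : ι → ℕ
  rk_lt : ∀ x, par x ≠ x → rk (par x) < rk x
  Lb : Finset ι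
  par_notMem : ∀ x, par x ∉ Lb
  only_child : ∀ x ∈ Lb, ∀ y, par y = par x → y = x
  only_child₂ : ∀ x ∈ Lb, ∀ y, par y = par (par x) → y = par x
  card_children_le : ∀ x, #{y | par y = x} ≤ 6

variable {ι V : Type*} [Fintype ι] [DecidableEq ι] [DecidableEq V] (T : LabelledTree ι)

namespace LabelledTree

/-- The elements with a parent. -/
def nonroots : Finset ι := {x | T.par x ≠ x}

lemma mem_nonroots {x : ι} : x ∈ T.nonroots ↔ T.par x ≠ x := by simp [nonroots]

lemma nonroot_of_mem {x : ι} (hx : x ∈ T.Lb) : T.par x ≠ x := 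
  fun h => T.par_notMem x (by rw [h]; exact hx)

/-- The edges of the embedded tree. -/
def edges (g : ι → V) : Finset (Sym2 V) := T.nonroots.image fun x => s(g x, g (T.par x))

/-- The image of the configuration. -/
def pts (_T : LabelledTree ι) (g : ι → V) : Finset V := univ.image g

/-- The images of the labels. -/
def labs (g : ι → V) : Finset V := T.Lb.image g

/-- The images of the other elements. -/
def inner (g : ι → V) : Finset V := T.Lbᶜ.image g

/-- Whenever an edge of `g'` lies in the image of `g`, it is an edge of `g`. -/
def Compat (g g' : ι → V) : Prop :=
  ∀ x, T.par x ≠ x → g' x ∈ T.pts g → g' (T.par x) ∈ T.pts g → s(g' x, g' (T.par x)) ∈ T.edges g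

/-- The number of edges of `g'` inside the image of `g`. -/
def shared (g g' : ι → V) : ℕ :=
  #{x | T.par x ≠ x ∧ g' x ∈ T.pts g ∧ g' (T.par x) ∈ T.pts g}

/-- The number of inner points of `g'` in the image of `g`. -/
def ell (g g' : ι → V) : ℕ := #{x ∈ T.Lbᶜ | g' x ∈ T.pts g}

/-- The number of labels of `g'` in the image of `g`. -/
def emm (g g' : ι → V) : ℕ := #{x ∈ T.Lb | g' x ∈ T.pts g}

lemma mem_pts {g : ι → V} {v : V} : v ∈ T.pts g ↔ ∃ x, g x = v := by simp [pts]

lemma pts_eq (g : ι → V) : T.pts g = T.inner g ∪ T.labs g := by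
  rw [pts, inner, labs, ← image_union]
  congr 1; ext x; simp; tauto

lemma card_nbrs_le (g : ι → V) (hg : Function.Injective g) (u : V) (s : Finset V) :
    #{v ∈ s | s(v, u) ∈ T.edges g} ≤ 7 := by
  by_cases hu : ∃ y, g y = u
  · obtain ⟨y, rfl⟩ := hu
    have hsub : ({v ∈ s | s(v, g y) ∈ T.edges g} : Finset V) ⊆
        insert (g (T.par y)) (({x | T.par x = y} : Finset ι).image g) := by
      intro v hv
      obtain ⟨x, hx, hxv⟩ := mem_image.mp (mem_filter.mp hv).2
      rw [Sym2.eq_iff] at hxv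
      rcases hxv with ⟨h1, h2⟩ | ⟨h1, h2⟩
      · exact mem_insert_of_mem (mem_image.mpr ⟨x, by simpa using hg h2, h1⟩)
      · rw [← hg h1, h2]; exact mem_insert_self _ _
    refine (card_le_card hsub).trans ((card_insert_le _ _).trans ?_)
    have := card_image_le (s := ({x | T.par x = y} : Finset ι)) (f := g)
    have := T.card_children_le y
    omega
  · rw [Finset.filter_false_of_mem]
    · simp
    · intro v _ hv
      obtain ⟨x, hx, hxv⟩ := mem_image.mp hv
      rw [Sym2.eq_iff] at hxv
      rcases hxv with ⟨h1, h2⟩ | ⟨h1, h2⟩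
      · exact hu ⟨_, h2⟩
      · exact hu ⟨_, h1⟩

/-- The local weight of a point `v` whose parent is at `u`. -/
def hw (p : ℝ) (g : ι → V) (z : ℝ) (v u : V) : ℝ :=
  if v ∉ T.pts g then 1 else
    z * (if u ∉ T.pts g then 1 else if s(v, u) ∈ T.edges g then p⁻¹ else 0)

/-- The local weight of a root. -/
def rw₀ (T : LabelledTree ι) (g : ι → V) (z : ℝ) (v : V) : ℝ := if v ∉ T.pts g then 1 else z

/-- The local weight at `x`. -/
def lw (p : ℝ) (g : ι → V) (z : ℝ) (x : ι) (g' : ι → V) : ℝ :=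
  if T.par x = x then T.rw₀ g z (g' x) else T.hw p g z (g' x) (g' (T.par x))

variable {T} {p z : ℝ} {g : ι → V}

lemma hw_nonneg (hp : 0 ≤ p) (hz : 0 ≤ z) (v u : V) : 0 ≤ T.hw p g z v u := by
  unfold hw; split_ifs <;> positivity

lemma lw_nonneg (hp : 0 ≤ p) (hz : 0 ≤ z) (x : ι) (g' : ι → V) : 0 ≤ T.lw p g z x g' := by
  unfold lw; split_ifs
  · unfold rw₀; split_ifs <;> linarith
  · exact hw_nonneg hp hz _ _

lemma sum_hw_le (hg : Function.Injective g) (hp : 0 < p) (hz : 0 ≤ z)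
    (hκ : 7 ≤ p * Fintype.card ι) (P : Finset V) (u : V) :
    ∑ v ∈ P, T.hw p g z v u ≤ #P + z * Fintype.card ι := by
  have hle : ∀ v, T.hw p g z v u ≤ 1 + (if v ∈ T.pts g then
      z * (if u ∉ T.pts g then 1 else if s(v, u) ∈ T.edges g then p⁻¹ else 0) else 0) := by
    intro v
    unfold hw
    by_cases hv : v ∈ T.pts g
    · simp only [hv, not_true_eq_false, if_false, if_true]; linarith
    · simp [hv]
  refine (Finset.sum_le_sum fun v _ => hle v).trans ?_
  rw [Finset.sum_add_distrib, sum_const, nsmul_eq_mul, mul_one]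
  refine add_le_add le_rfl ?_
  rw [← Finset.sum_filter, ← Finset.mul_sum]
  refine mul_le_mul_of_nonneg_left ?_ hz
  by_cases hu : u ∈ T.pts g
  · simp only [hu, not_true_eq_false, if_false]
    rw [← Finset.sum_filter, sum_const, nsmul_eq_mul]
    have h6 := T.card_nbrs_le g hg u {v ∈ P | v ∈ T.pts g}
    have h6' : (#{v ∈ {v ∈ P | v ∈ T.pts g} | s(v, u) ∈ T.edges g} : ℝ) ≤ 7 := by exact_mod_cast h6
    calc _ ≤ 7 * p⁻¹ := mul_le_mul_of_nonneg_right h6' (by positivity)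
      _ ≤ Fintype.card ι := by
        rw [← div_eq_mul_inv, div_le_iff₀ hp]; linarith
  · simp only [hu, not_false_eq_true, if_true, sum_const, nsmul_eq_mul, mul_one]
    have : #{v ∈ P | v ∈ T.pts g} ≤ Fintype.card ι := by
      refine (card_le_card (t := T.pts g) fun v hv => (mem_filter.mp hv).2).trans ?_
      exact card_image_le
    exact_mod_cast this

lemma sum_rw₀_le (hz : 0 ≤ z) (P : Finset V) :
    ∑ v ∈ P, T.rw₀ g z v ≤ #P + z * Fintype.card ι := by
  have hle : ∀ v, T.rw₀ g z v ≤ 1 + (if v ∈ T.pts g then z else 0) := by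
    intro v
    unfold rw₀
    by_cases hv : v ∈ T.pts g <;> simp [hv]
  refine (Finset.sum_le_sum fun v _ => hle v).trans ?_
  rw [Finset.sum_add_distrib, sum_const, nsmul_eq_mul, mul_one]
  refine add_le_add le_rfl ?_
  rw [← Finset.sum_filter, sum_const, nsmul_eq_mul, mul_comm]
  refine mul_le_mul_of_nonneg_left ?_ hz
  have : #{v ∈ P | v ∈ T.pts g} ≤ Fintype.card ι := by
    refine (card_le_card (t := T.pts g) fun v hv => (mem_filter.mp hv).2).trans ?_
    exact card_image_le
  exact_mod_cast this

lemma sum_lw_update_le (hg : Function.Injective g) (hp : 0 < p) (hz : 0 ≤ z)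
    (hκ : 7 ≤ p * Fintype.card ι) (P : Finset V) (x : ι) (g' : ι → V) :
    ∑ v ∈ P, T.lw p g z x (Function.update g' x v) ≤ #P + z * Fintype.card ι := by
  by_cases hx : T.par x = x
  · simp only [lw, hx, if_true, Function.update_self]
    exact sum_rw₀_le hz P
  · simp only [lw, hx, if_false, Function.update_self, Function.update_of_ne (Ne.symm (Ne.symm hx))]
    exact sum_hw_le hg hp hz hκ P _

lemma lw_update (x y : ι) (hyx : y ≠ x) (hrk : T.rk x ≤ T.rk y) (g' : ι → V) (v : V) :
    T.lw p g z x (Function.update g' y v) = T.lw p g z x g' := by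
  unfold lw
  split_ifs with hx
  · rw [Function.update_of_ne hyx.symm]
  · have : T.par x ≠ y := by
      rintro rfl
      exact absurd (T.rk_lt x hx) (not_lt.mpr hrk)
    rw [Function.update_of_ne hyx.symm, Function.update_of_ne this]

/-- The product of the local weights over a compatible configuration. -/
lemma prod_lw (z z' : ℝ) {g' : ι → V} (hc : T.Compat g g') :
    ∏ x, T.lw p g (if x ∈ T.Lb then z' else z) x g' =
      p⁻¹ ^ T.shared g g' * z ^ T.ell g g' * z' ^ T.emm g g' := by
  have h : ∀ x, T.lw p g (if x ∈ T.Lb then z' else z) x g' =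
      (if T.par x ≠ x ∧ g' x ∈ T.pts g ∧ g' (T.par x) ∈ T.pts g then p⁻¹ else 1) *
      (if x ∈ T.Lbᶜ ∧ g' x ∈ T.pts g then z else 1) *
      (if x ∈ T.Lb ∧ g' x ∈ T.pts g then z' else 1) := by
    intro x
    have hc' := hc x
    by_cases hx : T.par x = x
    · by_cases hL : x ∈ T.Lb
      · exact absurd hx (T.nonroot_of_mem hL)
      · by_cases hm : g' x ∈ T.pts g <;> simp [lw, rw₀, hx, hL, hm]
    · by_cases hm : g' x ∈ T.pts g
      · by_cases hm' : g' (T.par x) ∈ T.pts g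
        · have := hc' hx hm hm'
          by_cases hL : x ∈ T.Lb <;> simp [lw, hw, hx, hL, hm, hm', this, mul_comm]
        · by_cases hL : x ∈ T.Lb <;> simp [lw, hw, hx, hL, hm, hm']
      · by_cases hL : x ∈ T.Lb <;> simp [lw, hw, hx, hm]
  rw [Finset.prod_congr rfl fun x _ => h x, Finset.prod_mul_distrib, Finset.prod_mul_distrib,
    Finset.prod_ite, Finset.prod_ite, Finset.prod_ite]
  simp only [prod_const, one_pow, mul_one]
  simp only [shared, ell, emm, ← Finset.filter_filter, Finset.filter_univ_mem]

end LabelledTree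

end Tree

section Copies

open Finset

/-- The vertex `v` is adjacent to some element of `U`. -/
def Dominated {V : Type*} [DecidableEq V] (v : V) (U : Finset V) (ω : Sym2 V → Bool) : Prop :=
  ∃ e ∈ spokes v U, ω e = true

lemma pr_prescribed_and_dominated {V : Type*} [DecidableEq V] [Fintype V] (p : ℝ)
    {A B : Finset (Sym2 V)} (hAB : Disjoint A B) (t : Finset V) (X Y : V → Finset V)
    (hf : ∀ v ∈ t, Disjoint (spokes v (X v ∪ Y v)) (A ∪ B))
    (ht : ∀ v ∈ t, ∀ v' ∈ t, v ≠ v' → v ∉ X v' ∪ Y v' ∨ v' ∉ X v ∪ Y v) :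
    pr p (fun ω => ((∀ e ∈ A, ω e = true) ∧ ∀ e ∈ B, ω e = false) ∧
        ∀ v ∈ t, Dominated v (X v) ω ∧ Dominated v (Y v) ω) =
      p ^ #A * (1 - p) ^ #B *
        ∏ v ∈ t, (1 - (1 - p) ^ #(X v) - (1 - p) ^ #(Y v) + (1 - p) ^ #(X v ∪ Y v)) := by
  have hdep : ∀ v ∈ t, Dep (spokes v (X v ∪ Y v) : Set (Sym2 V)) fun ω : Sym2 V → Bool =>
      ind (Dominated v (X v) ω ∧ Dominated v (Y v) ω) := by
    intro v _
    have : Dep (spokes v (X v ∪ Y v) : Set (Sym2 V)) fun ω : Sym2 V → Bool =>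
        (Dominated v (X v) ω ∧ Dominated v (Y v) ω) := by
      intro ω ω' h
      have key : ∀ Z ⊆ X v ∪ Y v, Dominated v Z ω ↔ Dominated v Z ω' := by
        intro Z hZ
        refine exists_congr fun e => and_congr_right fun he => ?_
        rw [h e (by exact_mod_cast image_subset_image hZ he)]
      simp only [key _ subset_union_left, key _ subset_union_right]
    exact this.comp ind
  have h1 : ∀ ω : Sym2 V → Bool, ind (((∀ e ∈ A, ω e = true) ∧ ∀ e ∈ B, ω e = false) ∧
      ∀ v ∈ t, Dominated v (X v) ω ∧ Dominated v (Y v) ω) =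
      ind ((∀ e ∈ A, ω e = true) ∧ ∀ e ∈ B, ω e = false) *
        ∏ v ∈ t, ind (Dominated v (X v) ω ∧ Dominated v (Y v) ω) := by
    intro ω; rw [ind_and, ind_forall]
  rw [pr, funext h1, ex_mul_of_dep p (S := (A ∪ B : Finset (Sym2 V)))
    (T := (t.biUnion fun v => spokes v (X v ∪ Y v) : Finset (Sym2 V))) _
    ((dep_prescribed (by simp) (by simp)).comp ind) (Dep.prod fun v hv => (hdep v hv).mono _),
    ex_prod_of_dep p t _ hdep]
  · congr 1
    · exact pr_prescribed p hAB
    · refine Finset.prod_congr rfl fun v _ => ?_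
      have := pr_exists_true_and p (spokes v (X v)) (spokes v (Y v))
      rw [card_spokes, card_spokes, spokes, spokes, ← image_union] at this
      rw [← card_spokes v (X v ∪ Y v)]
      exact this
  · intro v hv v' hv' hne
    rw [Function.onFun, disjoint_coe]
    rcases ht v hv v' hv' hne with h | h
    · exact disjoint_spokes hne h
    · exact (disjoint_spokes hne.symm h).symm
  · rw [disjoint_coe, disjoint_biUnion_right]
    exact fun v hv => (hf v hv).symm
  · intro v hv
    exact_mod_cast subset_biUnion_of_mem (fun v => spokes v (X v ∪ Y v)) hv

variable {ι V : Type*} [Fintype ι] [DecidableEq ι] [DecidableEq V] (T : LabelledTree ι)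

namespace LabelledTree

/-- Injective configurations, with labels in `N` and other elements in `D`. -/
structure Conf (D N : Finset V) (g : ι → V) : Prop where
  inj : Function.Injective g
  lab : ∀ x ∈ T.Lb, g x ∈ N
  inn : ∀ x ∉ T.Lb, g x ∈ D

/-- The prescribed non-edges. -/
def nonedges (g : ι → V) : Finset (Sym2 V) := (prs (T.pts g) \ prs (T.labs g)) \ T.edges g

/-- The configuration `g` spans an induced copy of the tree (disregarding pairs of labels), which
dominates `D` and `N`. -/
def Event (D N : Finset V) (g : ι → V) (ω : Sym2 V → Bool) : Prop :=
  ((∀ e ∈ T.edges g, ω e = true) ∧ ∀ e ∈ T.nonedges g, ω e = false) ∧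
    (∀ v ∈ D \ T.inner g, Dominated v (T.pts g) ω) ∧ ∀ v ∈ N \ T.labs g, Dominated v (T.inner g) ω

/-- The probability of `Event`. -/
def prEvent (p : ℝ) (d ν : ℕ) : ℝ :=
  p ^ #T.nonroots * (1 - p) ^ ((Fintype.card ι).choose 2 - (#T.Lb).choose 2 - #T.nonroots) *
    ((1 - (1 - p) ^ Fintype.card ι) ^ (d - #T.Lbᶜ) * (1 - (1 - p) ^ #T.Lbᶜ) ^ (ν - #T.Lb))

variable {T} {D N : Finset V} {g g' : ι → V}

lemma inner_subset (hg : T.Conf D N g) : T.inner g ⊆ D := by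
  intro v hv
  obtain ⟨x, hx, rfl⟩ := mem_image.mp hv
  exact hg.inn x (by simpa using hx)

lemma labs_subset (hg : T.Conf D N g) : T.labs g ⊆ N := by
  intro v hv
  obtain ⟨x, hx, rfl⟩ := mem_image.mp hv
  exact hg.lab x hx

lemma inner_subset_pts : T.inner g ⊆ T.pts g := by rw [pts_eq]; exact subset_union_left

lemma labs_subset_pts : T.labs g ⊆ T.pts g := by rw [pts_eq]; exact subset_union_right

lemma card_pts (hg : Function.Injective g) : #(T.pts g) = Fintype.card ι := by
  rw [pts, card_image_of_injective _ hg, card_univ]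

lemma card_labs (hg : Function.Injective g) : #(T.labs g) = #T.Lb := card_image_of_injective _ hg

lemma card_inner (hg : Function.Injective g) : #(T.inner g) = #T.Lbᶜ :=
  card_image_of_injective _ hg

lemma mem_labs_iff (hg : Function.Injective g) {x : ι} : g x ∈ T.labs g ↔ x ∈ T.Lb := by
  rw [labs, hg.mem_finset_image]

lemma edges_subset (hg : Function.Injective g) : T.edges g ⊆ prs (T.pts g) \ prs (T.labs g) := by
  intro e he
  obtain ⟨x, hx, rfl⟩ := mem_image.mp he
  rw [Finset.mem_sdiff, mem_prs, mem_prs, mem_labs_iff hg, mem_labs_iff hg]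
  refine ⟨⟨T.mem_pts.mpr ⟨x, rfl⟩, T.mem_pts.mpr ⟨_, rfl⟩, fun h => ?_⟩,
    fun h => T.par_notMem x h.2.1⟩
  exact T.mem_nonroots.mp hx (hg h).symm

lemma card_edges (hg : Function.Injective g) : #(T.edges g) = #T.nonroots := by
  refine card_image_of_injOn fun x hx y hy h => ?_
  simp only [mem_coe, mem_nonroots] at hx hy
  simp only [Sym2.eq_iff] at h
  rcases h with ⟨h, _⟩ | ⟨h1, h2⟩
  · exact hg h
  · have h1 := hg h1
    have h2 := hg h2
    have := T.rk_lt x hx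
    have := T.rk_lt y hy
    rw [h2] at *
    rw [← h1] at *
    omega

lemma card_nonedges (hg : Function.Injective g) :
    #(T.nonedges g) = (Fintype.card ι).choose 2 - (#T.Lb).choose 2 - #T.nonroots := by
  rw [nonedges, card_sdiff_of_subset (edges_subset hg),
    card_sdiff_of_subset (prs_mono labs_subset_pts), card_prs, card_prs, card_pts hg, card_labs hg,
    card_edges hg]

lemma pts_inter_inner (hDN : Disjoint D N) (hg : T.Conf D N g) (hg' : T.Conf D N g') {x : ι}
    (hx : x ∉ T.Lb) : g' x ∈ T.pts g ↔ g' x ∈ T.inner g := by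
  refine ⟨fun h => ?_, fun h => inner_subset_pts h⟩
  rw [pts_eq, mem_union] at h
  exact h.resolve_right fun h => disjoint_left.mp hDN (hg'.inn x hx) (labs_subset hg h)

lemma pts_inter_labs (hDN : Disjoint D N) (hg : T.Conf D N g) (hg' : T.Conf D N g') {x : ι}
    (hx : x ∈ T.Lb) : g' x ∈ T.pts g ↔ g' x ∈ T.labs g := by
  refine ⟨fun h => ?_, fun h => labs_subset_pts h⟩
  rw [pts_eq, mem_union] at h
  exact h.resolve_left fun h => disjoint_right.mp hDN (hg'.lab x hx) (inner_subset hg h)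

lemma card_inner_inter (hDN : Disjoint D N) (hg : T.Conf D N g) (hg' : T.Conf D N g') :
    #(T.inner g ∩ T.inner g') = T.ell g g' := by
  rw [ell, ← card_image_of_injective _ hg'.inj]
  congr 1
  ext v
  simp only [mem_inter, mem_image, mem_filter]
  constructor
  · rintro ⟨h1, h2⟩
    obtain ⟨x, hx, rfl⟩ := mem_image.mp h2
    exact ⟨x, ⟨hx, inner_subset_pts h1⟩, rfl⟩
  · rintro ⟨x, ⟨hx, h⟩, rfl⟩
    exact ⟨(pts_inter_inner hDN hg hg' (by simpa using hx)).mp h, mem_image_of_mem _ hx⟩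

lemma card_labs_inter (hDN : Disjoint D N) (hg : T.Conf D N g) (hg' : T.Conf D N g') :
    #(T.labs g ∩ T.labs g') = T.emm g g' := by
  rw [emm, ← card_image_of_injective _ hg'.inj]
  congr 1
  ext v
  simp only [mem_inter, mem_image, mem_filter]
  constructor
  · rintro ⟨h1, h2⟩
    obtain ⟨x, hx, rfl⟩ := mem_image.mp h2
    exact ⟨x, ⟨hx, labs_subset_pts h1⟩, rfl⟩
  · rintro ⟨x, ⟨hx, h⟩, rfl⟩
    exact ⟨(pts_inter_labs hDN hg hg' hx).mp h, mem_image_of_mem _ hx⟩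

lemma card_pts_inter (hg' : Function.Injective g') :
    #(T.pts g ∩ T.pts g') = T.ell g g' + T.emm g g' := by
  have : T.pts g ∩ T.pts g' = ({x | g' x ∈ T.pts g} : Finset ι).image g' := by
    ext v
    simp only [mem_inter, mem_image, mem_filter, mem_univ, true_and]
    constructor
    · rintro ⟨h1, h2⟩
      obtain ⟨x, rfl⟩ := T.mem_pts.mp h2
      exact ⟨x, h1, rfl⟩
    · rintro ⟨x, hx, rfl⟩
      exact ⟨hx, T.mem_pts.mpr ⟨x, rfl⟩⟩
  rw [this, card_image_of_injective _ hg', ell, emm,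
    ← card_filter_add_card_filter_not (s := ({x | g' x ∈ T.pts g} : Finset ι)) (· ∈ T.Lbᶜ)]
  congr 2 <;> ext x <;> simp [and_comm]

lemma ell_comm (hDN : Disjoint D N) (hg : T.Conf D N g) (hg' : T.Conf D N g') :
    T.ell g g' = T.ell g' g := by
  rw [← card_inner_inter hDN hg hg', inter_comm, card_inner_inter hDN hg' hg]

lemma pr_event [Fintype V] (p : ℝ) (hDN : Disjoint D N) (hg : T.Conf D N g) :
    pr p (T.Event D N g) = T.prEvent p #D #N := by
  have hSD := inner_subset hg
  have hIN := labs_subset hg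
  have hE : ∀ ω, T.Event D N g ω ↔
      ((∀ e ∈ T.edges g, ω e = true) ∧ ∀ e ∈ T.nonedges g, ω e = false) ∧
      ∀ v ∈ D \ T.inner g ∪ N \ T.labs g,
        Dominated v (if v ∈ D then T.pts g else T.inner g) ω ∧
        Dominated v (if v ∈ D then T.pts g else T.inner g) ω := by
    intro ω
    rw [Event]
    refine and_congr_right fun _ => ⟨fun h v hv => ?_, fun h => ⟨fun v hv => ?_, fun v hv => ?_⟩⟩
    · rw [and_self]
      rcases mem_union.mp hv with hv | hv
      · rw [if_pos (Finset.mem_sdiff.mp hv).1]; exact h.1 v hv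
      · rw [if_neg (disjoint_right.mp hDN (Finset.mem_sdiff.mp hv).1)]; exact h.2 v hv
    · have := (h v (mem_union_left _ hv)).1
      rwa [if_pos (Finset.mem_sdiff.mp hv).1] at this
    · have := (h v (mem_union_right _ hv)).1
      rwa [if_neg (disjoint_right.mp hDN (Finset.mem_sdiff.mp hv).1)] at this
  have hnp : ∀ v ∈ D \ T.inner g ∪ N \ T.labs g, v ∉ T.pts g := by
    intro v hv
    rw [pts_eq, mem_union]
    rcases mem_union.mp hv with hv | hv <;> rw [Finset.mem_sdiff] at hv
    · rintro (h | h)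
      · exact hv.2 h
      · exact disjoint_left.mp hDN hv.1 (hIN h)
    · rintro (h | h)
      · exact disjoint_right.mp hDN hv.1 (hSD h)
      · exact hv.2 h
  have hsub : ∀ v, (if v ∈ D then T.pts g else T.inner g) ⊆ T.pts g := by
    intro v; split_ifs
    · exact Subset.rfl
    · exact inner_subset_pts
  have heq : T.Event D N g = fun ω => _ := funext fun ω => propext (hE ω)
  rw [heq, pr_prescribed_and_dominated p
    (show Disjoint (T.edges g) (T.nonedges g) from disjoint_sdiff), card_edges hg.inj, card_nonedges hg.inj,
    prEvent, Finset.prod_union]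
  · congr 2
    · rw [← card_pts hg.inj (T := T), ← card_inner hg.inj, ← card_sdiff_of_subset hSD]
      refine Finset.prod_eq_pow_card fun v hv => ?_
      rw [if_pos (Finset.mem_sdiff.mp hv).1, union_self]; ring
    · rw [← card_labs hg.inj (T := T), ← card_inner hg.inj, ← card_sdiff_of_subset hIN]
      refine Finset.prod_eq_pow_card fun v hv => ?_
      rw [if_neg (disjoint_right.mp hDN (Finset.mem_sdiff.mp hv).1), union_self]; ring
  · exact hDN.mono sdiff_subset sdiff_subset
  · intro v hv
    refine (disjoint_spokes_prs (hnp v hv)).mono_right (union_subset ?_ ?_)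
    · exact (edges_subset hg.inj).trans sdiff_subset
    · exact sdiff_subset.trans sdiff_subset
  · intro v hv v' hv' _
    exact Or.inl fun h => hnp v hv (hsub v' (by simpa using h))

end LabelledTree

end Copies

section PairBound

open Finset

lemma one_le_mul_exp {q : ℝ} (h0 : 0 ≤ q) (h1 : q ≤ 1 / 2) : 1 ≤ (1 - q) * Real.exp (2 * q) := by
  have := Real.add_one_le_exp (2 * q)
  nlinarith

lemma pow_le_pow_mul_exp {q : ℝ} (h0 : 0 ≤ q) (h1 : q ≤ 1 / 2) {a b c : ℕ} (h : b ≤ a + c) :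
    (1 - q) ^ a ≤ (1 - q) ^ b * Real.exp (2 * q * c) := by
  have hq : 0 ≤ 1 - q := by linarith
  calc (1 - q) ^ a = (1 - q) ^ a * 1 := (mul_one _).symm
    _ ≤ (1 - q) ^ a * ((1 - q) * Real.exp (2 * q)) ^ c :=
        mul_le_mul_of_nonneg_left (one_le_pow₀ (one_le_mul_exp h0 h1)) (by positivity)
    _ = (1 - q) ^ (a + c) * Real.exp (2 * q * c) := by
        rw [mul_pow, ← Real.exp_nat_mul, pow_add]; ring_nf
    _ ≤ _ := mul_le_mul_of_nonneg_right (pow_le_pow_of_le_one hq (by linarith) h)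
        (Real.exp_pos _).le

lemma one_sub_two_mul_le {q Y : ℝ} (h1 : q ≤ 1 / 2) (hY : 0 ≤ Y) :
    1 - q - q + q ^ 2 * Y ≤ (1 - q) ^ 2 * Real.exp (4 * q ^ 2 * Y) := by
  have h2 := Real.add_one_le_exp (4 * q ^ 2 * Y)
  have h3 : (1 / 4 : ℝ) ≤ (1 - q) ^ 2 := by nlinarith
  have h4 : 0 ≤ q ^ 2 * Y := by positivity
  calc 1 - q - q + q ^ 2 * Y ≤ (1 - q) ^ 2 * (4 * q ^ 2 * Y + 1) := by nlinarith [sq_nonneg q]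
    _ ≤ _ := mul_le_mul_of_nonneg_left h2 (by positivity)

variable {ι V : Type*} [Fintype ι] [DecidableEq ι] [DecidableEq V] {T : LabelledTree ι}

namespace LabelledTree

variable {D N : Finset V} {g g' : ι → V} {p : ℝ}

lemma compat_of_event (hDN : Disjoint D N) (hg : T.Conf D N g) (hg' : T.Conf D N g')
    {ω : Sym2 V → Bool} (h : T.Event D N g ω) (h' : T.Event D N g' ω) : T.Compat g g' := by
  intro x hx hx1 hx2
  by_contra hne
  have h1 : s(g' x, g' (T.par x)) ∈ T.nonedges g := by
    rw [nonedges, Finset.mem_sdiff, Finset.mem_sdiff, mem_prs, mem_prs]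
    refine ⟨⟨⟨hx1, hx2, fun he => hx (hg'.inj he).symm⟩, fun hl => ?_⟩, hne⟩
    exact disjoint_left.mp hDN (hg'.inn _ (T.par_notMem x)) (labs_subset hg hl.2.1)
  have h2 := h.1.2 _ h1
  rw [h'.1.1 _ (mem_image.mpr ⟨x, T.mem_nonroots.mpr hx, rfl⟩)] at h2
  simp at h2

lemma card_edges_inter_le : #(T.edges g ∩ T.edges g') ≤ T.shared g g' := by
  have hsub : T.edges g ∩ T.edges g' ⊆ ({x | T.par x ≠ x ∧ g' x ∈ T.pts g ∧
      g' (T.par x) ∈ T.pts g} : Finset ι).image fun x => s(g' x, g' (T.par x)) := by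
    intro e he
    rw [mem_inter] at he
    obtain ⟨x, hx, rfl⟩ := mem_image.mp he.2
    obtain ⟨y, hy, hxy⟩ := mem_image.mp he.1
    refine mem_image.mpr ⟨x, ?_, rfl⟩
    rw [mem_filter]
    refine ⟨mem_univ _, T.mem_nonroots.mp hx, ?_⟩
    rw [Sym2.eq_iff] at hxy
    rw [T.mem_pts, T.mem_pts]
    rcases hxy with ⟨h1, h2⟩ | ⟨h1, h2⟩
    · exact ⟨⟨_, h1⟩, _, h2⟩
    · exact ⟨⟨_, h2⟩, _, h1⟩
  exact (card_le_card hsub).trans card_image_le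

lemma card_nonedges_inter_le (hDN : Disjoint D N) (hg : T.Conf D N g) (hg' : T.Conf D N g') :
    #(T.nonedges g ∩ T.nonedges g') ≤
      (T.ell g g' + T.emm g g').choose 2 - (T.emm g g').choose 2 := by
  rw [← card_pts_inter hg'.inj, ← card_labs_inter hDN hg hg', ← card_prs, ← card_prs,
    ← card_sdiff_of_subset (prs_mono (inter_subset_inter labs_subset_pts labs_subset_pts))]
  refine card_le_card fun e he => ?_
  rw [← prs_inter, ← prs_inter]
  simp only [nonedges, mem_inter, Finset.mem_sdiff] at he ⊢
  tauto

/-- Labels of `g'` which avoid `g` together with their parents. -/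
def freeLabs (T : LabelledTree ι) (g g' : ι → V) : Finset V :=
  ({x ∈ T.Lb | g' x ∉ T.pts g ∧ g' (T.par x) ∉ T.pts g} : Finset ι).image g'

lemma card_freeLabs_ge (hg' : Function.Injective g') :
    #T.Lb ≤ #(T.freeLabs g g') + T.emm g g' + T.ell g g' := by
  rw [freeLabs, card_image_of_injective _ hg']
  have h1 : T.Lb ⊆ ({x ∈ T.Lb | g' x ∉ T.pts g ∧ g' (T.par x) ∉ T.pts g} ∪
      {x ∈ T.Lb | g' x ∈ T.pts g}) ∪ {x ∈ T.Lb | g' (T.par x) ∈ T.pts g} := by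
    intro x hx
    simp only [mem_union, mem_filter]
    tauto
  have h2 : #{x ∈ T.Lb | g' (T.par x) ∈ T.pts g} ≤ T.ell g g' := by
    refine card_le_card_of_injOn T.par (fun x hx => ?_) fun x hx y hy h => ?_
    · rw [mem_coe, mem_filter] at hx ⊢
      exact ⟨by simpa using T.par_notMem x, hx.2⟩
    · rw [mem_coe, mem_filter] at hx hy
      exact T.only_child y hy.1 x h
  have h3 := (card_le_card h1).trans (card_union_le _ _)
  have h4 := card_union_le {x ∈ T.Lb | g' x ∉ T.pts g ∧ g' (T.par x) ∉ T.pts g}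
    {x ∈ T.Lb | g' x ∈ T.pts g}
  rw [emm]
  omega

lemma mem_freeLabs (hg' : T.Conf D N g') {v : V}
    (hv : v ∈ T.freeLabs g g') : v ∈ N ∧ v ∈ T.labs g' ∧ v ∉ T.pts g ∧
      ∀ ω, T.Event D N g ω → T.Event D N g' ω → Dominated v (T.inner g \ T.inner g') ω := by
  obtain ⟨x, hx, rfl⟩ := mem_image.mp hv
  obtain ⟨hxL, hx1, hx2⟩ := mem_filter.mp hx
  refine ⟨hg'.lab x hxL, mem_image_of_mem _ hxL, hx1, fun ω h h' => ?_⟩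
  obtain ⟨e, he, hω⟩ := h.2.2 (g' x) (Finset.mem_sdiff.mpr
    ⟨hg'.lab x hxL, fun h => hx1 (labs_subset_pts h)⟩)
  obtain ⟨u, hu, rfl⟩ := mem_spokes.mp he
  refine ⟨_, mem_spokes.mpr ⟨u, Finset.mem_sdiff.mpr ⟨hu, fun hu' => ?_⟩, rfl⟩, hω⟩
  obtain ⟨y, hy, rfl⟩ := mem_image.mp hu'
  rw [mem_compl] at hy
  have hne : s(g' x, g' y) ∈ T.nonedges g' := by
    rw [nonedges, Finset.mem_sdiff, Finset.mem_sdiff, mem_prs, mem_prs, mem_labs_iff hg'.inj,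
      mem_labs_iff hg'.inj]
    refine ⟨⟨⟨T.mem_pts.mpr ⟨x, rfl⟩, T.mem_pts.mpr ⟨y, rfl⟩, fun h => ?_⟩,
      fun h => hy h.2.1⟩, fun h => ?_⟩
    · exact hy (hg'.inj h ▸ hxL)
    · obtain ⟨c, _, hcc⟩ := mem_image.mp h
      rw [Sym2.eq_iff] at hcc
      rcases hcc with ⟨h1, h2⟩ | ⟨_, h2⟩
      · rw [hg'.inj h1] at h2
        exact hx2 (h2 ▸ inner_subset_pts hu)
      · exact T.par_notMem c (hg'.inj h2 ▸ hxL)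
  rw [h'.1.2 _ hne] at hω
  simp at hω

/-- The ratio between the joint probability of two events and its independent analogue. -/
def pairFactor (T : LabelledTree ι) (p : ℝ) (d ν : ℕ) (g g' : ι → V) : ℝ :=
  ind (T.Compat g g') * (p⁻¹ ^ T.shared g g' *
    (1 - p)⁻¹ ^ ((T.ell g g' + T.emm g g').choose 2 - (T.emm g g').choose 2) *
    Real.exp (4 * d * ((1 - p) ^ Fintype.card ι) ^ 2 * (1 - p)⁻¹ ^ (T.ell g g' + T.emm g g') +
      4 * Fintype.card ι * (1 - p) ^ Fintype.card ι +
      4 * ν * ((1 - p) ^ #T.Lbᶜ) ^ 2 * (1 - p)⁻¹ ^ T.ell g g' +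
      4 * T.ell g g'))

lemma pairFactor_nonneg (hp0 : 0 < p) (hp1 : p < 1) (d ν : ℕ) (g g' : ι → V) :
    0 ≤ T.pairFactor p d ν g g' := by
  have : 0 < 1 - p := by linarith
  exact mul_nonneg (ind_nonneg _) (by positivity)

/-- The factor `1 - q^{|X|} - q^{|Y|} + q^{|X ∪ Y|}`. -/
def domFactor (q : ℝ) (X Y : Finset V) : ℝ := 1 - q ^ #X - q ^ #Y + q ^ #(X ∪ Y)

lemma domFactor_nonneg {q : ℝ} (h0 : 0 ≤ q) (h1 : q ≤ 1) (X Y : Finset V) :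
    0 ≤ domFactor q X Y := by
  have hx : q ^ #X ≤ 1 := pow_le_one₀ h0 h1
  have hy : q ^ #Y ≤ 1 := pow_le_one₀ h0 h1
  have hxy : q ^ #X * q ^ #Y ≤ q ^ #(X ∪ Y) := by
    rw [← pow_add]; exact pow_le_pow_of_le_one h0 h1 (card_union_le _ _)
  unfold domFactor
  nlinarith

lemma domFactor_le {q : ℝ} (h0 : 0 < q) (h1 : q ≤ 1) {X Y : Finset V} {k s : ℕ} (hX : #X = k)
    (hY : #Y = k) (hs : #(X ∩ Y) ≤ s) (hk : q ^ k ≤ 1 / 2) :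
    domFactor q X Y ≤ (1 - q ^ k) ^ 2 * Real.exp (4 * (q ^ k) ^ 2 * q⁻¹ ^ s) := by
  refine le_trans ?_ (one_sub_two_mul_le hk (by positivity))
  unfold domFactor
  rw [hX, hY]
  refine add_le_add le_rfl ?_
  have h2 := card_union_add_card_inter X Y
  rw [inv_pow, ← div_eq_mul_inv, le_div_iff₀ (by positivity), ← pow_add, ← pow_mul]
  exact pow_le_pow_of_le_one h0.le h1 (by omega)

variable [Fintype V]

lemma pr_event_and_le_prod (hp0 : 0 ≤ p) (hp1 : p ≤ 1) (hDN : Disjoint D N)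
    (hg : T.Conf D N g) (hg' : T.Conf D N g')
    (hAB : Disjoint (T.edges g ∪ T.edges g') (T.nonedges g ∪ T.nonedges g')) :
    pr p (fun ω => T.Event D N g ω ∧ T.Event D N g' ω) ≤
      p ^ #(T.edges g ∪ T.edges g') * (1 - p) ^ #(T.nonedges g ∪ T.nonedges g') *
      (domFactor (1 - p) (T.pts g) (T.pts g') ^ #(D \ (T.inner g ∪ T.inner g')) *
       domFactor (1 - p) (T.inner g) (T.inner g') ^ #(N \ (T.labs g ∪ T.labs g')) *
       domFactor (1 - p) (T.inner g \ T.inner g') (T.inner g \ T.inner g') ^ #(T.freeLabs g g') *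
       domFactor (1 - p) (T.inner g' \ T.inner g) (T.inner g' \ T.inner g) ^
        #(T.freeLabs g' g)) := by
  have hSD := inner_subset hg
  have hIN := labs_subset hg
  have hSD' := inner_subset hg'
  have hIN' := labs_subset hg'
  have hC := T.pts_eq g
  have hC' := T.pts_eq g'
  set S := T.inner g
  set S' := T.inner g'
  set I := T.labs g
  set I' := T.labs g'
  set F := T.freeLabs g g' with hF
  set F' := T.freeLabs g' g with hF'
  have hFm : ∀ v ∈ F, v ∈ N ∧ v ∈ I' ∧ v ∉ T.pts g ∧ _ :=
    fun v hv => mem_freeLabs hg' hv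
  have hFm' : ∀ v ∈ F', v ∈ N ∧ v ∈ I ∧ v ∉ T.pts g' ∧ _ :=
    fun v hv => mem_freeLabs hg hv
  have hFF' : Disjoint F F' := disjoint_left.mpr fun v hv hv' =>
    (hFm v hv).2.2.1 (labs_subset_pts (hFm' v hv').2.1)
  have hFI : Disjoint (N \ (I ∪ I')) F := disjoint_left.mpr fun v hv hv' =>
    (Finset.mem_sdiff.mp hv).2 (mem_union_right _ (hFm v hv').2.1)
  have hFI' : Disjoint (N \ (I ∪ I')) F' := disjoint_left.mpr fun v hv hv' =>
    (Finset.mem_sdiff.mp hv).2 (mem_union_left _ (hFm' v hv').2.1)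
  have hDd : ∀ v ∈ N, v ∉ D := fun v h h' => disjoint_left.mp hDN h' h
  have hDF : Disjoint D F := disjoint_left.mpr fun v hv hv' => hDd v (hFm v hv').1 hv
  have hDF' : Disjoint D F' := disjoint_left.mpr fun v hv hv' => hDd v (hFm' v hv').1 hv
  set X : V → Finset V := fun v => if v ∈ D then T.pts g else if v ∈ F then S \ S' else
    if v ∈ F' then S' \ S else S with hX
  set Y : V → Finset V := fun v => if v ∈ D then T.pts g' else if v ∈ F then S \ S' else
    if v ∈ F' then S' \ S else S' with hY
  set t := D \ (S ∪ S') ∪ (N \ (I ∪ I') ∪ (F ∪ F')) with ht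
  have e1 : ∀ v ∈ D \ (S ∪ S'), X v = T.pts g ∧ Y v = T.pts g' := by
    intro v hv
    have := (Finset.mem_sdiff.mp hv).1
    simp [hX, hY, this]
  have e2 : ∀ v ∈ N \ (I ∪ I'), X v = S ∧ Y v = S' := by
    intro v hv
    have h1 := hDd v (Finset.mem_sdiff.mp hv).1
    have h2 := disjoint_left.mp hFI hv
    have h3 := disjoint_left.mp hFI' hv
    simp [hX, hY, h1, h2, h3]
  have e3 : ∀ v ∈ F, X v = S \ S' ∧ Y v = S \ S' := by
    intro v hv
    have h1 := hDd v (hFm v hv).1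
    simp [hX, hY, h1, hv]
  have e4 : ∀ v ∈ F', X v = S' \ S ∧ Y v = S' \ S := by
    intro v hv
    have h1 := hDd v (hFm' v hv).1
    have h2 := disjoint_right.mp hFF' hv
    simp [hX, hY, h1, hv, h2]
  have hXYS : ∀ v ∈ N \ (I ∪ I') ∪ (F ∪ F'), X v ∪ Y v ⊆ S ∪ S' := by
    intro v hv
    simp only [mem_union] at hv
    rcases hv with hv | hv | hv
    · rw [(e2 v (by simpa using hv)).1, (e2 v (by simpa using hv)).2]
    · rw [(e3 v hv).1, (e3 v hv).2, union_self]
      exact sdiff_subset.trans subset_union_left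
    · rw [(e4 v hv).1, (e4 v hv).2, union_self]
      exact sdiff_subset.trans subset_union_right
  have hout : ∀ v ∈ D \ (S ∪ S'), v ∉ T.pts g ∪ T.pts g' := by
    intro v hv
    rw [hC, hC']
    simp only [Finset.mem_sdiff, mem_union] at hv ⊢
    have h1 : v ∉ I := fun h => hDd v (hIN h) hv.1
    have h2 : v ∉ I' := fun h => hDd v (hIN' h) hv.1
    tauto
  have hout2 : ∀ v ∈ N \ (I ∪ I'), v ∉ T.pts g ∪ T.pts g' := by
    intro v hv
    rw [hC, hC']
    simp only [Finset.mem_sdiff, mem_union] at hv ⊢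
    have h1 : v ∉ S := fun h => hDd v hv.1 (hSD h)
    have h2 : v ∉ S' := fun h => hDd v hv.1 (hSD' h)
    tauto
  have hNt : ∀ v ∈ N \ (I ∪ I') ∪ (F ∪ F'), v ∈ N := by
    intro v hv
    simp only [mem_union] at hv
    rcases hv with hv | hv | hv
    · exact (Finset.mem_sdiff.mp hv).1
    · exact (hFm v hv).1
    · exact (hFm' v hv).1
  have hNS : ∀ v ∈ N \ (I ∪ I') ∪ (F ∪ F'), v ∉ S ∪ S' := by
    intro v hv h
    exact hDd v (hNt v hv) (union_subset hSD hSD' h)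
  have hprsub : (T.edges g ∪ T.edges g') ∪ (T.nonedges g ∪ T.nonedges g') ⊆
      prs (T.pts g) ∪ prs (T.pts g') := by
    refine union_subset (union_subset_union ?_ ?_) (union_subset_union ?_ ?_)
    · exact (edges_subset hg.inj).trans sdiff_subset
    · exact (edges_subset hg'.inj).trans sdiff_subset
    · exact sdiff_subset.trans sdiff_subset
    · exact sdiff_subset.trans sdiff_subset
  have hmain := pr_prescribed_and_dominated p hAB t X Y ?_ ?_
  · refine le_trans (pr_mono hp0 hp1 ?_) (hmain.le.trans (le_of_eq ?_))
    · rintro ω ⟨h, h'⟩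
      refine ⟨⟨fun e he => ?_, fun e he => ?_⟩, fun v hv => ?_⟩
      · exact (mem_union.mp he).elim (h.1.1 e) (h'.1.1 e)
      · exact (mem_union.mp he).elim (h.1.2 e) (h'.1.2 e)
      · rw [ht, mem_union, mem_union, mem_union] at hv
        rcases hv with hv | hv | hv | hv
        · rw [(e1 v hv).1, (e1 v hv).2]
          rw [Finset.mem_sdiff, mem_union, not_or] at hv
          exact ⟨h.2.1 v (Finset.mem_sdiff.mpr ⟨hv.1, hv.2.1⟩),
            h'.2.1 v (Finset.mem_sdiff.mpr ⟨hv.1, hv.2.2⟩)⟩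
        · rw [(e2 v hv).1, (e2 v hv).2]
          rw [Finset.mem_sdiff, mem_union, not_or] at hv
          exact ⟨h.2.2 v (Finset.mem_sdiff.mpr ⟨hv.1, hv.2.1⟩),
            h'.2.2 v (Finset.mem_sdiff.mpr ⟨hv.1, hv.2.2⟩)⟩
        · rw [(e3 v hv).1, (e3 v hv).2, and_self]
          exact (mem_freeLabs hg' hv).2.2.2 ω h h'
        · rw [(e4 v hv).1, (e4 v hv).2, and_self]
          exact (mem_freeLabs hg hv).2.2.2 ω h' h
    · congr 1
      rw [ht, Finset.prod_union (hDN.mono sdiff_subset fun v hv => hNt v hv),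
        Finset.prod_union (disjoint_union_right.mpr ⟨hFI, hFI'⟩), Finset.prod_union hFF',
        ← mul_assoc, ← mul_assoc]
      congr 1
      · congr 1
        · congr 1
          · exact Finset.prod_eq_pow_card fun v hv => by rw [(e1 v hv).1, (e1 v hv).2]; rfl
          · exact Finset.prod_eq_pow_card fun v hv => by rw [(e2 v hv).1, (e2 v hv).2]; rfl
        · exact Finset.prod_eq_pow_card fun v hv => by rw [(e3 v hv).1, (e3 v hv).2]; rfl
      · exact Finset.prod_eq_pow_card fun v hv => by rw [(e4 v hv).1, (e4 v hv).2]; rfl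
  · intro v hv
    refine Disjoint.mono_right hprsub ?_
    rw [ht, mem_union, mem_union, mem_union] at hv
    rw [disjoint_union_right]
    rcases hv with hv | hv | hv | hv
    · have := hout v hv
      rw [mem_union, not_or] at this
      exact ⟨disjoint_spokes_prs this.1, disjoint_spokes_prs this.2⟩
    · have := hout2 v hv
      rw [mem_union, not_or] at this
      exact ⟨disjoint_spokes_prs this.1, disjoint_spokes_prs this.2⟩
    · refine ⟨disjoint_spokes_prs (hFm v hv).2.2.1, ?_⟩
      rw [(e3 v hv).1, (e3 v hv).2, union_self, disjoint_left]
      intro e he he'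
      obtain ⟨u, hu, rfl⟩ := mem_spokes.mp he
      rw [Finset.mem_sdiff] at hu
      have := (mem_prs.mp he').2.1
      rw [hC', mem_union] at this
      exact this.elim hu.2 fun h => hDd u (hIN' h) (hSD hu.1)
    · refine ⟨?_, disjoint_spokes_prs (hFm' v hv).2.2.1⟩
      rw [(e4 v hv).1, (e4 v hv).2, union_self, disjoint_left]
      intro e he he'
      obtain ⟨u, hu, rfl⟩ := mem_spokes.mp he
      rw [Finset.mem_sdiff] at hu
      have := (mem_prs.mp he').2.1
      rw [hC, mem_union] at this
      exact this.elim hu.2 fun h => hDd u (hIN h) (hSD' hu.1)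
  · intro v hv v' hv' _
    rw [ht, mem_union] at hv hv'
    rcases hv' with hv' | hv'
    · rcases hv with hv | hv
      · left; rw [(e1 v' hv').1, (e1 v' hv').2]; exact hout v hv
      · right; exact fun h => (Finset.mem_sdiff.mp hv').2 (hXYS v hv h)
    · left
      intro h
      have h2 := hXYS v' hv' h
      rcases hv with hv | hv
      · exact (Finset.mem_sdiff.mp hv).2 h2
      · exact hNS v hv h2

lemma pr_event_and_le (hp0 : 0 < p) (hp1 : p < 1) (hDN : Disjoint D N) (hg : T.Conf D N g)
    (hg' : T.Conf D N g') (hq₁ : (1 - p) ^ Fintype.card ι ≤ 1 / 2)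
    (hq₂ : (1 - p) ^ #T.Lbᶜ ≤ 1 / 2) :
    pr p (fun ω => T.Event D N g ω ∧ T.Event D N g' ω) ≤
      T.prEvent p #D #N ^ 2 * T.pairFactor p #D #N g g' := by
  have hq0 : 0 < 1 - p := by linarith
  have hq1 : 1 - p ≤ 1 := by linarith
  by_cases hcompat : T.Compat g g'
  swap
  · have : ∀ ω, ¬ (T.Event D N g ω ∧ T.Event D N g' ω) :=
      fun ω h => hcompat (compat_of_event hDN hg hg' h.1 h.2)
    rw [pr, funext fun ω => ind_of_not (this ω), ex_const]
    exact mul_nonneg (sq_nonneg _) (pairFactor_nonneg hp0 hp1 _ _ _ _)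
  by_cases hAB : Disjoint (T.edges g ∪ T.edges g') (T.nonedges g ∪ T.nonedges g')
  swap
  · obtain ⟨e, he, he'⟩ := not_disjoint_iff.mp hAB
    have : ∀ ω, ¬ (T.Event D N g ω ∧ T.Event D N g' ω) := by
      rintro ω ⟨h, h'⟩
      have h1 : ω e = true := (mem_union.mp he).elim (h.1.1 e) (h'.1.1 e)
      have h2 : ω e = false := (mem_union.mp he').elim (h.1.2 e) (h'.1.2 e)
      simp [h1] at h2
    rw [pr, funext fun ω => ind_of_not (this ω), ex_const]
    exact mul_nonneg (sq_nonneg _) (pairFactor_nonneg hp0 hp1 _ _ _ _)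
  refine (pr_event_and_le_prod hp0.le hp1.le hDN hg hg' hAB).trans ?_
  set q₁ := (1 - p) ^ Fintype.card ι with hq₁d
  set q₂ := (1 - p) ^ #T.Lbᶜ with hq₂d
  set l := T.ell g g' with hl
  set m := T.emm g g' with hm
  set Y := (1 - p)⁻¹ ^ (l + m) with hY
  have hY0 : 0 ≤ Y := by positivity
  set Z := (1 - p)⁻¹ ^ l with hZ
  have hZ0 : 0 ≤ Z := by positivity
  have hq₁0 : 0 < q₁ := by positivity
  have hq₂0 : 0 < q₂ := by positivity
  have hci := card_inner_inter hDN hg hg'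
  have hcl := card_labs_inter hDN hg hg'
  have hkD : #T.Lbᶜ ≤ #D := by rw [← card_inner (T := T) hg.inj]; exact card_le_card (inner_subset hg)
  have hwN : #T.Lb ≤ #N := by rw [← card_labs (T := T) hg.inj]; exact card_le_card (labs_subset hg)
  -- the number of points in each part
  have hc1 : 2 * (#D - #T.Lbᶜ) ≤ 2 * #(D \ (T.inner g ∪ T.inner g')) + 2 * #T.Lbᶜ := by
    have h1 := card_union_add_card_inter (T.inner g) (T.inner g')
    rw [card_inner hg.inj, card_inner hg'.inj] at h1
    rw [card_sdiff_of_subset (union_subset (inner_subset hg) (inner_subset hg'))]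
    omega
  have hc2 : 2 * (#N - #T.Lb) ≤ 2 * #(N \ (T.labs g ∪ T.labs g')) + #(T.freeLabs g g') +
      #(T.freeLabs g' g) + 2 * l := by
    have h1 := card_union_add_card_inter (T.labs g) (T.labs g')
    rw [card_labs hg.inj, card_labs hg'.inj, hcl] at h1
    have h2 := card_freeLabs_ge (T := T) (g := g) hg'.inj
    have h3 := card_freeLabs_ge (T := T) (g := g') hg.inj
    have h4 := ell_comm hDN hg hg'
    have h5 : T.emm g' g = m := by
      rw [← card_labs_inter hDN hg' hg, inter_comm, hcl]
    rw [card_sdiff_of_subset (union_subset (labs_subset hg) (labs_subset hg'))]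
    omega
  -- the first part
  have hf1 : domFactor (1 - p) (T.pts g) (T.pts g') ≤ (1 - q₁) ^ 2 * Real.exp (4 * q₁ ^ 2 * Y) :=
    domFactor_le hq0 hq1 (card_pts hg.inj) (card_pts hg'.inj) (card_pts_inter hg'.inj).le hq₁
  have hf2 : domFactor (1 - p) (T.inner g) (T.inner g') ≤
      (1 - q₂) ^ 2 * Real.exp (4 * q₂ ^ 2 * Z) :=
    domFactor_le hq0 hq1 (card_inner hg.inj) (card_inner hg'.inj) hci.le hq₂
  have hf3 : ∀ X : Finset V, #X ≤ #T.Lbᶜ → domFactor (1 - p) X X ≤ 1 - q₂ := by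
    intro X hX
    have : q₂ ≤ (1 - p) ^ #X := pow_le_pow_of_le_one hq0.le hq1 hX
    unfold domFactor
    rw [union_self]; linarith
  have hf4 := hf3 (T.inner g \ T.inner g')
    ((card_le_card sdiff_subset).trans (card_inner hg.inj).le)
  have hf5 := hf3 (T.inner g' \ T.inner g)
    ((card_le_card sdiff_subset).trans (card_inner hg'.inj).le)
  have hdf0 := domFactor_nonneg (V := V) hq0.le hq1
  have hA : p ^ #(T.edges g ∪ T.edges g') ≤ (p ^ #T.nonroots) ^ 2 * p⁻¹ ^ T.shared g g' := by
    have h1 := card_union_add_card_inter (T.edges g) (T.edges g')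
    rw [card_edges hg.inj, card_edges hg'.inj] at h1
    have h2 := card_edges_inter_le (T := T) (g := g) (g' := g')
    rw [inv_pow, ← div_eq_mul_inv, le_div_iff₀ (by positivity), ← pow_add, ← pow_mul]
    exact pow_le_pow_of_le_one hp0.le hp1.le (by omega)
  have hB : (1 - p) ^ #(T.nonedges g ∪ T.nonedges g') ≤
      ((1 - p) ^ ((Fintype.card ι).choose 2 - (#T.Lb).choose 2 - #T.nonroots)) ^ 2 *
        (1 - p)⁻¹ ^ ((l + m).choose 2 - m.choose 2) := by
    have h1 := card_union_add_card_inter (T.nonedges g) (T.nonedges g')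
    rw [card_nonedges hg.inj, card_nonedges hg'.inj] at h1
    have h2 := card_nonedges_inter_le hDN hg hg'
    rw [← hl, ← hm] at h2
    rw [inv_pow, ← div_eq_mul_inv, le_div_iff₀ (by positivity), ← pow_add, ← pow_mul]
    exact pow_le_pow_of_le_one hq0.le hq1 (by omega)
  have hP1 : domFactor (1 - p) (T.pts g) (T.pts g') ^ #(D \ (T.inner g ∪ T.inner g')) ≤
      (1 - q₁) ^ (2 * (#D - #T.Lbᶜ)) * Real.exp (4 * #D * q₁ ^ 2 * Y + 4 * Fintype.card ι * q₁) := by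
    calc _ ≤ ((1 - q₁) ^ 2 * Real.exp (4 * q₁ ^ 2 * Y)) ^ #(D \ (T.inner g ∪ T.inner g')) :=
          pow_le_pow_left₀ (hdf0 _ _) hf1 _
      _ = (1 - q₁) ^ (2 * #(D \ (T.inner g ∪ T.inner g'))) *
            Real.exp (4 * q₁ ^ 2 * Y * #(D \ (T.inner g ∪ T.inner g'))) := by
          rw [mul_pow, ← pow_mul, ← Real.exp_nat_mul]; ring_nf
      _ ≤ ((1 - q₁) ^ (2 * (#D - #T.Lbᶜ)) * Real.exp (2 * q₁ * (2 * #T.Lbᶜ : ℕ))) *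
            Real.exp (4 * q₁ ^ 2 * Y * #D) := by
          have h1q : 0 ≤ 1 - q₁ := by linarith
          gcongr
          · exact pow_le_pow_mul_exp hq₁0.le hq₁ hc1
          · exact sdiff_subset
      _ = (1 - q₁) ^ (2 * (#D - #T.Lbᶜ)) * Real.exp (4 * #D * q₁ ^ 2 * Y + 4 * #T.Lbᶜ * q₁) := by
          rw [mul_assoc, ← Real.exp_add]; push_cast; ring_nf
      _ ≤ _ := by
          have : ((#T.Lbᶜ : ℕ) : ℝ) ≤ Fintype.card ι := by exact_mod_cast card_le_univ _
          have h1q : 0 ≤ 1 - q₁ := by linarith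
          gcongr
  have hP2 : domFactor (1 - p) (T.inner g) (T.inner g') ^ #(N \ (T.labs g ∪ T.labs g')) *
      domFactor (1 - p) (T.inner g \ T.inner g') (T.inner g \ T.inner g') ^ #(T.freeLabs g g') *
      domFactor (1 - p) (T.inner g' \ T.inner g) (T.inner g' \ T.inner g) ^
        #(T.freeLabs g' g) ≤ (1 - q₂) ^ (2 * (#N - #T.Lb)) *
        Real.exp (4 * #N * q₂ ^ 2 * Z + 4 * l) := by
    have h1q : 0 ≤ 1 - q₂ := by linarith
    calc _ ≤ ((1 - q₂) ^ 2 * Real.exp (4 * q₂ ^ 2 * Z)) ^ #(N \ (T.labs g ∪ T.labs g')) *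
            (1 - q₂) ^ #(T.freeLabs g g') * (1 - q₂) ^ #(T.freeLabs g' g) :=
          mul_le_mul (mul_le_mul (pow_le_pow_left₀ (hdf0 _ _) hf2 _)
            (pow_le_pow_left₀ (hdf0 _ _) hf4 _) (pow_nonneg (hdf0 _ _) _) (by positivity))
            (pow_le_pow_left₀ (hdf0 _ _) hf5 _) (pow_nonneg (hdf0 _ _) _) (by positivity)
      _ = (1 - q₂) ^ (2 * #(N \ (T.labs g ∪ T.labs g')) + #(T.freeLabs g g') +
            #(T.freeLabs g' g)) *
            Real.exp (4 * q₂ ^ 2 * Z * #(N \ (T.labs g ∪ T.labs g'))) := by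
          rw [mul_pow, ← pow_mul, ← Real.exp_nat_mul, pow_add, pow_add]; ring_nf
      _ ≤ ((1 - q₂) ^ (2 * (#N - #T.Lb)) * Real.exp (2 * q₂ * (2 * l : ℕ))) *
            Real.exp (4 * q₂ ^ 2 * Z * #N) := by
          gcongr
          · exact pow_le_pow_mul_exp hq₂0.le hq₂ hc2
          · exact sdiff_subset
      _ = (1 - q₂) ^ (2 * (#N - #T.Lb)) * Real.exp (4 * #N * q₂ ^ 2 * Z + 4 * q₂ * l) := by
          rw [mul_assoc, ← Real.exp_add]; push_cast; ring_nf
      _ ≤ _ := by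
          have : 4 * q₂ * (l : ℝ) ≤ 4 * l := by
            have : (0 : ℝ) ≤ l := by positivity
            nlinarith
          gcongr
  have hn1 := hdf0 (T.pts g) (T.pts g')
  have hn2 := hdf0 (T.inner g) (T.inner g')
  have hn3 := hdf0 (T.inner g \ T.inner g') (T.inner g \ T.inner g')
  have hn4 := hdf0 (T.inner g' \ T.inner g) (T.inner g' \ T.inner g)
  have h1q₁ : 0 ≤ 1 - q₁ := by linarith
  have h1q₂ : 0 ≤ 1 - q₂ := by linarith
  rw [mul_assoc (domFactor _ _ _ ^ _) , mul_assoc (domFactor _ _ _ ^ _)]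
  refine (mul_le_mul (mul_le_mul hA hB (by positivity) (by positivity))
    (mul_le_mul hP1 hP2 (by positivity) (by positivity)) (by positivity) (by positivity)).trans
    (le_of_eq ?_)
  rw [prEvent, pairFactor, ind_of hcompat, ← hl, ← hm]
  have hexp : Real.exp (4 * #D * q₁ ^ 2 * Y + 4 * Fintype.card ι * q₁ + 4 * #N * q₂ ^ 2 * Z + 4 * l) =
      Real.exp (4 * #D * q₁ ^ 2 * Y + 4 * Fintype.card ι * q₁) * Real.exp (4 * #N * q₂ ^ 2 * Z + 4 * l) := by
    rw [← Real.exp_add]; ring_nf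
  rw [← hY, ← hZ, ← hq₁d, ← hq₂d, hexp]
  ring

end LabelledTree

end PairBound

section SmallOverlap

open Finset

variable {ι V : Type*} [Fintype ι] [DecidableEq ι] [DecidableEq V] {T : LabelledTree ι}

namespace LabelledTree

lemma par_par_ne {x : ι} (hx : x ∈ T.Lb) : T.par (T.par x) ≠ T.par x := fun h =>
  T.par_notMem x (by rw [← T.only_child₂ x hx x h.symm]; exact hx)

lemma par_par_ne_par {x y : ι} (hy : y ∈ T.Lb) : T.par (T.par x) ≠ T.par y := fun h =>
  T.par_notMem x (by rw [T.only_child y hy _ h]; exact hy)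

/-- The label `μ x` is used by `g`, and `u` is its parent. -/
def IsPar (T : LabelledTree ι) (g : ι → V) (μ : V) (u : V) : Prop :=
  ∃ y ∈ T.Lb, g y = μ ∧ u = g (T.par y)

/-- The label `μ x` is used by `g`, and `u` is its grandparent. -/
def IsPar₂ (T : LabelledTree ι) (g : ι → V) (μ : V) (u : V) : Prop :=
  ∃ y ∈ T.Lb, g y = μ ∧ u = g (T.par (T.par y))

omit [DecidableEq V] in
lemma sum_mul_ind_le {P : Finset V} {Q : V → Prop} (hQ : ∀ u v, Q u → Q v → u = v)
    {F : V → ℝ} {c : ℝ} (hc : 0 ≤ c) (hF : ∀ v ∈ P, Q v → F v ≤ c) :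
    ∑ v ∈ P, F v * ind (Q v) ≤ c := by
  by_cases h : ∃ v ∈ P, Q v
  · obtain ⟨v, hv, hQv⟩ := h
    rw [Finset.sum_eq_single_of_mem v hv, ind_of hQv, mul_one]
    · exact hF v hv hQv
    · intro u _ hne
      rw [ind_of_not fun hu => hne (hQ u v hu hQv), mul_zero]
  · push Not at h
    rw [Finset.sum_eq_zero]
    · exact hc
    · intro v hv
      rw [ind_of_not (h v hv), mul_zero]

variable {p z : ℝ} {g : ι → V}

omit [DecidableEq V] in
lemma isPar_unique (hg : Function.Injective g) {μ u v : V} (hu : T.IsPar g μ u)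
    (hv : T.IsPar g μ v) : u = v := by
  obtain ⟨y, _, h1, rfl⟩ := hu
  obtain ⟨y', _, h1', rfl⟩ := hv
  rw [hg (h1.trans h1'.symm)]

omit [DecidableEq V] in
lemma isPar₂_unique (hg : Function.Injective g) {μ u v : V} (hu : T.IsPar₂ g μ u)
    (hv : T.IsPar₂ g μ v) : u = v := by
  obtain ⟨y, _, h1, rfl⟩ := hu
  obtain ⟨y', _, h1', rfl⟩ := hv
  rw [hg (h1.trans h1'.symm)]

lemma hw_label_le (hg : Function.Injective g) (hp0 : 0 < p) {D N : Finset V}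
    (hDN : Disjoint D N) (hD : ∀ x ∉ T.Lb, g x ∈ D) {μ u : V} (hμ : μ ∈ N) :
    T.hw p g 1 μ u ≤ 1 + p⁻¹ * ind (T.IsPar g μ u) := by
  have hi := mul_nonneg (inv_pos.mpr hp0).le (ind_nonneg (T.IsPar g μ u))
  by_cases h1 : μ ∈ T.pts g
  swap
  · simp only [hw, h1, not_false_eq_true, if_true]; linarith
  by_cases h2 : u ∈ T.pts g
  swap
  · simp only [hw, h1, h2, not_true_eq_false, not_false_eq_true, if_true, if_false]; linarith
  by_cases h3 : s(μ, u) ∈ T.edges g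
  swap
  · simp only [hw, h1, h2, h3, not_true_eq_false, if_false]; linarith
  simp only [hw, h1, h2, h3, not_true_eq_false, if_true, if_false]
  have : T.IsPar g μ u := by
    obtain ⟨y, rfl⟩ := T.mem_pts.mp h1
    have hy : y ∈ T.Lb := by
      by_contra hy
      exact disjoint_left.mp hDN (hD y hy) hμ
    obtain ⟨c, hc, hcc⟩ := mem_image.mp h3
    rw [Sym2.eq_iff] at hcc
    rcases hcc with ⟨h4, h5⟩ | ⟨_, h5⟩
    · exact ⟨y, hy, rfl, by rw [← h5, hg h4]⟩
    · exact absurd (hg h5 ▸ hy) (T.par_notMem c)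
  rw [ind_of this]
  linarith

lemma hw_par_le (hg : Function.Injective g) (hp0 : 0 < p) (hz : 0 ≤ z) {D N : Finset V}
    (hDN : Disjoint D N) (hN : ∀ x ∈ T.Lb, g x ∈ N) {μ v u : V} (hu : u ∈ D)
    (hv : T.IsPar g μ v) :
    T.hw p g z v u ≤ z * (1 + p⁻¹ * ind (T.IsPar₂ g μ u)) := by
  have hi := mul_nonneg (inv_pos.mpr hp0).le (ind_nonneg (T.IsPar₂ g μ u))
  obtain ⟨y, hy, hyμ, rfl⟩ := hv
  unfold hw
  rw [if_neg (not_not.mpr (T.mem_pts.mpr ⟨_, rfl⟩))]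
  refine mul_le_mul_of_nonneg_left ?_ hz
  by_cases h2 : u ∈ T.pts g
  swap
  · simp only [h2, not_false_eq_true, if_true]; linarith
  by_cases h3 : s(g (T.par y), u) ∈ T.edges g
  swap
  · simp only [h2, h3, not_true_eq_false, if_false]; linarith
  simp only [h2, h3, not_true_eq_false, if_true, if_false]
  have : T.IsPar₂ g μ u := by
    refine ⟨y, hy, hyμ, ?_⟩
    obtain ⟨c, hc, hcc⟩ := mem_image.mp h3
    rw [Sym2.eq_iff] at hcc
    rcases hcc with ⟨h4, h5⟩ | ⟨h4, h5⟩
    · rw [← h5, hg h4]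
    · rw [T.only_child y hy c (hg h5)] at h4
      rw [← h4] at hu
      exact absurd (hN y hy) (disjoint_left.mp hDN hu)
  rw [ind_of this]
  linarith

lemma lw_le (hp0 : 0 < p) (hp1 : p ≤ 1) (hz : 1 ≤ z) (x : ι) (g' : ι → V) :
    T.lw p g z x g' ≤ z * p⁻¹ := by
  have h1 : 1 ≤ p⁻¹ := (one_le_inv₀ hp0).mpr hp1
  have h2 : 1 ≤ z * p⁻¹ := one_le_mul_of_one_le_of_one_le hz h1
  have h3 : z ≤ z * p⁻¹ := le_mul_of_one_le_right (by linarith) h1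
  unfold lw rw₀ hw
  split_ifs <;> linarith

/-- The weight moved from the parent of a label to its grandparent. -/
def shift (T : LabelledTree ι) (p z : ℝ) (n₃ : ℕ) (g : ι → V) (μ u : V) : ℝ :=
  1 + z * Fintype.card ι / n₃ + z / (p * n₃) + z / (p ^ 2 * n₃) * ind (T.IsPar₂ g μ u)

omit [DecidableEq V] in
lemma shift_ge_one (hp0 : 0 < p) (hz : 0 ≤ z) (n₃ : ℕ) (μ u : V) :
    1 ≤ T.shift p z n₃ g μ u := by
  have := ind_nonneg (T.IsPar₂ g μ u)
  have h1 : 0 ≤ z * Fintype.card ι / n₃ := by positivity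
  have h2 : 0 ≤ z / (p * n₃) := by positivity
  have h3 : 0 ≤ z / (p ^ 2 * n₃) * ind (T.IsPar₂ g μ u) := by positivity
  unfold shift
  linarith

/-- The redistributed local weights. -/
def shiftedWeight (T : LabelledTree ι) (p z : ℝ) (n₃ : ℕ) (g : ι → V) (μ : ι → V) (y : ι)
    (g' : ι → V) : ℝ :=
  (if y ∈ T.Lb then 1 else T.lw p g z y g') *
    (∏ x ∈ T.Lb with T.par x = y, (1 + p⁻¹ * ind (T.IsPar g (μ x) (g' y))) /
      T.shift p z n₃ g (μ x) (g' (T.par y))) *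
    ∏ x ∈ T.Lb with T.par (T.par x) = y, T.shift p z n₃ g (μ x) (g' y)

lemma shiftedWeight_nonneg (hp0 : 0 < p) (hz : 0 ≤ z) (n₃ : ℕ) (μ : ι → V) (y : ι) (g' : ι → V) :
    0 ≤ T.shiftedWeight p z n₃ g μ y g' := by
  have hs : ∀ μ u, 0 ≤ T.shift p z n₃ g μ u := fun μ u =>
    zero_le_one.trans (shift_ge_one hp0 hz n₃ μ u)
  refine mul_nonneg (mul_nonneg ?_ (Finset.prod_nonneg fun x _ => div_nonneg ?_ (hs _ _)))
    (Finset.prod_nonneg fun x _ => hs _ _)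
  · split_ifs
    · exact zero_le_one
    · exact lw_nonneg hp0.le hz _ _
  · have := ind_nonneg (T.IsPar g (μ x) (g' y))
    positivity

lemma shiftedWeight_update (n₃ : ℕ) (μ : ι → V) (x y : ι) (hyx : y ≠ x) (hrk : T.rk x ≤ T.rk y)
    (g' : ι → V) (v : V) :
    T.shiftedWeight p z n₃ g μ x (Function.update g' y v) = T.shiftedWeight p z n₃ g μ x g' := by
  have h1 : T.par x ≠ y := by
    rintro rfl
    exact absurd (T.rk_lt x hyx) (not_lt.mpr hrk)
  unfold shiftedWeight
  rw [lw_update x y hyx hrk, Function.update_of_ne hyx.symm, Function.update_of_ne h1]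

lemma prod_lw_le_prod_shiftedWeight (hg : Function.Injective g) (hp0 : 0 < p) (hz : 0 ≤ z)
    (n₃ : ℕ) {D N : Finset V} (hDN : Disjoint D N) (hD : ∀ x ∉ T.Lb, g x ∈ D) {μ g' : ι → V}
    (hμ : ∀ x ∈ T.Lb, g' x = μ x ∧ μ x ∈ N) :
    ∏ x, T.lw p g (if x ∈ T.Lb then 1 else z) x g' ≤ ∏ x, T.shiftedWeight p z n₃ g μ x g' := by
  have e1 : ∏ y, ∏ x ∈ T.Lb with T.par x = y, (1 + p⁻¹ * ind (T.IsPar g (μ x) (g' y))) /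
      T.shift p z n₃ g (μ x) (g' (T.par y)) =
      ∏ x ∈ T.Lb, (1 + p⁻¹ * ind (T.IsPar g (μ x) (g' (T.par x)))) /
        T.shift p z n₃ g (μ x) (g' (T.par (T.par x))) := by
    rw [← Finset.prod_fiberwise T.Lb T.par]
    refine Finset.prod_congr rfl fun y _ => Finset.prod_congr rfl fun x hx => ?_
    rw [(mem_filter.mp hx).2]
  have e2 : ∏ y, ∏ x ∈ T.Lb with T.par (T.par x) = y, T.shift p z n₃ g (μ x) (g' y) =
      ∏ x ∈ T.Lb, T.shift p z n₃ g (μ x) (g' (T.par (T.par x))) := by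
    rw [← Finset.prod_fiberwise T.Lb fun x => T.par (T.par x)]
    refine Finset.prod_congr rfl fun y _ => Finset.prod_congr rfl fun x hx => ?_
    rw [(mem_filter.mp hx).2]
  simp only [shiftedWeight]
  rw [Finset.prod_mul_distrib, Finset.prod_mul_distrib, e1, e2, mul_assoc, ← Finset.prod_mul_distrib]
  have e3 : ∀ x ∈ T.Lb, (1 + p⁻¹ * ind (T.IsPar g (μ x) (g' (T.par x)))) /
      T.shift p z n₃ g (μ x) (g' (T.par (T.par x))) *
      T.shift p z n₃ g (μ x) (g' (T.par (T.par x))) =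
      1 + p⁻¹ * ind (T.IsPar g (μ x) (g' (T.par x))) := fun x _ =>
    div_mul_cancel₀ _ (zero_lt_one.trans_le (shift_ge_one hp0 hz n₃ _ _)).ne'
  rw [Finset.prod_congr rfl e3, ← Fintype.prod_ite_mem T.Lb, ← Finset.prod_mul_distrib]
  refine Finset.prod_le_prod (fun x _ => lw_nonneg hp0.le (by split_ifs; exacts [zero_le_one, hz]) _ _)
    fun x _ => ?_
  by_cases hx : x ∈ T.Lb
  · simp only [hx, if_true, one_mul]
    rw [lw, if_neg (T.nonroot_of_mem hx), (hμ x hx).1]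
    exact hw_label_le hg hp0 hDN hD (hμ x hx).2
  · simp only [hx, if_false, mul_one, le_refl]

lemma sum_shiftedWeight_le (hg : Function.Injective g) (hp0 : 0 < p) (hp1 : p ≤ 1) (hz : 1 ≤ z)
    (hκ : 7 ≤ p * Fintype.card ι) {D N P₃ : Finset V} (hDN : Disjoint D N) (hP₃ : P₃ ⊆ D)
    (hn₃ : P₃.Nonempty) (hN : ∀ x ∈ T.Lb, g x ∈ N) (μ : ι → V) {x : ι} (hx : x ∉ T.Lb)
    (g' : ι → V) (hg' : ∀ x ∉ T.Lb, g' x ∈ P₃) :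
    ∑ v ∈ P₃, T.shiftedWeight p z #P₃ g μ x (Function.update g' x v) ≤
      #P₃ * Real.exp (2 * (z * Fintype.card ι / #P₃) + z / (p * #P₃) +
        z ^ 2 / (p ^ 3 * #P₃ ^ 2)) := by
  have hz0 : 0 ≤ z := by linarith
  have hn : (0 : ℝ) < #P₃ := by exact_mod_cast card_pos.mpr hn₃
  have h0 : 0 ≤ z * Fintype.card ι / #P₃ := by positivity
  have h1 : 0 ≤ z / (p * #P₃) := by positivity
  have h2 : 0 ≤ z ^ 2 / (p ^ 3 * #P₃ ^ 2) := by positivity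
  have hlw := fun y => sum_lw_update_le (T := T) hg hp0 hz0 hκ P₃ y g'
  have hlwe : (#P₃ : ℝ) + z * Fintype.card ι = #P₃ * (1 + z * Fintype.card ι / #P₃) := by
    field_simp
  have hexp : (1 + z * Fintype.card ι / #P₃) * (1 + (z * Fintype.card ι / #P₃ + z / (p * #P₃) +
      z ^ 2 / (p ^ 3 * #P₃ ^ 2))) ≤ Real.exp (2 * (z * Fintype.card ι / #P₃) + z / (p * #P₃) +
        z ^ 2 / (p ^ 3 * #P₃ ^ 2)) := by
    have e : 2 * (z * Fintype.card ι / #P₃) + z / (p * #P₃) + z ^ 2 / (p ^ 3 * #P₃ ^ 2) =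
      z * Fintype.card ι / #P₃ + (z * Fintype.card ι / #P₃ + z / (p * #P₃) +
      z ^ 2 / (p ^ 3 * #P₃ ^ 2)) := by ring
    rw [e, Real.exp_add]
    refine mul_le_mul ?_ ?_ (by positivity) (Real.exp_pos _).le
    · rw [add_comm]; exact Real.add_one_le_exp _
    · rw [add_comm]; exact Real.add_one_le_exp _
  have hexp1 : 1 ≤ Real.exp (2 * (z * Fintype.card ι / #P₃) + z / (p * #P₃) +
        z ^ 2 / (p ^ 3 * #P₃ ^ 2)) := Real.one_le_exp (by positivity)
  simp only [shiftedWeight, hx, if_false, Function.update_self]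
  by_cases hA : ∃ y ∈ T.Lb, T.par y = x
  · obtain ⟨y, hy, rfl⟩ := hA
    have f1 : ({x' ∈ T.Lb | T.par x' = T.par y} : Finset ι) = {y} := by
      ext x'
      simp only [mem_filter, mem_singleton]
      exact ⟨fun h => T.only_child y hy _ h.2, fun h => by rw [h]; exact ⟨hy, rfl⟩⟩
    have f2 : ({x' ∈ T.Lb | T.par (T.par x') = T.par y} : Finset ι) = ∅ := by
      rw [Finset.filter_eq_empty_iff]
      exact fun x' _ => par_par_ne_par hy
    have hne := par_par_ne hy
    simp only [f1, f2, Finset.prod_singleton, Finset.prod_empty, mul_one,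
      Function.update_of_ne hne, lw, if_neg hne, Function.update_self]
    set u := g' (T.par (T.par y)) with hu
    have huP : u ∈ P₃ := hg' _ (T.par_notMem _)
    have hR := shift_ge_one (T := T) (g := g) hp0 hz0 #P₃ (μ y) u
    have hR0 : 0 < T.shift p z #P₃ g (μ y) u := by linarith
    refine le_trans ?_ (le_mul_of_one_le_right hn.le hexp1)
    simp only [← mul_div_assoc]
    rw [← Finset.sum_div, div_le_iff₀ hR0]
    have h3 : ∑ v ∈ P₃, T.hw p g z v u * (1 + p⁻¹ * ind (T.IsPar g (μ y) v)) =
        ∑ v ∈ P₃, T.hw p g z v u + p⁻¹ * ∑ v ∈ P₃, T.hw p g z v u * ind (T.IsPar g (μ y) v) := by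
      rw [Finset.mul_sum, ← Finset.sum_add_distrib]
      exact Finset.sum_congr rfl fun v _ => by ring
    have h4 := sum_hw_le (T := T) hg hp0 hz0 hκ P₃ u
    have h5 : ∑ v ∈ P₃, T.hw p g z v u * ind (T.IsPar g (μ y) v) ≤
        z * (1 + p⁻¹ * ind (T.IsPar₂ g (μ y) u)) := by
      refine sum_mul_ind_le (fun u v => isPar_unique hg) ?_ fun v hv hpv =>
        hw_par_le hg hp0 hz0 hDN hN (hP₃ huP) hpv
      have := ind_nonneg (T.IsPar₂ g (μ y) u)
      positivity
    rw [h3]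
    refine (add_le_add h4 (mul_le_mul_of_nonneg_left h5 (inv_pos.mpr hp0).le)).trans (le_of_eq ?_)
    unfold shift
    field_simp
    ring
  · have f1 : ({x' ∈ T.Lb | T.par x' = x} : Finset ι) = ∅ := by
      rw [Finset.filter_eq_empty_iff]
      exact fun x' hx' h => hA ⟨x', hx', h⟩
    simp only [f1, Finset.prod_empty, mul_one]
    by_cases hB : ∃ y ∈ T.Lb, T.par (T.par y) = x
    · obtain ⟨y, hy, rfl⟩ := hB
      have f2 : ({x' ∈ T.Lb | T.par (T.par x') = T.par (T.par y)} : Finset ι) = {y} := by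
        ext x'
        simp only [mem_filter, mem_singleton]
        refine ⟨fun h => T.only_child y hy _ (T.only_child₂ y hy _ h.2),
          fun h => by rw [h]; exact ⟨hy, rfl⟩⟩
      simp only [f2, Finset.prod_singleton]
      have h3 : ∀ v, T.lw p g z (T.par (T.par y)) (Function.update g' (T.par (T.par y)) v) *
          T.shift p z #P₃ g (μ y) v =
          (1 + z * Fintype.card ι / #P₃ + z / (p * #P₃)) *
            T.lw p g z (T.par (T.par y)) (Function.update g' (T.par (T.par y)) v) +
          z / (p ^ 2 * #P₃) * (T.lw p g z (T.par (T.par y))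
            (Function.update g' (T.par (T.par y)) v) * ind (T.IsPar₂ g (μ y) v)) := by
        intro v; unfold shift; ring
      have h5 : ∑ v ∈ P₃, T.lw p g z (T.par (T.par y)) (Function.update g' (T.par (T.par y)) v) *
          ind (T.IsPar₂ g (μ y) v) ≤ z * p⁻¹ :=
        sum_mul_ind_le (fun u v => isPar₂_unique hg) (by positivity) fun v _ _ =>
          lw_le hp0 hp1 hz _ _
      simp only [h3]
      rw [Finset.sum_add_distrib, ← Finset.mul_sum, ← Finset.mul_sum]
      refine (add_le_add (mul_le_mul_of_nonneg_left (hlw _) (by positivity))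
        (mul_le_mul_of_nonneg_left h5 (by positivity))).trans ?_
      refine le_trans ?_ (mul_le_mul_of_nonneg_left hexp hn.le)
      rw [hlwe]
      have e : z / (p ^ 2 * #P₃) * (z * p⁻¹) = #P₃ * (z ^ 2 / (p ^ 3 * #P₃ ^ 2)) := by
        field_simp
      rw [e]
      have := mul_nonneg (mul_nonneg hn.le h0) h2
      nlinarith
    · have f2 : ({x' ∈ T.Lb | T.par (T.par x') = x} : Finset ι) = ∅ := by
        rw [Finset.filter_eq_empty_iff]
        exact fun x' hx' h => hB ⟨x', hx', h⟩
      simp only [f2, Finset.prod_empty, mul_one]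
      refine (hlw x).trans ?_
      rw [hlwe]
      refine mul_le_mul_of_nonneg_left (le_trans ?_ hexp) hn.le
      have : 0 ≤ z * Fintype.card ι / #P₃ + z / (p * #P₃) + z ^ 2 / (p ^ 3 * #P₃ ^ 2) := by
        positivity
      nlinarith

/-- The pools from which a configuration with labels `μ` is chosen. -/
def pool (T : LabelledTree ι) (P₃ : Finset V) (μ : ι → V) (x : ι) : Finset V :=
  if x ∈ T.Lb then {μ x} else P₃

omit [DecidableEq V] in
lemma mem_pool {P₃ : Finset V} {μ g' : ι → V} :
    g' ∈ Fintype.piFinset (T.pool P₃ μ) ↔ (∀ x ∈ T.Lb, g' x = μ x) ∧ ∀ x ∉ T.Lb, g' x ∈ P₃ := by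
  simp only [Fintype.mem_piFinset, pool]
  refine ⟨fun h => ⟨fun x hx => by simpa [hx] using h x, fun x hx => by simpa [hx] using h x⟩,
    fun h x => ?_⟩
  by_cases hx : x ∈ T.Lb
  · simpa [hx] using h.1 x hx
  · simpa [hx] using h.2 x hx

lemma sum_compat_le (hg : Function.Injective g) (hp0 : 0 < p) (hp1 : p ≤ 1) (hz : 1 ≤ z)
    (hκ : 7 ≤ p * Fintype.card ι) {D N P₃ : Finset V} (hDN : Disjoint D N) (hP₃ : P₃ ⊆ D)
    (hn₃ : P₃.Nonempty) (hD : ∀ x ∉ T.Lb, g x ∈ D) (hN : ∀ x ∈ T.Lb, g x ∈ N) {μ : ι → V}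
    (hμ : ∀ x ∈ T.Lb, μ x ∈ N) :
    ∑ g' ∈ Fintype.piFinset (T.pool P₃ μ),
        ind (T.Compat g g') * (p⁻¹ ^ T.shared g g' * z ^ T.ell g g') ≤
      #P₃ ^ #T.Lbᶜ * Real.exp (Fintype.card ι * (2 * (z * Fintype.card ι / #P₃) + z / (p * #P₃) +
        z ^ 2 / (p ^ 3 * #P₃ ^ 2))) := by
  have hz0 : 0 ≤ z := by linarith
  set E := 2 * (z * Fintype.card ι / #P₃) + z / (p * #P₃) + z ^ 2 / (p ^ 3 * #P₃ ^ 2) with hE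
  have hE0 : 0 ≤ E := by positivity
  have h1 : ∀ g' ∈ Fintype.piFinset (T.pool P₃ μ),
      ind (T.Compat g g') * (p⁻¹ ^ T.shared g g' * z ^ T.ell g g') ≤
      ∏ x, T.shiftedWeight p z #P₃ g μ x g' := by
    intro g' hg'
    by_cases hc : T.Compat g g'
    · rw [ind_of hc, one_mul]
      have := prod_lw (p := p) z 1 hc
      rw [one_pow, mul_one] at this
      rw [← this]
      exact prod_lw_le_prod_shiftedWeight hg hp0 hz0 _ hDN hD fun x hx =>
        ⟨(mem_pool.mp hg').1 x hx, hμ x hx⟩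
    · rw [ind_of_not hc, zero_mul]
      exact Finset.prod_nonneg fun x _ => shiftedWeight_nonneg hp0 hz0 _ _ _ _
  refine (Finset.sum_le_sum h1).trans ?_
  refine (sum_prod_le_of_peel (T.pool P₃ μ) T.rk (T.shiftedWeight p z #P₃ g μ)
    (fun x => if x ∈ T.Lb then 1 else #P₃ * Real.exp E)
    (fun x g' => shiftedWeight_nonneg hp0 hz0 _ _ _ _)
    (fun x => by split_ifs <;> positivity)
    (fun x y hyx hrk g' v => shiftedWeight_update _ _ x y hyx hrk g' v) ?_).trans ?_
  · intro x g' hg'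
    by_cases hx : x ∈ T.Lb
    · have f1 : ({x' ∈ T.Lb | T.par x' = x} : Finset ι) = ∅ := by
        rw [Finset.filter_eq_empty_iff]
        rintro x' _ rfl
        exact T.par_notMem _ hx
      have f2 : ({x' ∈ T.Lb | T.par (T.par x') = x} : Finset ι) = ∅ := by
        rw [Finset.filter_eq_empty_iff]
        rintro x' _ rfl
        exact T.par_notMem _ hx
      simp [pool, hx, shiftedWeight, f1, f2]
    · simp only [pool, hx, if_false]
      exact sum_shiftedWeight_le hg hp0 hp1 hz hκ hDN hP₃ hn₃ hN μ hx g' (mem_pool.mp hg').2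
  · rw [Finset.prod_ite, prod_const_one, one_mul, prod_const, mul_pow, ← Real.exp_nat_mul]
    have : ({x | x ∉ T.Lb} : Finset ι) = T.Lbᶜ := by ext; simp
    rw [this]
    have h2 : ((#T.Lbᶜ : ℕ) : ℝ) ≤ Fintype.card ι := by exact_mod_cast card_le_univ _
    gcongr

lemma choose_add_sub_le (l m : ℕ) : (l + m).choose 2 - m.choose 2 ≤ l * (l + m) := by
  have h : ((l + m).choose 2 : ℕ) ≤ m.choose 2 + l * (l + m) := by
    induction l with
    | zero => simp
    | succ l ih =>
      rw [show l + 1 + m = (l + m) + 1 by ring, Nat.choose_succ_succ', Nat.choose_one_right]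
      nlinarith
  omega

/-- The contribution of the pairs with small overlap. -/
lemma sum_pairFactor_small_le (hg : Function.Injective g) (hp0 : 0 < p) (hp1 : p < 1)
    (hκ : 7 ≤ p * Fintype.card ι) {D N P₃ : Finset V} (hDN : Disjoint D N) (hP₃ : P₃ ⊆ D)
    (hn₃ : P₃.Nonempty) (hD : ∀ x ∉ T.Lb, g x ∈ D) (hN : ∀ x ∈ T.Lb, g x ∈ N) {μ : ι → V}
    (hμ : ∀ x ∈ T.Lb, μ x ∈ N) (d ν s₀ : ℕ) (hz : z = Real.exp 4 * (1 - p)⁻¹ ^ s₀) :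
    ∑ g' ∈ Fintype.piFinset (T.pool P₃ μ) with T.ell g g' + T.emm g g' ≤ s₀,
        T.pairFactor p d ν g g' ≤
      #P₃ ^ #T.Lbᶜ * (Real.exp (Fintype.card ι * (2 * (z * Fintype.card ι / #P₃) +
        z / (p * #P₃) + z ^ 2 / (p ^ 3 * #P₃ ^ 2))) *
      Real.exp (4 * d * ((1 - p) ^ Fintype.card ι) ^ 2 * (1 - p)⁻¹ ^ s₀ +
        4 * Fintype.card ι * (1 - p) ^ Fintype.card ι +
        4 * ν * ((1 - p) ^ #T.Lbᶜ) ^ 2 * (1 - p)⁻¹ ^ s₀)) := by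
  have hq0 : 0 < 1 - p := by linarith
  have hy : 1 ≤ (1 - p)⁻¹ := (one_le_inv₀ hq0).mpr (by linarith)
  have hz1 : 1 ≤ z := by
    rw [hz]
    exact one_le_mul_of_one_le_of_one_le (Real.one_le_exp (by norm_num)) (one_le_pow₀ hy)
  rw [← mul_assoc]
  refine le_trans ?_ (mul_le_mul_of_nonneg_right (sum_compat_le hg hp0 hp1.le hz1 hκ hDN hP₃ hn₃
    hD hN hμ) (Real.exp_pos _).le)
  rw [Finset.sum_mul]
  refine (Finset.sum_le_sum fun g' hg' => ?_).trans
    (Finset.sum_le_sum_of_subset_of_nonneg (filter_subset _ _) fun g' _ _ => ?_)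
  · have hs := (mem_filter.mp hg').2
    have e1 : (1 - p)⁻¹ ^ ((T.ell g g' + T.emm g g').choose 2 - (T.emm g g').choose 2) ≤
        ((1 - p)⁻¹ ^ s₀) ^ T.ell g g' := by
      rw [← pow_mul]
      refine pow_le_pow_right₀ hy ((choose_add_sub_le _ _).trans ?_)
      rw [mul_comm]
      exact Nat.mul_le_mul_right _ hs
    have e2 : z ^ T.ell g g' = ((1 - p)⁻¹ ^ s₀) ^ T.ell g g' * Real.exp (4 * T.ell g g') := by
      rw [hz, mul_pow, ← Real.exp_nat_mul]; ring_nf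
    have e3 : (1 - p)⁻¹ ^ T.ell g g' ≤ (1 - p)⁻¹ ^ s₀ := pow_le_pow_right₀ hy (by omega)
    have e4 : (1 - p)⁻¹ ^ (T.ell g g' + T.emm g g') ≤ (1 - p)⁻¹ ^ s₀ := pow_le_pow_right₀ hy hs
    have hi := ind_nonneg (T.Compat g g')
    rw [pairFactor, e2]
    calc _ ≤ ind (T.Compat g g') * (p⁻¹ ^ T.shared g g' * ((1 - p)⁻¹ ^ s₀) ^ T.ell g g' *
          Real.exp ((4 * d * ((1 - p) ^ Fintype.card ι) ^ 2 * (1 - p)⁻¹ ^ s₀ +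
            4 * Fintype.card ι * (1 - p) ^ Fintype.card ι +
            4 * ν * ((1 - p) ^ #T.Lbᶜ) ^ 2 * (1 - p)⁻¹ ^ s₀) + 4 * T.ell g g')) := by
          gcongr
      _ = _ := by rw [Real.exp_add]; ring
  · exact mul_nonneg (mul_nonneg (ind_nonneg _) (by positivity)) (Real.exp_pos _).le

end LabelledTree

end SmallOverlap

section LargeOverlap

open Finset

variable {ι V : Type*} [Fintype ι] [DecidableEq ι] [DecidableEq V] {T : LabelledTree ι}

namespace LabelledTree

variable {p : ℝ} {g g' : ι → V}

lemma ell_le : T.ell g g' ≤ #T.Lbᶜ := card_filter_le _ _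

lemma emm_le : T.emm g g' ≤ #T.Lb := card_filter_le _ _

lemma ell_add_emm_le : T.ell g g' + T.emm g g' ≤ Fintype.card ι := by
  have h1 := ell_le (T := T) (g := g) (g' := g')
  have h2 := emm_le (T := T) (g := g) (g' := g')
  have h3 := card_add_card_compl T.Lb
  omega

lemma pow_sq_mul_inv_pow_le {q : ℝ} (h0 : 0 < q) (h1 : q ≤ 1) {a b : ℕ} (h : b ≤ a) :
    (q ^ a) ^ 2 * q⁻¹ ^ b ≤ q ^ a := by
  rw [inv_pow, ← div_eq_mul_inv, div_le_iff₀ (by positivity), sq]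
  exact mul_le_mul_of_nonneg_left (pow_le_pow_of_le_one h0.le h1 h) (by positivity)

/-- The contribution of the pairs with large overlap, averaged over the pairs of labels. -/
lemma sum_pairFactor_large_le (hg : Function.Injective g) (hp0 : 0 < p) (hp1 : p < 1)
    (hκ : 7 ≤ p * Fintype.card ι) (P : ι → Finset V) {n₃ n₂ : ℕ} (hn₃ : 0 < n₃) (hn₂ : 0 < n₂)
    (hP₃ : ∀ x ∉ T.Lb, #(P x) = n₃) (hP₂ : ∀ x ∈ T.Lb, #(P x) = n₂) (d ν s₀ : ℕ) {M₀ : ℝ}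
    (hM₀ : 0 ≤ M₀)
    (hM : ∀ l m : ℕ, l ≤ #T.Lbᶜ → m ≤ #T.Lb → s₀ < l + m →
      (1 - p)⁻¹ ^ (l + m).choose 2 * ((Fintype.card ι / n₃ : ℝ) ^ l *
        (Fintype.card ι / n₂ : ℝ) ^ m) ≤ M₀) :
    ∑ g' ∈ Fintype.piFinset P with s₀ < T.ell g g' + T.emm g g',
        (1 - p)⁻¹ ^ (T.emm g g').choose 2 * T.pairFactor p d ν g g' ≤
      M₀ * Real.exp (4 * d * (1 - p) ^ Fintype.card ι +
        4 * Fintype.card ι * (1 - p) ^ Fintype.card ι + 4 * ν * (1 - p) ^ #T.Lbᶜ +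
        4 * Fintype.card ι) * (2 ^ Fintype.card ι * (n₃ ^ #T.Lbᶜ * n₂ ^ #T.Lb)) := by
  have hq0 : 0 < 1 - p := by linarith
  have hq1 : 1 - p ≤ 1 := by linarith
  have hκ0 : (0 : ℝ) < Fintype.card ι := by
    by_contra h
    have : p * Fintype.card ι ≤ 0 := mul_nonpos_of_nonneg_of_nonpos hp0.le (by linarith)
    linarith
  have hn₃' : (0 : ℝ) < n₃ := by exact_mod_cast hn₃
  have hn₂' : (0 : ℝ) < n₂ := by exact_mod_cast hn₂
  set E := Real.exp (4 * d * (1 - p) ^ Fintype.card ι +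
        4 * Fintype.card ι * (1 - p) ^ Fintype.card ι + 4 * ν * (1 - p) ^ #T.Lbᶜ +
        4 * Fintype.card ι) with hE
  set z : ℝ := n₃ / Fintype.card ι with hz
  set z' : ℝ := n₂ / Fintype.card ι with hz'
  have hz0 : 0 ≤ z := by positivity
  have hz0' : 0 ≤ z' := by positivity
  have h1 : ∀ g' ∈ Fintype.piFinset P, s₀ < T.ell g g' + T.emm g g' →
      (1 - p)⁻¹ ^ (T.emm g g').choose 2 * T.pairFactor p d ν g g' ≤
      M₀ * E * ∏ x, T.lw p g (if x ∈ T.Lb then z' else z) x g' := by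
    intro g' _ hs
    by_cases hc : T.Compat g g'
    swap
    · rw [pairFactor, ind_of_not hc, zero_mul, mul_zero]
      exact mul_nonneg (by positivity) (Finset.prod_nonneg fun x _ =>
        lw_nonneg hp0.le (by split_ifs; exacts [hz0', hz0]) _ _)
    rw [prod_lw z z' hc, pairFactor, ind_of hc, one_mul]
    have h2 := hM _ _ (ell_le (T := T) (g := g) (g' := g')) emm_le hs
    have h3 : (1 - p)⁻¹ ^ (T.ell g g' + T.emm g g').choose 2 ≤
        M₀ * (z ^ T.ell g g' * z' ^ T.emm g g') := by
      have e : (Fintype.card ι / n₃ : ℝ) ^ T.ell g g' * (Fintype.card ι / n₂ : ℝ) ^ T.emm g g' =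
          (z ^ T.ell g g' * z' ^ T.emm g g')⁻¹ := by
        rw [hz, hz', mul_inv, ← inv_pow, ← inv_pow, inv_div, inv_div]
      rw [e, ← div_eq_mul_inv, div_le_iff₀ (by positivity)] at h2
      exact h2
    have h4 : (T.emm g g').choose 2 + ((T.ell g g' + T.emm g g').choose 2 -
        (T.emm g g').choose 2) = (T.ell g g' + T.emm g g').choose 2 :=
      Nat.add_sub_cancel' (Nat.choose_le_choose 2 (by omega))
    have h5 : Real.exp (4 * d * ((1 - p) ^ Fintype.card ι) ^ 2 *
        (1 - p)⁻¹ ^ (T.ell g g' + T.emm g g') +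
        4 * Fintype.card ι * (1 - p) ^ Fintype.card ι +
        4 * ν * ((1 - p) ^ #T.Lbᶜ) ^ 2 * (1 - p)⁻¹ ^ T.ell g g' + 4 * T.ell g g') ≤ E := by
      have e1 := pow_sq_mul_inv_pow_le hq0 hq1 (ell_add_emm_le (T := T) (g := g) (g' := g'))
      have e2 := pow_sq_mul_inv_pow_le hq0 hq1 (ell_le (T := T) (g := g) (g' := g'))
      have e3 : ((T.ell g g' : ℕ) : ℝ) ≤ Fintype.card ι := by
        exact_mod_cast (Nat.le_add_right _ _).trans
          (ell_add_emm_le (T := T) (g := g) (g' := g'))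
      rw [hE, mul_assoc (4 * (d : ℝ)), mul_assoc (4 * (ν : ℝ))]
      gcongr
    calc _ = p⁻¹ ^ T.shared g g' * (1 - p)⁻¹ ^ (T.ell g g' + T.emm g g').choose 2 *
          Real.exp (4 * d * ((1 - p) ^ Fintype.card ι) ^ 2 *
            (1 - p)⁻¹ ^ (T.ell g g' + T.emm g g') +
            4 * Fintype.card ι * (1 - p) ^ Fintype.card ι +
            4 * ν * ((1 - p) ^ #T.Lbᶜ) ^ 2 * (1 - p)⁻¹ ^ T.ell g g' + 4 * T.ell g g') := by
          have h6 : (1 - p)⁻¹ ^ (T.ell g g' + T.emm g g').choose 2 =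
              (1 - p)⁻¹ ^ (T.emm g g').choose 2 * (1 - p)⁻¹ ^
                ((T.ell g g' + T.emm g g').choose 2 - (T.emm g g').choose 2) := by
            rw [← pow_add, h4]
          rw [h6]; ring
      _ ≤ p⁻¹ ^ T.shared g g' * (M₀ * (z ^ T.ell g g' * z' ^ T.emm g g')) * E := by gcongr
      _ = _ := by ring
  have h2 : ∑ g' ∈ Fintype.piFinset P, ∏ x, T.lw p g (if x ∈ T.Lb then z' else z) x g' ≤
      2 ^ Fintype.card ι * (n₃ ^ #T.Lbᶜ * n₂ ^ #T.Lb) := by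
    refine (sum_prod_le_of_peel P T.rk (fun x => T.lw p g (if x ∈ T.Lb then z' else z) x)
      (fun x => 2 * if x ∈ T.Lb then (n₂ : ℝ) else n₃)
      (fun x g' => lw_nonneg hp0.le (by split_ifs; exacts [hz0', hz0]) _ _)
      (fun x => by split_ifs <;> positivity)
      (fun x y hyx hrk g' v => lw_update x y hyx hrk g' v) ?_).trans ?_
    · intro x g' _
      refine (sum_lw_update_le hg hp0 (by split_ifs; exacts [hz0', hz0]) hκ _ _ _).trans ?_
      by_cases hx : x ∈ T.Lb
      · simp only [hx, if_true, hP₂ x hx]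
        rw [hz', div_mul_cancel₀ _ hκ0.ne']; linarith
      · simp only [hx, if_false, hP₃ x hx]
        rw [hz, div_mul_cancel₀ _ hκ0.ne']; linarith
    · rw [Finset.prod_mul_distrib, prod_const, card_univ, Finset.prod_ite, prod_const, prod_const]
      have : ({x | x ∉ T.Lb} : Finset ι) = T.Lbᶜ := by ext; simp
      rw [this, Finset.filter_univ_mem, mul_comm ((n₂ : ℝ) ^ _)]
  refine le_trans ?_ (mul_le_mul_of_nonneg_left h2 (by positivity))
  rw [Finset.mul_sum]
  refine (Finset.sum_le_sum fun g' hg' => h1 g' (mem_filter.mp hg').1 (mem_filter.mp hg').2).trans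
    (Finset.sum_le_sum_of_subset_of_nonneg (filter_subset _ _) fun g' _ _ => ?_)
  exact mul_nonneg (by positivity) (Finset.prod_nonneg fun x _ =>
        lw_nonneg hp0.le (by split_ifs; exacts [hz0', hz0]) _ _)

/-- The injective configurations in a family of pools. -/
def configs (P : ι → Finset V) : Finset (ι → V) :=
  {g ∈ Fintype.piFinset P | Function.Injective g}

/-- The sum of the pair factors over the pairs with large overlap, both with independent labels. -/
def largeSum (T : LabelledTree ι) (p : ℝ) (d ν s₀ : ℕ) (P : ι → Finset V)
    (ω : Sym2 V → Bool) : ℝ :=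
  ∑ g ∈ configs P, ∑ g' ∈ configs P with s₀ < T.ell g g' + T.emm g g',
    ind (Indep (T.labs g) ω ∧ Indep (T.labs g') ω) * T.pairFactor p d ν g g'

lemma largeSum_nonneg (hp0 : 0 < p) (hp1 : p < 1) (d ν s₀ : ℕ) (P : ι → Finset V)
    (ω : Sym2 V → Bool) : 0 ≤ T.largeSum p d ν s₀ P ω :=
  Finset.sum_nonneg fun _ _ => Finset.sum_nonneg fun _ _ =>
    mul_nonneg (ind_nonneg _) (pairFactor_nonneg hp0 hp1 _ _ _ _)

lemma ex_largeSum_le [Fintype V] (hp0 : 0 < p) (hp1 : p < 1)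
    (hκ : 7 ≤ p * Fintype.card ι) (P : ι → Finset V) {n₃ n₂ : ℕ} (hn₃ : 0 < n₃) (hn₂ : 0 < n₂)
    (hP₃ : ∀ x ∉ T.Lb, #(P x) = n₃) (hP₂ : ∀ x ∈ T.Lb, #(P x) = n₂) (d ν s₀ : ℕ) {M₀ : ℝ}
    {D N : Finset V} (hDN : Disjoint D N) (hD : ∀ x ∉ T.Lb, P x ⊆ D) (hN : ∀ x ∈ T.Lb, P x ⊆ N)
    (hM₀ : 0 ≤ M₀)
    (hM : ∀ l m : ℕ, l ≤ #T.Lbᶜ → m ≤ #T.Lb → s₀ < l + m →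
      (1 - p)⁻¹ ^ (l + m).choose 2 * ((Fintype.card ι / n₃ : ℝ) ^ l *
        (Fintype.card ι / n₂ : ℝ) ^ m) ≤ M₀) :
    ex p (T.largeSum p d ν s₀ P) ≤
      ((1 - p) ^ (#T.Lb).choose 2) ^ 2 * (M₀ * Real.exp (4 * d * (1 - p) ^ Fintype.card ι +
        4 * Fintype.card ι * (1 - p) ^ Fintype.card ι + 4 * ν * (1 - p) ^ #T.Lbᶜ +
        4 * Fintype.card ι) * 2 ^ Fintype.card ι) * (n₃ ^ #T.Lbᶜ * n₂ ^ #T.Lb) ^ 2 := by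
  have hq0 : 0 < 1 - p := by linarith
  set E := Real.exp (4 * d * (1 - p) ^ Fintype.card ι +
        4 * Fintype.card ι * (1 - p) ^ Fintype.card ι + 4 * ν * (1 - p) ^ #T.Lbᶜ +
        4 * Fintype.card ι) with hE
  have hcard : (#(Fintype.piFinset P) : ℝ) = n₃ ^ #T.Lbᶜ * n₂ ^ #T.Lb := by
    have e : ∀ x, #(P x) = if x ∈ T.Lb then n₂ else n₃ := by
      intro x; split_ifs with h
      exacts [hP₂ x h, hP₃ x h]
    have : ({x | x ∉ T.Lb} : Finset ι) = T.Lbᶜ := by ext; simp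
    rw [Fintype.card_piFinset, Finset.prod_congr rfl fun x _ => e x, Finset.prod_ite, prod_const,
      prod_const, this, Finset.filter_univ_mem]
    push_cast; ring
  have hconf : ∀ g ∈ configs P, T.Conf D N g := by
    intro g hg
    obtain ⟨h1, h2⟩ := mem_filter.mp hg
    rw [Fintype.mem_piFinset] at h1
    exact ⟨h2, fun x hx => hN x hx (h1 x), fun x hx => hD x hx (h1 x)⟩
  have h1 : ∀ g ∈ configs P, ex p (fun ω => ∑ g' ∈ configs P with s₀ < T.ell g g' + T.emm g g',
      ind (Indep (T.labs g) ω ∧ Indep (T.labs g') ω) * T.pairFactor p d ν g g') ≤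
      ((1 - p) ^ (#T.Lb).choose 2) ^ 2 *
        (M₀ * E * (2 ^ Fintype.card ι * (n₃ ^ #T.Lbᶜ * n₂ ^ #T.Lb))) := by
    intro g hg
    have hgc := hconf g hg
    rw [ex_sum]
    refine le_trans ?_ (mul_le_mul_of_nonneg_left (sum_pairFactor_large_le (T := T) hgc.inj hp0 hp1
      hκ P hn₃ hn₂ hP₃ hP₂ d ν s₀ hM₀ hM) (by positivity))
    rw [Finset.mul_sum]
    refine (Finset.sum_le_sum fun g' hg' => ?_).trans (Finset.sum_le_sum_of_subset_of_nonneg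
      (filter_subset_filter _ (filter_subset _ _)) fun g' _ _ => ?_)
    · have hgc' := hconf g' (mem_filter.mp hg').1
      rw [ex_mul_const]
      have h2 := pr_indep_and p (T.labs g) (T.labs g')
      rw [card_labs hgc.inj, card_labs hgc'.inj, card_labs_inter hDN hgc hgc'] at h2
      have h3 : pr p (fun ω => Indep (T.labs g) ω ∧ Indep (T.labs g') ω) =
          ((1 - p) ^ (#T.Lb).choose 2) ^ 2 * (1 - p)⁻¹ ^ (T.emm g g').choose 2 := by
        rw [inv_pow, ← div_eq_mul_inv, eq_div_iff (by positivity), h2, sq]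
      rw [← mul_assoc, ← h3]
      rfl
    · have := pairFactor_nonneg (T := T) hp0 hp1 d ν g g'
      positivity
  unfold largeSum
  rw [ex_sum]
  refine (Finset.sum_le_sum h1).trans ?_
  rw [sum_const, nsmul_eq_mul]
  have h2 : (#(configs P) : ℝ) ≤ n₃ ^ #T.Lbᶜ * n₂ ^ #T.Lb := by
    rw [← hcard]
    exact_mod_cast card_filter_le _ _
  refine (mul_le_mul_of_nonneg_right h2 (by positivity)).trans (le_of_eq ?_)
  ring

end LabelledTree

end LargeOverlap

section SecondMoment

open Finset

variable {ι V : Type*} [Fintype ι] [DecidableEq ι] [DecidableEq V] {T : LabelledTree ι}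

namespace LabelledTree

variable {p : ℝ}

lemma card_configs_pool_ge {P₃ : Finset V} (hn₃ : P₃.Nonempty)
    {μ : ι → V} (hμi : ∀ x ∈ T.Lb, ∀ y ∈ T.Lb, μ x = μ y → x = y) :
    (#P₃ : ℝ) ^ #T.Lbᶜ * (1 - Fintype.card ι ^ 2 / #P₃) ≤ #(configs (T.pool P₃ μ)) := by
  have hn : (0 : ℝ) < #P₃ := by exact_mod_cast card_pos.mpr hn₃
  have hcard : (#(Fintype.piFinset (T.pool P₃ μ)) : ℝ) = #P₃ ^ #T.Lbᶜ := by
    have e : ∀ x, #(T.pool P₃ μ x) = if x ∈ T.Lb then 1 else #P₃ := by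
      intro x; unfold pool; split_ifs <;> simp
    have : ({x | x ∉ T.Lb} : Finset ι) = T.Lbᶜ := by ext; simp
    rw [Fintype.card_piFinset, Finset.prod_congr rfl fun x _ => e x, Finset.prod_ite, prod_const,
      prod_const, this]
    simp
  have h1 : ∀ x y : ι, x ≠ y → x ∉ T.Lb →
      ∑ g ∈ Fintype.piFinset (T.pool P₃ μ), ind (g x = g y) ≤ #P₃ ^ #T.Lbᶜ / #P₃ := by
    intro x y hxy hx
    have h2 := sum_piFinset_update (T.pool P₃ μ) x fun g => ind (g x = g y)
    simp only [Function.update_self, Function.update_of_ne hxy.symm] at h2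
    have h3 : ∀ g ∈ Fintype.piFinset (T.pool P₃ μ),
        ∑ v ∈ T.pool P₃ μ x, ind (v = g y) ≤ 1 := by
      intro g _
      have := sum_mul_ind_le (P := T.pool P₃ μ x) (Q := fun v => v = g y)
        (fun u v hu hv => hu.trans hv.symm) zero_le_one (F := fun _ => 1) fun _ _ _ => le_rfl
      simpa using this
    have h4 := Finset.sum_le_sum h3
    rw [h2, sum_const, nsmul_eq_mul, mul_one, hcard] at h4
    rw [le_div_iff₀ hn, mul_comm]
    simpa [pool, hx] using h4
  have h2 : ∀ g ∈ Fintype.piFinset (T.pool P₃ μ), 1 - ind (Function.Injective g) ≤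
      ∑ q : ι × ι with q.1 ≠ q.2 ∧ q.1 ∉ T.Lb, ind (g q.1 = g q.2) := by
    intro g hg
    have hnn : 0 ≤ ∑ q : ι × ι with q.1 ≠ q.2 ∧ q.1 ∉ T.Lb, ind (g q.1 = g q.2) :=
      Finset.sum_nonneg fun _ _ => ind_nonneg _
    by_cases hi : Function.Injective g
    · rw [ind_of hi]; simpa using hnn
    · rw [ind_of_not hi, sub_zero]
      obtain ⟨x, y, hxy, hne⟩ := Function.not_injective_iff.mp hi
      rw [mem_pool] at hg
      have : ∃ q : ι × ι, q.1 ≠ q.2 ∧ q.1 ∉ T.Lb ∧ g q.1 = g q.2 := by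
        by_cases hx : x ∈ T.Lb
        · by_cases hy : y ∈ T.Lb
          · rw [hg.1 x hx, hg.1 y hy] at hxy
            exact absurd (hμi x hx y hy hxy) hne
          · exact ⟨(y, x), hne.symm, hy, hxy.symm⟩
        · exact ⟨(x, y), hne, hx, hxy⟩
      obtain ⟨q, hq1, hq2, hq3⟩ := this
      refine le_trans ?_ (Finset.single_le_sum (f := fun q : ι × ι => ind (g q.1 = g q.2))
        (fun q _ => ind_nonneg _) (mem_filter.mpr ⟨mem_univ q, hq1, hq2⟩))
      rw [ind_of hq3]
  have h3 := Finset.sum_le_sum h2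
  rw [Finset.sum_sub_distrib, sum_const, nsmul_eq_mul, mul_one, hcard, sum_ind_eq_card,
    Finset.sum_comm] at h3
  have h4 : ∑ q : ι × ι with q.1 ≠ q.2 ∧ q.1 ∉ T.Lb,
      ∑ g ∈ Fintype.piFinset (T.pool P₃ μ), ind (g q.1 = g q.2) ≤
      Fintype.card ι ^ 2 * ((#P₃ : ℝ) ^ #T.Lbᶜ / #P₃) := by
    refine (Finset.sum_le_sum fun q hq => h1 q.1 q.2 (mem_filter.mp hq).2.1
      (mem_filter.mp hq).2.2).trans ?_
    rw [sum_const, nsmul_eq_mul]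
    refine mul_le_mul_of_nonneg_right ?_ (by positivity)
    have : #{q : ι × ι | q.1 ≠ q.2 ∧ q.1 ∉ T.Lb} ≤ Fintype.card ι ^ 2 := by
      refine (card_le_univ _).trans (le_of_eq ?_)
      rw [Fintype.card_prod, sq]
    exact_mod_cast this
  have h5 : (#P₃ : ℝ) ^ #T.Lbᶜ * (1 - Fintype.card ι ^ 2 / #P₃) =
      #P₃ ^ #T.Lbᶜ - Fintype.card ι ^ 2 * ((#P₃ : ℝ) ^ #T.Lbᶜ / #P₃) := by ring
  rw [h5]
  unfold configs
  linarith

variable [Fintype V] {Λ : Type*}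

/-- The second moment bound: given a family `𝓘` of label maps, with high probability some
configuration using one of them is an induced dominating copy. -/
lemma pr_exists_event_ge (hp0 : 0 < p) (hp1 : p < 1)
    {D N P₃ : Finset V} (hDN : Disjoint D N) (hP₃ : P₃ ⊆ D) (hn₃ : P₃.Nonempty)
    (hq₁ : (1 - p) ^ Fintype.card ι ≤ 1 / 2) (hq₂ : (1 - p) ^ #T.Lbᶜ ≤ 1 / 2)
    (P : ι → Finset V) (hPP₃ : ∀ x ∉ T.Lb, P x = P₃) (hPN : ∀ x ∈ T.Lb, P x ⊆ N)
    (𝓘 : Finset Λ) (h𝓘 : 𝓘.Nonempty) (lam : Λ → ι → V)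
    (hlam : ∀ L ∈ 𝓘, ∀ x ∈ T.Lb, lam L x ∈ P x)
    (hlami : ∀ L ∈ 𝓘, ∀ x ∈ T.Lb, ∀ y ∈ T.Lb, lam L x = lam L y → x = y)
    (hlamL : ∀ L ∈ 𝓘, ∀ L' ∈ 𝓘, (∀ x ∈ T.Lb, lam L x = lam L' x) → L = L')
    (ω₀ : Sym2 V → Bool) (hω₀ : ∀ L ∈ 𝓘, Indep (T.Lb.image (lam L)) ω₀)
    (s₀ : ℕ) {B ε : ℝ} (hB : 0 < B) (hε : 0 ≤ ε) (hθ : (Fintype.card ι : ℝ) ^ 2 ≤ #P₃)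
    (hsmall : ∀ g, T.Conf D N g → ∀ μ : ι → V, (∀ x ∈ T.Lb, μ x ∈ N) →
      ∑ g' ∈ Fintype.piFinset (T.pool P₃ μ) with T.ell g g' + T.emm g g' ≤ s₀,
        T.pairFactor p #D #N g g' ≤ #P₃ ^ #T.Lbᶜ * B)
    (hlarge : T.largeSum p #D #N s₀ P ω₀ ≤ ε * (#𝓘 * (#P₃ : ℝ) ^ #T.Lbᶜ) ^ 2) :
    (1 - Fintype.card ι ^ 2 / #P₃) ^ 2 / (B + ε) ≤
      pr p (fun ω => ∃ L ∈ 𝓘, ∃ g, T.Conf D N g ∧ (∀ x ∈ T.Lb, g x = lam L x) ∧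
        (∀ x ∉ T.Lb, g x ∈ P₃) ∧ T.Event D N g ω) := by
  classical
  have hn : (0 : ℝ) < #P₃ := by exact_mod_cast card_pos.mpr hn₃
  have hI : (0 : ℝ) < #𝓘 := by exact_mod_cast card_pos.mpr h𝓘
  have hq0 : 0 < 1 - p := by linarith
  set θ : ℝ := Fintype.card ι ^ 2 / #P₃ with hθd
  have hθ1 : θ ≤ 1 := by rw [hθd, div_le_one hn]; exact hθ
  set A : ℝ := #𝓘 * (#P₃ : ℝ) ^ #T.Lbᶜ with hA
  have hA0 : 0 < A := by positivity
  set W : Finset (ι → V) := 𝓘.biUnion fun L => configs (T.pool P₃ (lam L)) with hW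
  have hmemW : ∀ g ∈ W, ∃ L ∈ 𝓘, (∀ x ∈ T.Lb, g x = lam L x) ∧ (∀ x ∉ T.Lb, g x ∈ P₃) ∧
      T.Conf D N g := by
    intro g hg
    obtain ⟨L, hL, hgL⟩ := mem_biUnion.mp hg
    obtain ⟨h1, h2⟩ := mem_filter.mp hgL
    rw [mem_pool] at h1
    exact ⟨L, hL, h1.1, h1.2, h2, fun x hx => by rw [h1.1 x hx]; exact hPN x hx (hlam L hL x hx),
      fun x hx => hP₃ (h1.2 x hx)⟩
  have hdisj : (𝓘 : Set Λ).PairwiseDisjoint fun L => configs (T.pool P₃ (lam L)) := by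
    intro L hL L' hL' hne
    refine disjoint_left.mpr fun g hg hg' => hne (hlamL L hL L' hL' fun x hx => ?_)
    have h1 := (mem_pool.mp (mem_filter.mp hg).1).1 x hx
    have h2 := (mem_pool.mp (mem_filter.mp hg').1).1 x hx
    rw [← h1, h2]
  have hWcard : (#W : ℝ) = ∑ L ∈ 𝓘, (#(configs (T.pool P₃ (lam L))) : ℝ) := by
    rw [hW, card_biUnion hdisj]; push_cast; rfl
  have hWge : A * (1 - θ) ≤ #W := by
    rw [hWcard, hA, mul_assoc, ← nsmul_eq_mul, ← sum_const]
    refine Finset.sum_le_sum fun L hL => card_configs_pool_ge hn₃ (hlami L hL)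
  have hWconf : ∀ g ∈ W, g ∈ configs P ∧ Indep (T.labs g) ω₀ := by
    intro g hg
    obtain ⟨L, hL, h1, h2, h3⟩ := hmemW g hg
    refine ⟨mem_filter.mpr ⟨?_, h3.inj⟩, ?_⟩
    · rw [Fintype.mem_piFinset]
      intro x
      by_cases hx : x ∈ T.Lb
      · rw [h1 x hx]; exact hlam L hL x hx
      · rw [hPP₃ x hx]; exact h2 x hx
    · have : T.labs g = T.Lb.image (lam L) := Finset.image_congr fun x hx => h1 x hx
      rw [this]; exact hω₀ L hL
  have hpf := pairFactor_nonneg (T := T) (V := V) hp0 hp1 #D #N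
  have hsm : ∀ g ∈ W, ∑ g' ∈ W with T.ell g g' + T.emm g g' ≤ s₀, T.pairFactor p #D #N g g' ≤
      A * B := by
    intro g hg
    obtain ⟨L, hL, h1, h2, h3⟩ := hmemW g hg
    rw [hW, Finset.filter_biUnion, Finset.sum_biUnion fun L hL L' hL' hne =>
      disjoint_filter_filter (hdisj hL hL' hne), hA, mul_assoc, ← nsmul_eq_mul, ← sum_const]
    refine Finset.sum_le_sum fun L' hL' => ?_
    refine le_trans (Finset.sum_le_sum_of_subset_of_nonneg
      (filter_subset_filter _ (filter_subset _ _)) fun g' _ _ => hpf g g')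
      (hsmall g h3 (lam L') fun x hx => hPN x hx (hlam L' hL' x hx))
  have hlg : ∑ g ∈ W, ∑ g' ∈ W with ¬ T.ell g g' + T.emm g g' ≤ s₀, T.pairFactor p #D #N g g' ≤
      ε * A ^ 2 := by
    refine le_trans ?_ hlarge
    unfold largeSum
    refine (Finset.sum_le_sum fun g hg => ?_).trans (Finset.sum_le_sum_of_subset_of_nonneg
      (fun g hg => (hWconf g hg).1) fun g _ _ => Finset.sum_nonneg fun g' _ =>
        mul_nonneg (ind_nonneg _) (hpf g g'))
    refine (Finset.sum_le_sum fun g' hg' => ?_).trans (Finset.sum_le_sum_of_subset_of_nonneg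
      (fun g' hg' => ?_) fun g' _ _ => mul_nonneg (ind_nonneg _) (hpf g g'))
    · rw [ind_of ⟨(hWconf g hg).2, (hWconf g' (mem_filter.mp hg').1).2⟩, one_mul]
    · rw [mem_filter] at hg' ⊢
      exact ⟨(hWconf g' hg'.1).1, not_le.mp hg'.2⟩
  set P0 := T.prEvent p #D #N with hP0
  have hP0pos : 0 < P0 := by
    have h1 : 0 < 1 - (1 - p) ^ Fintype.card ι := by linarith
    have h2 : 0 < 1 - (1 - p) ^ #T.Lbᶜ := by linarith
    rw [hP0, prEvent]; positivity
  set X : (Sym2 V → Bool) → ℝ := fun ω => ∑ g ∈ W, ind (T.Event D N g ω) with hX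
  have hEX : ex p X = #W * P0 := by
    rw [hX, ex_sum, ← nsmul_eq_mul, ← sum_const]
    refine Finset.sum_congr rfl fun g hg => ?_
    obtain ⟨L, hL, h1, h2, h3⟩ := hmemW g hg
    exact pr_event p hDN h3
  have hEX2 : ex p (fun ω => X ω ^ 2) ≤ P0 ^ 2 * (#W * (A * B) + ε * A ^ 2) := by
    have h1 : ∀ ω, X ω ^ 2 = ∑ g ∈ W, ∑ g' ∈ W, ind (T.Event D N g ω ∧ T.Event D N g' ω) := by
      intro ω
      simp only [hX]
      rw [sq, Finset.sum_mul_sum]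
      exact Finset.sum_congr rfl fun g _ => Finset.sum_congr rfl fun g' _ => (ind_and _ _).symm
    rw [funext h1, ex_sum]
    have h2 : ∀ g ∈ W, ex p (fun ω => ∑ g' ∈ W, ind (T.Event D N g ω ∧ T.Event D N g' ω)) ≤
        P0 ^ 2 * (A * B + ∑ g' ∈ W with ¬ T.ell g g' + T.emm g g' ≤ s₀,
          T.pairFactor p #D #N g g') := by
      intro g hg
      obtain ⟨_, _, _, _, hgc⟩ := hmemW g hg
      rw [ex_sum]
      refine (Finset.sum_le_sum (g := fun g' => P0 ^ 2 * T.pairFactor p #D #N g g')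
        fun g' hg' => ?_).trans ?_
      · obtain ⟨_, _, _, _, hgc'⟩ := hmemW g' hg'
        exact pr_event_and_le hp0 hp1 hDN hgc hgc' hq₁ hq₂
      · rw [← Finset.mul_sum, ← Finset.sum_filter_add_sum_filter_not W
          fun g' => T.ell g g' + T.emm g g' ≤ s₀]
        refine mul_le_mul_of_nonneg_left (add_le_add (hsm g hg) le_rfl) (by positivity)
    refine (Finset.sum_le_sum h2).trans ?_
    rw [← Finset.mul_sum, Finset.sum_add_distrib, sum_const, nsmul_eq_mul]
    exact mul_le_mul_of_nonneg_left (add_le_add le_rfl hlg) (by positivity)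
  have hWle : (#W : ℝ) ≤ A := by
    rw [hWcard, hA, ← nsmul_eq_mul, ← sum_const]
    refine Finset.sum_le_sum fun L _ => ?_
    have h1 : (#(configs (T.pool P₃ (lam L))) : ℝ) ≤ #(Fintype.piFinset (T.pool P₃ (lam L))) := by
      exact_mod_cast card_filter_le _ _
    refine h1.trans (le_of_eq ?_)
    have e : ∀ x, #(T.pool P₃ (lam L) x) = if x ∈ T.Lb then 1 else #P₃ := by
      intro x; unfold pool; split_ifs <;> simp
    have : ({x | x ∉ T.Lb} : Finset ι) = T.Lbᶜ := by ext; simp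
    rw [Fintype.card_piFinset, Finset.prod_congr rfl fun x _ => e x, Finset.prod_ite, prod_const,
      prod_const, this]
    simp
  have hCS := sq_ex_le_pr_ne_zero hp0.le hp1.le X
  have hpr0 : 0 ≤ pr p (fun ω => X ω ≠ 0) := pr_nonneg hp0.le hp1.le _
  refine le_trans ?_ (pr_mono hp0.le hp1.le (Q := fun ω => X ω ≠ 0) fun ω hω => ?_)
  · rw [div_le_iff₀ (by positivity)]
    have h1 : (A * (1 - θ) * P0) ^ 2 ≤ (#W * P0) ^ 2 :=
      pow_le_pow_left₀ (mul_nonneg (mul_nonneg hA0.le (by linarith)) hP0pos.le)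
        (mul_le_mul_of_nonneg_right hWge hP0pos.le) 2
    have h2 : P0 ^ 2 * (#W * (A * B) + ε * A ^ 2) ≤ P0 ^ 2 * (A ^ 2 * (B + ε)) := by
      refine mul_le_mul_of_nonneg_left ?_ (by positivity)
      have := mul_le_mul_of_nonneg_right hWle (show 0 ≤ A * B by positivity)
      nlinarith
    rw [hEX] at hCS
    have h3 := h1.trans (hCS.trans (mul_le_mul_of_nonneg_left (hEX2.trans h2) hpr0))
    have h4 : (A * P0) ^ 2 * (1 - θ) ^ 2 ≤
        (A * P0) ^ 2 * (pr p (fun ω => X ω ≠ 0) * (B + ε)) := by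
      calc _ = (A * (1 - θ) * P0) ^ 2 := by ring
        _ ≤ _ := h3
        _ = _ := by ring
    exact le_of_mul_le_mul_left h4 (by positivity)
  · obtain ⟨g, hg, hne⟩ := Finset.exists_ne_zero_of_sum_ne_zero hω
    obtain ⟨L, hL, h1, h2, h3⟩ := hmemW g hg
    refine ⟨L, hL, g, h3, h1, h2, ?_⟩
    by_contra hE
    exact hne (ind_of_not hE)

end LabelledTree

end SecondMoment

section Shape

open Finset

lemma ωr_four_succ (a : ℕ) : ωr 4 (a + 1) = 4 * ωr 4 a + 1 := by
  have h : ∀ k : ℕ, 3 * ωr 4 k + 1 = 4 ^ k := by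
    intro k
    have h1 : 3 ∣ 4 ^ k - 1 := by
      have := Nat.sub_dvd_pow_sub_pow 4 1 k
      simpa using this
    have h2 : 0 < 4 ^ k := by positivity
    unfold ωr
    omega
  have h1 := h a
  have h2 := h (a + 1)
  rw [pow_succ] at h2
  omega

lemma heapDepth_lt {a i : ℕ} (hi : i < ωr 4 a) : heapDepth 4 i < a := by
  induction a generalizing i with
  | zero => simp [ωr] at hi
  | succ a ih =>
    rw [ωr_four_succ] at hi
    cases i with
    | zero => rw [heapDepth]; omega
    | succ j =>
      rw [heapDepth]
      have := ih (i := j / 4) (by omega)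
      omega

/-- The parent map of the tree formed by the heap-ordered 4-ary tree with a path of length `γ`
hanging from each of its nodes. -/
def wPar (γ w : ℕ) (x : Fin w × Fin (γ + 1)) : Fin w × Fin (γ + 1) :=
  if (x.2 : ℕ) = 0 then (⟨((x.1 : ℕ) - 1) / 4, by have := x.1.2; omega⟩, x.2)
  else (x.1, ⟨(x.2 : ℕ) - 1, by have := x.2.2; omega⟩)

lemma wPar_eq_iff {γ w : ℕ} {x y : Fin w × Fin (γ + 1)} :
    wPar γ w x = y ↔ ((x.2 : ℕ) = 0 ∧ (y.2 : ℕ) = 0 ∧ (y.1 : ℕ) = ((x.1 : ℕ) - 1) / 4) ∨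
      ((x.1 : ℕ) = y.1 ∧ (x.2 : ℕ) = (y.2 : ℕ) + 1) := by
  unfold wPar
  split_ifs with h <;> simp only [Prod.ext_iff, Fin.ext_iff] <;> omega

/-- The tree part of `W_a^γ`, with the ends of the pendant paths as labels. -/
def wTree (γ w : ℕ) (hγ : 3 ≤ γ) : LabelledTree (Fin w × Fin (γ + 1)) where
  par := wPar γ w
  rk x := (x.1 : ℕ) * (γ + 1) + x.2
  rk_lt x hx := by
    obtain ⟨y, hy⟩ : ∃ y, y = wPar γ w x := ⟨_, rfl⟩
    rw [← hy] at hx ⊢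
    rcases wPar_eq_iff.mp hy.symm with ⟨h1, h2, h3⟩ | ⟨h1, h2⟩
    · have : (y.1 : ℕ) < x.1 := by
        by_contra hcon
        exact hx (Prod.ext (Fin.ext (by omega)) (Fin.ext (by omega)))
      have := Nat.mul_lt_mul_of_pos_right this (Nat.succ_pos γ)
      simp only [Nat.succ_eq_add_one] at this
      omega
    · rw [h1]; omega
  Lb := {x | (x.2 : ℕ) = γ}
  par_notMem x := by
    obtain ⟨y, hy⟩ : ∃ y, y = wPar γ w x := ⟨_, rfl⟩
    rw [← hy]
    have := x.2.2
    rcases wPar_eq_iff.mp hy.symm with ⟨h1, h2, h3⟩ | ⟨h1, h2⟩ <;> simp <;> omega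
  only_child x hx y hy := by
    have hx : (x.2 : ℕ) = γ := by simpa using hx
    obtain ⟨z, hz⟩ : ∃ z, z = wPar γ w x := ⟨_, rfl⟩
    rw [← hz] at hy
    have h1 := wPar_eq_iff.mp hz.symm
    have h2 := wPar_eq_iff.mp hy
    refine Prod.ext (Fin.ext ?_) (Fin.ext ?_) <;> omega
  only_child₂ x hx y hy := by
    have hx : (x.2 : ℕ) = γ := by simpa using hx
    obtain ⟨z, hz⟩ : ∃ z, z = wPar γ w x := ⟨_, rfl⟩
    rw [← hz] at hy ⊢
    obtain ⟨z', hz'⟩ : ∃ z', z' = wPar γ w z := ⟨_, rfl⟩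
    rw [← hz'] at hy
    have h1 := wPar_eq_iff.mp hz.symm
    have h2 := wPar_eq_iff.mp hy
    have h3 := wPar_eq_iff.mp hz'.symm
    refine Prod.ext (Fin.ext ?_) (Fin.ext ?_) <;> omega
  card_children_le x := by
    have h := Finset.card_le_card_of_injOn (s := {y | wPar γ w y = x}) (t := Finset.range 6)
      (fun y => if (y.2 : ℕ) = 0 then if (y.1 : ℕ) = 0 then 5 else ((y.1 : ℕ) - 1) % 4 else 4)
      (fun y _ => by
        simp only [coe_range, Set.mem_Iio]
        split_ifs <;> omega)
      (fun y hy y' hy' h => by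
        have hy := wPar_eq_iff.mp (by simpa using hy : wPar γ w y = x)
        have hy' := wPar_eq_iff.mp (by simpa using hy' : wPar γ w y' = x)
        dsimp only at h
        refine Prod.ext (Fin.ext ?_) (Fin.ext ?_) <;> split_ifs at h <;> omega)
    simpa using h

variable {γ w : ℕ} (hγ : 3 ≤ γ)

lemma mem_wTree_Lb {x : Fin w × Fin (γ + 1)} : x ∈ (wTree γ w hγ).Lb ↔ (x.2 : ℕ) = γ := by
  simp [wTree]

lemma wTree_Lb_eq : (wTree γ w hγ).Lb = Finset.univ.image fun i => (i, Fin.last γ) := by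
  ext x
  rw [mem_wTree_Lb, mem_image]
  constructor
  · intro h
    exact ⟨x.1, mem_univ _, Prod.ext rfl (Fin.ext (by simp [h]))⟩
  · rintro ⟨i, _, rfl⟩
    simp

lemma card_wTree_Lb : #(wTree γ w hγ).Lb = w := by
  rw [wTree_Lb_eq, card_image_of_injective _ fun i j h => (Prod.ext_iff.mp h).1]
  simp

lemma card_wTree_Lb_compl : #(wTree γ w hγ).Lbᶜ = w * γ := by
  rw [card_compl, card_wTree_Lb, Fintype.card_prod, Fintype.card_fin, Fintype.card_fin, mul_add,
    mul_one, Nat.add_sub_cancel]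

lemma isInducedCopy_range {V W : Type} {H : SimpleGraph W} {G : SimpleGraph V} {φ : W → V}
    (hφ : Function.Injective φ) (h : ∀ x y, G.Adj (φ x) (φ y) ↔ H.Adj x y) :
    IsInducedCopy H G (Set.range φ) :=
  ⟨⟨Equiv.ofInjective φ hφ, by intro x y; exact h x y⟩⟩

lemma LabelledTree.Event.adj_iff {ι V : Type*} [Fintype ι] [DecidableEq ι] [DecidableEq V]
    {T : LabelledTree ι} {D N : Finset V} {g : ι → V} {ω : Sym2 V → Bool} (hE : T.Event D N g ω)
    (hg : Function.Injective g) (hI : Indep (T.labs g) ω) {x y : ι} (hxy : x ≠ y) :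
    ω s(g x, g y) = true ↔ T.par x = y ∨ T.par y = x := by
  constructor
  · intro h
    by_contra hcon
    push Not at hcon
    have hne : g x ≠ g y := fun h => hxy (hg h)
    have hmem : s(g x, g y) ∈ prs (T.pts g) :=
      mem_prs.mpr ⟨mem_image_of_mem _ (mem_univ _), mem_image_of_mem _ (mem_univ _), hne⟩
    have hlab : s(g x, g y) ∉ prs (T.labs g) := fun hl => by simp [hI _ hl] at h
    have hed : s(g x, g y) ∉ T.edges g := by
      intro he
      obtain ⟨z, _, hz⟩ := mem_image.mp he
      rcases Sym2.eq_iff.mp hz with ⟨h1, h2⟩ | ⟨h1, h2⟩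
      · exact hcon.1 (by rw [← hg h1]; exact hg h2)
      · exact hcon.2 (by rw [← hg h1]; exact hg h2)
    have := hE.1.2 _ (Finset.mem_sdiff.mpr ⟨Finset.mem_sdiff.mpr ⟨hmem, hlab⟩, hed⟩)
    simp [this] at h
  · rintro (h | h)
    · refine hE.1.1 _ (mem_image.mpr ⟨x, ?_, by rw [h]⟩)
      simp only [LabelledTree.nonroots, mem_filter_univ]
      rw [h]; exact hxy.symm
    · refine hE.1.1 _ (mem_image.mpr ⟨y, ?_, by rw [h, Sym2.eq_swap]⟩)
      simp only [LabelledTree.nonroots, mem_filter_univ]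
      rw [h]; exact hxy

/-- Gluing the path and the tree part yields a dominating induced copy of `W_a^γ`. -/
lemma exists_dominating_copy {V : Type} [DecidableEq V] {a : ℕ} {ω : Sym2 V → Bool}
    {x : ℕ → V} {g : Fin (ωr 4 a) × Fin (γ + 1) → V} {D N : Finset V}
    (hx : ∀ i < a, ∀ j < a, x i = x j → i = j) (hgx : ∀ y, ∀ i < a, g y ≠ x i)
    (hxx : ∀ i j, i < j → j < a → ω s(x i, x j) = decide (i + 1 = j))
    (hxg : ∀ y, ∀ i < a, ω s(g y, x i) = true ↔ (y.2 : ℕ) = γ ∧ heapDepth 4 y.1 = i)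
    (hg : Function.Injective g) (hE : (wTree γ (ωr 4 a) hγ).Event D N g ω)
    (hI : Indep ((wTree γ (ωr 4 a) hγ).labs g) ω)
    (hcov : ∀ v, v ∈ D ∨ v ∈ N ∨ ∃ i < a, v = x i) :
    ∃ s : Set V, IsInducedCopy (WG γ a) (gr ω) s ∧ ∀ v ∉ s, ∃ u ∈ s, (gr ω).Adj v u := by
  set φ : WVert γ a → V := Sum.elim (fun i => x i) g with hφ
  have hφi : Function.Injective φ := by
    rintro (i | y) (j | y') h
    · exact congrArg _ (Fin.ext (hx i i.2 j j.2 h))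
    · exact absurd h.symm (hgx y' i i.2)
    · exact absurd h (hgx y j j.2)
    · exact congrArg _ (hg h)
  refine ⟨Set.range φ, isInducedCopy_range hφi ?_, ?_⟩
  · have hpath : ∀ i j : Fin a, i ≠ j →
        (ω s(x i, x j) = true ↔ (j : ℕ) = i + 1 ∨ (i : ℕ) = j + 1) := by
      intro i j hij
      rcases lt_or_gt_of_ne hij with h | h
      · rw [hxx i j h j.2, decide_eq_true_iff]; omega
      · rw [Sym2.eq_swap, hxx j i h i.2, decide_eq_true_iff]; omega
    intro u v
    rw [gr_adj, WG, SimpleGraph.fromRel_adj, hφi.ne_iff]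
    refine and_congr_right fun huv => ?_
    rcases u with i | y <;> rcases v with j | y'
    · exact hpath i j fun h => huv (h ▸ rfl)
    · simp only [hφ, Sum.elim_inl, Sum.elim_inr, Wbase, or_false]
      rw [Sym2.eq_swap, hxg y' i i.2]
    · simp only [hφ, Sum.elim_inl, Sum.elim_inr, Wbase, false_or]
      rw [hxg y j j.2]
    · simp only [hφ, Sum.elim_inr, Wbase]
      have hne : y ≠ y' := fun h => huv (h ▸ rfl)
      rw [hE.adj_iff hg hI hne]
      have hne' : (y.1 : ℕ) ≠ y'.1 ∨ (y.2 : ℕ) ≠ y'.2 := by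
        by_contra hcon
        push Not at hcon
        exact hne (Prod.ext (Fin.ext hcon.1) (Fin.ext hcon.2))
      have h1 : (wTree γ (ωr 4 a) hγ).par = wPar γ (ωr 4 a) := rfl
      rw [h1, wPar_eq_iff, wPar_eq_iff, Fin.ext_iff, Fin.ext_iff]
      omega
  · intro v hv
    have key : ∀ U : Finset V, (U : Set V) ⊆ Set.range φ → Dominated v U ω →
        ∃ u ∈ Set.range φ, (gr ω).Adj v u := by
      rintro U hU ⟨e, he, hωe⟩
      obtain ⟨u, hu, rfl⟩ := mem_spokes.mp he
      exact ⟨u, hU hu, fun h => hv (h ▸ hU hu), hωe⟩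
    have hpts : ((wTree γ (ωr 4 a) hγ).pts g : Set V) ⊆ Set.range φ := by
      intro u hu
      obtain ⟨y, _, rfl⟩ := mem_image.mp (mem_coe.mp hu)
      exact ⟨Sum.inr y, rfl⟩
    have hinner : ((wTree γ (ωr 4 a) hγ).inner g : Set V) ⊆ Set.range φ := by
      intro u hu
      obtain ⟨y, _, rfl⟩ := mem_image.mp (mem_coe.mp hu)
      exact ⟨Sum.inr y, rfl⟩
    rcases hcov v with h | h | ⟨i, hi, rfl⟩
    · exact key _ hpts (hE.2.1 v (Finset.mem_sdiff.mpr ⟨h, fun h' => hv (hinner h')⟩))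
    · refine key _ hinner (hE.2.2 v (Finset.mem_sdiff.mpr ⟨h, fun h' => hv ?_⟩))
      obtain ⟨y, _, rfl⟩ := mem_image.mp h'
      exact ⟨Sum.inr y, rfl⟩
    · exact absurd ⟨Sum.inl ⟨i, hi⟩, rfl⟩ hv

end Shape

section Labelled

open Finset

lemma pr_and_ge {E : Type*} [Fintype E] {p : ℝ} (h0 : 0 ≤ p) (h1 : p ≤ 1)
    {Q R : (E → Bool) → Prop} {ε₁ ε₂ : ℝ} (hQ : 1 - ε₁ ≤ pr p Q) (hR : 1 - ε₂ ≤ pr p R) :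
    1 - (ε₁ + ε₂) ≤ pr p (fun ω => Q ω ∧ R ω) := by
  have h := pr_not p Q
  have h' := pr_not p R
  have h2 : pr p (fun ω => ¬ (Q ω ∧ R ω)) ≤ pr p (fun ω => ¬ Q ω) + pr p (fun ω => ¬ R ω) := by
    unfold pr
    rw [← ex_add]
    refine ex_mono h0 h1 fun ω => ?_
    refine (ind_mono fun hω => ?_).trans (ind_or_le _ _)
    tauto
  rw [pr_not] at h2
  linarith

lemma LabelledTree.Event.congr {ι V : Type*} [Fintype ι] [DecidableEq ι] [DecidableEq V]
    {T : LabelledTree ι} {D N : Finset V} {g : ι → V} {ω ω' : Sym2 V → Bool}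
    (hE : T.Event D N g ω) (hDN : Disjoint D N) (hg : T.Conf D N g)
    (h : ∀ v ∈ D ∪ N, ∀ u ∈ T.pts g, (v ∈ N → u ∉ N) → ω s(v, u) = ω' s(v, u)) :
    T.Event D N g ω' := by
  have hDN' : ∀ {v}, v ∈ D → v ∉ N := fun hv => disjoint_left.mp hDN hv
  have hmem : ∀ x, g x ∈ D ∪ N := by
    intro x
    by_cases hx : x ∈ T.Lb
    · exact mem_union_right _ (hg.lab x hx)
    · exact mem_union_left _ (hg.inn x hx)
  have hpts : ∀ x, g x ∈ T.pts g := fun x => mem_image_of_mem _ (mem_univ _)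
  refine ⟨⟨fun e he => ?_, fun e he => ?_⟩, fun v hv => ?_, fun v hv => ?_⟩
  · have h1 := hE.1.1 e he
    obtain ⟨x, _, rfl⟩ := mem_image.mp he
    rw [← h _ (hmem x) _ (hpts _) fun _ => hDN' (hg.inn _ (T.par_notMem x))]
    exact h1
  · have h1 := hE.1.2 e he
    obtain ⟨he1, he2⟩ := Finset.mem_sdiff.mp (Finset.mem_sdiff.mp he).1
    induction e with | _ u v =>
    obtain ⟨hu, hv, huv⟩ := mem_prs.mp he1
    obtain ⟨x, _, rfl⟩ := mem_image.mp hu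
    obtain ⟨y, _, rfl⟩ := mem_image.mp hv
    rw [← h _ (hmem x) _ (hpts y) fun hx hy => he2 ?_]
    · exact h1
    · refine mem_prs.mpr ⟨mem_image_of_mem _ ?_, mem_image_of_mem _ ?_, huv⟩
      · by_contra hc
        exact hDN' (hg.inn x hc) hx
      · by_contra hc
        exact hDN' (hg.inn y hc) hy
  · obtain ⟨e, he, hωe⟩ := hE.2.1 v hv
    refine ⟨e, he, ?_⟩
    obtain ⟨u, hu, rfl⟩ := mem_spokes.mp he
    have hvD := (Finset.mem_sdiff.mp hv).1
    rw [← h v (mem_union_left _ hvD) u hu fun hvN => absurd hvN (hDN' hvD)]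
    exact hωe
  · obtain ⟨e, he, hωe⟩ := hE.2.2 v hv
    refine ⟨e, he, ?_⟩
    obtain ⟨u, hu, rfl⟩ := mem_spokes.mp he
    obtain ⟨x, hx, rfl⟩ := mem_image.mp hu
    rw [← h v (mem_union_right _ (Finset.mem_sdiff.mp hv).1) _ (hpts x)
      fun _ => hDN' (hg.inn x (mem_compl.mp hx))]
    exact hωe

/-- The depth of a node of the 4-ary tree, as an element of `Fin a`. -/
def depth (a : ℕ) (i : Fin (ωr 4 a)) : Fin a := ⟨heapDepth 4 i, heapDepth_lt i.2⟩

/-- The exponent controlling the pairs of configurations with small overlap; `κ` is the number of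
tree vertices, `l` the number of unlabelled ones and `B` the number of available labels. -/
def smallExp (κ l n B s₀ : ℕ) (p : ℝ) : ℝ :=
  κ * (2 * (Real.exp 4 * (1 - p)⁻¹ ^ s₀ * κ / (n / 8)) +
      Real.exp 4 * (1 - p)⁻¹ ^ s₀ / (p * (n / 8)) +
      (Real.exp 4 * (1 - p)⁻¹ ^ s₀) ^ 2 / (p ^ 3 * (n / 8) ^ 2)) +
    (4 * n * ((1 - p) ^ κ) ^ 2 * (1 - p)⁻¹ ^ s₀ + 4 * κ * (1 - p) ^ κ +
      4 * B * ((1 - p) ^ l) ^ 2 * (1 - p)⁻¹ ^ s₀)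

/-- The expected contribution of the pairs of configurations with large overlap, relative to the
squared number of configurations. -/
def largeRatio (κ l w n B b m : ℕ) (p M₀ : ℝ) : ℝ :=
  ((1 - p) ^ w.choose 2) ^ 2 * (M₀ * Real.exp (4 * n * (1 - p) ^ κ + 4 * κ * (1 - p) ^ κ +
    4 * B * (1 - p) ^ l + 4 * κ) * 2 ^ κ) * (4 ^ w * 4 * (2 * b) ^ (2 * m))

lemma largeRatio_cancel {κ l w n B b m : ℕ} {p M₀ ε Q x J : ℝ} (hε : 0 < ε) (hQ : 0 ≤ Q)
    (hx : 0 ≤ x) (hb : 0 < b) (hL : largeRatio κ l w n B b m p M₀ ≤ ε ^ 2)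
    (hJ : x ≤ 2 ^ w * 2 * (2 * b) ^ m * J) :
    ((1 - p) ^ w.choose 2) ^ 2 * (M₀ * Real.exp (4 * n * (1 - p) ^ κ + 4 * κ * (1 - p) ^ κ +
      4 * B * (1 - p) ^ l + 4 * κ) * 2 ^ κ) * (Q * x) ^ 2 ≤ ε * (J * Q) ^ 2 * ε := by
  have hb' : (0 : ℝ) < b := by exact_mod_cast hb
  have hc : (0 : ℝ) < 4 ^ w * 4 * (2 * b) ^ (2 * m) := by positivity
  unfold largeRatio at hL
  generalize ((1 - p) ^ w.choose 2) ^ 2 * (M₀ * Real.exp (4 * n * (1 - p) ^ κ +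
    4 * κ * (1 - p) ^ κ + 4 * B * (1 - p) ^ l + 4 * κ) * 2 ^ κ) = E at *
  have hs : (4 : ℝ) ^ w * 4 * (2 * b) ^ (2 * m) = (2 ^ w * 2 * (2 * b) ^ m) ^ 2 := by
    rw [show (4 : ℝ) ^ w = (2 ^ w) ^ 2 by rw [← pow_mul, mul_comm, pow_mul]; norm_num]
    rw [show (2 * (b : ℝ)) ^ (2 * m) = ((2 * b) ^ m) ^ 2 by rw [mul_comm 2 m, pow_mul] ]
    ring
  rw [hs] at hL hc
  generalize (2 : ℝ) ^ w * 2 * (2 * b) ^ m = c at *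
  refine le_of_mul_le_mul_right ?_ hc
  calc E * (Q * x) ^ 2 * c ^ 2 = E * c ^ 2 * (Q * x) ^ 2 := by ring
    _ ≤ ε ^ 2 * (Q * (c * J)) ^ 2 := by gcongr
    _ = _ := by ring

set_option maxHeartbeats 1000000 in
lemma pr_labelled_event_ge {V : Type*} [Fintype V] [DecidableEq V] {γ a n N b t₀ m s₀ : ℕ}
    {p y t M₀ ε : ℝ} (hγ : 3 ≤ γ) (ha : 1 ≤ a) (hp0 : 0 < p) (hp1 : p < 1)
    {ν : Fin a → Fin N → V} (hν : Function.Injective fun q : Fin a × Fin N => ν q.1 q.2)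
    {D NS P₃ : Finset V} (hNS : NS = Finset.univ.image fun q : Fin a × Fin N => ν q.1 q.2)
    (hDN : Disjoint D NS) (hP₃ : P₃ ⊆ D) (hn : 0 < n) (hDn : #D ≤ n) (hn₃ : (n : ℝ) / 8 ≤ #P₃)
    (hm : m = ωr 4 a + a * t₀) (hmN : m * b ≤ N) (hb : 0 < b) (hy : 1 ≤ y)
    (hqy : 1 ≤ y ^ 2 * (1 - p) ^ m) (ht : 0 ≤ t) (htt : 2 * t ≤ t₀)
    (hty : 2 * (m : ℝ) ^ 2 * y < t ^ 2 * b) (hIN : 2 * ωr 4 a ≤ N)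
    (hκ : 7 ≤ p * (ωr 4 a * (γ + 1) : ℕ))
    (hq₁ : (1 - p) ^ (ωr 4 a * (γ + 1)) ≤ 1 / 2) (hq₂ : (1 - p) ^ (ωr 4 a * γ) ≤ 1 / 2)
    (hθ : ((ωr 4 a * (γ + 1) : ℕ) : ℝ) ^ 2 ≤ n / 8)
    (hM₀ : 0 < M₀)
    (hM : ∀ l k : ℕ, l ≤ ωr 4 a * γ → k ≤ ωr 4 a → s₀ < l + k →
      (1 - p)⁻¹ ^ (l + k).choose 2 * ((((ωr 4 a * (γ + 1) : ℕ) : ℝ) / (n / 8)) ^ l *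
        (((ωr 4 a * (γ + 1) : ℕ) : ℝ) / N) ^ k) ≤ M₀)
    (hε : 0 < ε) (hL : largeRatio (ωr 4 a * (γ + 1)) (ωr 4 a * γ) (ωr 4 a) n (a * N) b m p M₀ ≤ ε ^ 2) :
    1 - (2 * Real.exp (-t ^ 2 / (2 * m)) + ε) -
        (1 - (1 - ((ωr 4 a * (γ + 1) : ℕ) : ℝ) ^ 2 / (n / 8)) ^ 2 /
          (Real.exp (smallExp (ωr 4 a * (γ + 1)) (ωr 4 a * γ) n (a * N) s₀ p) + ε)) ≤
      pr p (fun ω => ∃ g : Fin (ωr 4 a) × Fin (γ + 1) → V,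
        (wTree γ (ωr 4 a) hγ).Conf D NS g ∧
        (∀ x ∈ (wTree γ (ωr 4 a) hγ).Lb, ∃ c, g x = ν (depth a x.1) c) ∧
        (∀ x ∉ (wTree γ (ωr 4 a) hγ).Lb, g x ∈ P₃) ∧
        (wTree γ (ωr 4 a) hγ).Event D NS g ω ∧ Indep ((wTree γ (ωr 4 a) hγ).labs g) ω) := by
  have hq0 : 0 < 1 - p := by linarith
  have hn' : (0 : ℝ) < n := by exact_mod_cast hn
  have hn3pos : (0 : ℝ) < #P₃ := lt_of_lt_of_le (by positivity) hn₃
  have hn3 : 0 < #P₃ := by exact_mod_cast hn3pos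
  have hw : 0 < ωr 4 a := by
    obtain ⟨a, rfl⟩ : ∃ a', a = a' + 1 := ⟨a - 1, by omega⟩
    rw [ωr_four_succ]; omega
  have hN : 0 < N := by omega
  have hN' : (0 : ℝ) < N := by exact_mod_cast hN
  set T := wTree γ (ωr 4 a) hγ with hT
  have hLb : #T.Lb = ωr 4 a := card_wTree_Lb hγ
  have hLbc : #T.Lbᶜ = ωr 4 a * γ := card_wTree_Lb_compl hγ
  have hcard : Fintype.card (Fin (ωr 4 a) × Fin (γ + 1)) = ωr 4 a * (γ + 1) := by simp
  have hLbeq : T.Lb = Finset.univ.image fun i => (i, Fin.last γ) := wTree_Lb_eq hγ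
  have hNScard : #NS = a * N := by
    rw [hNS, card_image_of_injective _ hν]; simp
  have hνNS : ∀ c j, ν c j ∈ NS := fun c j => by
    rw [hNS]; exact mem_image.mpr ⟨(c, j), mem_univ _, rfl⟩
  set P : Fin (ωr 4 a) × Fin (γ + 1) → Finset V := fun x =>
    if x ∈ T.Lb then Finset.univ.image (ν (depth a x.1)) else P₃ with hP
  have hPl : ∀ x ∈ T.Lb, P x = Finset.univ.image (ν (depth a x.1)) := fun x hx => if_pos hx
  have hPn : ∀ x ∉ T.Lb, P x = P₃ := fun x hx => if_neg hx
  have hPc : ∀ x ∈ T.Lb, #(P x) = N := by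
    intro x hx
    rw [hPl x hx, card_image_of_injective _ fun i j h => ?_]
    · simp
    · have := @hν (depth a x.1, i) (depth a x.1, j) h
      exact (Prod.ext_iff.mp this).2
  have hPNS : ∀ x ∈ T.Lb, P x ⊆ NS := by
    intro x hx v hv
    rw [hPl x hx] at hv
    obtain ⟨j, _, rfl⟩ := mem_image.mp hv
    exact hνNS _ _
  set K : ℝ := ((1 - p) ^ (ωr 4 a).choose 2) ^ 2 * (M₀ *
    Real.exp (4 * n * (1 - p) ^ (ωr 4 a * (γ + 1)) +
      4 * (ωr 4 a * (γ + 1) : ℕ) * (1 - p) ^ (ωr 4 a * (γ + 1)) +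
      4 * (a * N : ℕ) * (1 - p) ^ (ωr 4 a * γ) + 4 * (ωr 4 a * (γ + 1) : ℕ)) *
      2 ^ (ωr 4 a * (γ + 1))) * ((#P₃ : ℝ) ^ (ωr 4 a * γ) * N ^ ωr 4 a) ^ 2
    with hK
  have hK0 : 0 < K := by positivity
  have hex : ex p (T.largeSum p #D #NS s₀ P) ≤ K := by
    refine (LabelledTree.ex_largeSum_le hp0 hp1 (by rw [hcard]; exact hκ) P hn3 hN
      (fun x hx => by rw [hPn x hx]) hPc #D #NS s₀ hDN
      (fun x hx => by rw [hPn x hx]; exact hP₃) hPNS hM₀.le ?_).trans ?_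
    · intro l k hl hk hlk
      rw [hLbc] at hl
      rw [hLb] at hk
      refine le_trans ?_ (hM l k hl hk hlk)
      rw [hcard]
      have : 0 < (n : ℝ) / 8 := by positivity
      gcongr
    · rw [hLb, hLbc, hcard, hNScard, hK]
      have : (#D : ℝ) ≤ n := by exact_mod_cast hDn
      gcongr
  set d : Fin (ωr 4 a) → Fin a := depth a with hd
  have : Nonempty (Fin (ωr 4 a)) := ⟨⟨0, hw⟩⟩
  have hlab := pr_labellings_ge (b := b) hp0.le hp1 hν d (m := m) (t₀ := t₀) (y := y) (t := t)
    (by simpa using hm) hmN hb hy hqy ht htt hty (by simpa using hIN)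
  rw [Fintype.card_fin] at hlab
  have hmarkov : 1 - ε ≤ pr p (fun ω => ¬ K / ε ≤ T.largeSum p #D #NS s₀ P ω) := by
    have h := pr_markov hp0.le hp1.le (F := T.largeSum p #D #NS s₀ P)
      (LabelledTree.largeSum_nonneg hp0 hp1 _ _ _ _) (t := K / ε) (by positivity)
    have h2 : ex p (T.largeSum p #D #NS s₀ P) / (K / ε) ≤ ε := by
      rw [div_le_iff₀ (by positivity)]
      refine hex.trans (le_of_eq ?_)
      field_simp
    rw [pr_not]; linarith
  have hB1 : (1 : ℝ) ≤ Real.exp (smallExp (ωr 4 a * (γ + 1)) (ωr 4 a * γ) n (a * N) s₀ p) := by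
    refine Real.one_le_exp ?_
    unfold smallExp
    positivity
  set θ : ℝ := ((ωr 4 a * (γ + 1) : ℕ) : ℝ) ^ 2 / (n / 8) with hθd
  have hθ1 : θ ≤ 1 := by rw [hθd, div_le_one (by positivity)]; exact hθ
  have hθ0 : 0 ≤ θ := by positivity
  refine pr_ge_of_glue hp0.le hp1.le (prs NS : Set (Sym2 V)) ?_
    (pr_and_ge hp0.le hp1.le hlab hmarkov) ?_
  · rw [sub_nonneg, div_le_one (by positivity)]
    nlinarith
  rintro ω₀ ⟨hc, hls⟩
  rw [not_le] at hls
  rw [sub_sub_cancel]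
  have hcpos : (0 : ℝ) < #(labellings ν d ω₀) := by
    have h1 : (0 : ℝ) < (N / 2) ^ ωr 4 a := by positivity
    by_contra hcon
    have h2 : (#(labellings ν d ω₀) : ℝ) = 0 := le_antisymm (not_lt.mp hcon) (by positivity)
    rw [h2, mul_zero] at hc
    linarith
  have hmemL : ∀ L, L ∈ labellings ν d ω₀ ↔ (Function.Injective fun i => ν (d i) (L i)) ∧
      Indep (Finset.image (fun i => ν (d i) (L i)) Finset.univ) ω₀ := by
    intro L; simp [labellings]
  have hlast : ∀ {x : Fin (ωr 4 a) × Fin (γ + 1)}, x ∈ T.Lb → x = (x.1, Fin.last γ) := by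
    intro x hx
    exact Prod.ext rfl (Fin.ext ((mem_wTree_Lb hγ).mp hx))
  have hmain := LabelledTree.pr_exists_event_ge (T := T) hp0 hp1 hDN hP₃ (card_pos.mp hn3)
    (by rw [hcard]; exact hq₁) (by rw [hLbc]; exact hq₂) P hPn hPNS (labellings ν d ω₀)
    (card_pos.mp (by exact_mod_cast hcpos)) (fun L x => ν (d x.1) (L x.1))
    (fun L _ x hx => by rw [hPl x hx]; exact mem_image_of_mem _ (mem_univ _))
    (fun L hL x hx x' hx' h => by
      rw [hlast hx, hlast hx', ((hmemL L).mp hL).1 h])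
    (fun L _ L' _ h => funext fun i => by
      have h1 := h (i, Fin.last γ) ((mem_wTree_Lb hγ).mpr (by simp))
      exact (Prod.ext_iff.mp (@hν (d i, L i) (d i, L' i) h1)).2)
    ω₀ (fun L hL => by
      rw [hLbeq, image_image]
      exact ((hmemL L).mp hL).2)
    s₀ (B := Real.exp (smallExp (ωr 4 a * (γ + 1)) (ωr 4 a * γ) n (a * N) s₀ p)) (ε := ε) (by linarith) hε.le
    (by rw [hcard]; exact hθ.trans hn₃)
    (fun g hg μ hμ => by
      refine (LabelledTree.sum_pairFactor_small_le hg.inj hp0 hp1 (by rw [hcard]; exact hκ) hDN hP₃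
        (card_pos.mp hn3) hg.inn hg.lab hμ #D #NS s₀ rfl).trans ?_
      refine mul_le_mul_of_nonneg_left ?_ (by positivity)
      rw [← Real.exp_add, hcard, hLbc, hNScard]
      refine Real.exp_le_exp.mpr ?_
      have : (#D : ℝ) ≤ n := by exact_mod_cast hDn
      have : 0 < (n : ℝ) / 8 := by positivity
      unfold smallExp
      gcongr)
    (by
      refine hls.le.trans ?_
      rw [div_le_iff₀ hε, hLbc]
      refine largeRatio_cancel hε (by positivity) (by positivity) hb hL ?_
      rw [div_pow, div_le_iff₀ (by positivity)] at hc
      exact hc.trans (le_of_eq (by ring)))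
  rw [hcard] at hmain
  have hθ' : ((ωr 4 a * (γ + 1) : ℕ) : ℝ) ^ 2 / #P₃ ≤ θ := by
    rw [hθd]
    gcongr
  refine le_trans ?_ (hmain.trans (pr_mono hp0.le hp1.le ?_))
  · have h1 : 0 ≤ 1 - θ := by linarith
    gcongr
  · rintro ω ⟨L, hL, g, hg, hgl, hgi, hE⟩
    refine ⟨g, hg, fun x hx => ⟨L x.1, hgl x hx⟩, hgi, hE.congr hDN hg ?_, ?_⟩
    · intro v hv u hu hvu
      rw [pw_of_notMem]
      intro hmem
      obtain ⟨h1, h2, _⟩ := mem_prs.mp (mem_coe.mp hmem)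
      exact hvu h1 h2
    · have hsub : T.labs g ⊆ NS := by
        intro v hv
        obtain ⟨x, hx, rfl⟩ := mem_image.mp hv
        exact hg.lab x hx
      intro e he
      rw [pw_of_mem (mem_coe.mpr (prs_mono hsub he))]
      have h1 : T.labs g = Finset.univ.image fun i => ν (d i) (L i) := by
        have h2 : T.labs g = T.Lb.image fun x => ν (d x.1) (L x.1) :=
          Finset.image_congr fun x hx => hgl x hx
        rw [h2, hLbeq, image_image]; rfl
      rw [h1] at he
      exact ((hmemL L).mp hL).2 e he

end Labelled

section Assembly

open Finset

lemma smallExp_nonneg {κ l n B s₀ : ℕ} {p : ℝ} (hp0 : 0 < p) (hp1 : p < 1) :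
    0 ≤ smallExp κ l n B s₀ p := by
  have : 0 < 1 - p := by linarith
  unfold smallExp
  positivity

lemma mem_privateNbrs {V : Type*} [Fintype V] [DecidableEq V] {W U : Finset V} {u v : V}
    {ω : Sym2 V → Bool} : v ∈ privateNbrs W U u ω ↔
      v ∈ W ∧ ω s(v, u) = true ∧ ∀ w ∈ U.erase u, ω s(v, w) = false := mem_filter

lemma mem_nonNbrs {V : Type*} [Fintype V] [DecidableEq V] {W U : Finset V} {v : V}
    {ω : Sym2 V → Bool} : v ∈ nonNbrs W U ω ↔ v ∈ W ∧ ∀ w ∈ U, ω s(v, w) = false := mem_filter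

lemma exists_dominating_copy_of_pw {V : Type} [Fintype V] [DecidableEq V] {γ a : ℕ} (hγ : 3 ≤ γ)
    {ω₁ ω₂ ω₃ : Sym2 V → Bool} {x : ℕ → V} {Rt U W D NS : Finset V} (hW : W = univ \ Rt)
    (hU : U = (range a).image x) (hUR : U ⊆ Rt) (hx : ∀ i < a, ∀ j < a, x i = x j → i = j)
    (hxx : ∀ i j, i < j → j < a → ω₁ s(x i, x j) = decide (i + 1 = j))
    (hD : D = univ \ (U ∪ NS)) (hNW : NS ⊆ W)
    {g : Fin (ωr 4 a) × Fin (γ + 1) → V} (hg : (wTree γ (ωr 4 a) hγ).Conf D NS g)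
    (hgl : ∀ y ∈ (wTree γ (ωr 4 a) hγ).Lb, g y ∈ privateNbrs W U (x (depth a y.1)) ω₂)
    (hgi : ∀ y ∉ (wTree γ (ωr 4 a) hγ).Lb, g y ∈ nonNbrs W U ω₂)
    (hE : (wTree γ (ωr 4 a) hγ).Event D NS g ω₃)
    (hI : Indep ((wTree γ (ωr 4 a) hγ).labs g) ω₃) :
    let ω := pw (prs Rt : Set (Sym2 V)) ω₁
      (pw {e | ∃ v ∈ W, ∃ u ∈ U, s(v, u) = e} ω₂ ω₃)
    ∃ s : Set V, IsInducedCopy (WG γ a) (gr ω) s ∧ ∀ v ∉ s, ∃ u ∈ s, (gr ω).Adj v u := by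
  intro ω
  set T := wTree γ (ωr 4 a) hγ with hT
  have hWR : ∀ {v}, v ∈ W → v ∉ Rt := fun hv => by
    rw [hW] at hv; exact (Finset.mem_sdiff.mp hv).2
  have hWU : ∀ {v}, v ∈ W → v ∉ U := fun hv h => hWR hv (hUR h)
  have hgW : ∀ y, g y ∈ W := by
    intro y
    by_cases hy : y ∈ T.Lb
    · exact (mem_privateNbrs.mp (hgl y hy)).1
    · exact (mem_nonNbrs.mp (hgi y hy)).1
  have hxU : ∀ i < a, x i ∈ U := fun i hi => by
    rw [hU]; exact mem_image_of_mem _ (mem_range.mpr hi)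
  have hout : ∀ v u, u ∈ W → v ∉ U → ω s(v, u) = ω₃ s(v, u) := by
    intro v u hu hv
    simp only [ω]
    rw [pw_of_notMem, pw_of_notMem]
    · rintro ⟨v', hv', u', hu', he⟩
      rcases Sym2.eq_iff.mp he with ⟨rfl, rfl⟩ | ⟨rfl, rfl⟩
      · exact hWU hu hu'
      · exact hv hu'
    · intro he
      exact hWR hu (mem_prs.mp (mem_coe.mp he)).2.1
  have hcross : ∀ v u, v ∈ W → u ∈ U → ω s(v, u) = ω₂ s(v, u) := by
    intro v u hv hu
    simp only [ω]
    rw [pw_of_notMem, pw_of_mem]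
    · exact ⟨v, hv, u, hu, rfl⟩
    · intro he
      exact hWR hv (mem_prs.mp (mem_coe.mp he)).1
  have hDU : ∀ {v}, v ∈ D → v ∉ U := fun hv h => by
    rw [hD] at hv
    exact (Finset.mem_sdiff.mp hv).2 (mem_union_left _ h)
  have hDN : Disjoint D NS := by
    rw [hD]
    exact disjoint_left.mpr fun v hv h => (Finset.mem_sdiff.mp hv).2 (mem_union_right _ h)
  have hE' : T.Event D NS g ω := by
    refine hE.congr hDN hg fun v hv u hu _ => (hout v u ?_ ?_).symm
    · obtain ⟨y, _, rfl⟩ := mem_image.mp hu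
      exact hgW y
    · rcases mem_union.mp hv with h | h
      · exact hDU h
      · exact hWU (hNW h)
  have hI' : Indep (T.labs g) ω := by
    intro e he
    induction e with | _ u v =>
    obtain ⟨hu, hv, huv⟩ := mem_prs.mp he
    obtain ⟨y, _, rfl⟩ := mem_image.mp hu
    obtain ⟨z, _, rfl⟩ := mem_image.mp hv
    rw [hout _ _ (hgW z) (hWU (hgW y))]
    exact hI _ he
  refine exists_dominating_copy (hγ := hγ) hx (fun y i hi (h : g y = x i) => hWU (hgW y) (h ▸ hxU i hi)) ?_ ?_
    hg.inj hE' hI' ?_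
  · intro i j hij hj
    rw [← hxx i j hij hj]
    refine pw_of_mem (mem_coe.mpr (mem_prs.mpr ⟨hUR (hxU i (by omega)), hUR (hxU j hj), ?_⟩)) _ _
    intro h
    exact hij.ne (hx i (by omega) j hj h)
  · intro y i hi
    rw [hcross _ _ (hgW y) (hxU i hi)]
    by_cases hy : y ∈ T.Lb
    · have h1 := (mem_privateNbrs.mp (hgl y hy)).2
      have hy' : (y.2 : ℕ) = γ := (mem_wTree_Lb hγ).mp hy
      by_cases hd : heapDepth 4 y.1 = i
      · subst hd
        simp only [hy', true_and, iff_true]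
        exact h1.1
      · simp only [hd, and_false, iff_false, Bool.not_eq_true]
        refine h1.2 _ (mem_erase.mpr ⟨fun h => hd ?_, hxU i hi⟩)
        exact (hx i hi _ (depth a y.1).2 h).symm
    · have hy' : ¬ (y.2 : ℕ) = γ := fun h => hy ((mem_wTree_Lb hγ).mpr h)
      simp only [hy', false_and, iff_false, Bool.not_eq_true]
      exact (mem_nonNbrs.mp (hgi y hy)).2 _ (hxU i hi)
  · intro v
    by_cases hvU : v ∈ U
    · rw [hU] at hvU
      obtain ⟨i, hi, rfl⟩ := mem_image.mp hvU
      exact Or.inr (Or.inr ⟨i, mem_range.mp hi, rfl⟩)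
    · by_cases hvN : v ∈ NS
      · exact Or.inr (Or.inl hvN)
      · refine Or.inl ?_
        rw [hD]
        simp [hvU, hvN]

/-- A bound for the failure probability of the construction. -/
def failProb (γ a n N m s₀ r : ℕ) (p t ε : ℝ) : ℝ :=
  a * (1 - p * (1 - p) ^ a) ^ r + (a + 1) * (16 / (n * p)) +
    ((2 * Real.exp (-t ^ 2 / (2 * m)) + ε) +
      (1 - (1 - ((ωr 4 a * (γ + 1) : ℕ) : ℝ) ^ 2 / (n / 8)) ^ 2 /
        (Real.exp (smallExp (ωr 4 a * (γ + 1)) (ωr 4 a * γ) n (a * N) s₀ p) + ε)))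

set_option maxHeartbeats 1000000 in
lemma prob_dominating_copy_ge {γ a n N b t₀ m s₀ r : ℕ}
    {p y t M₀ ε : ℝ} (hγ : 3 ≤ γ) (ha : 1 ≤ a) (hp0 : 0 < p) (hp1 : p < 1)
    (hn : 0 < n) (har : 2 * (a * r) ≤ n) (hpa : 1 / 2 ≤ (1 - p) ^ a) (hNn : (N : ℝ) ≤ n * p / 8)
    (hm : m = ωr 4 a + a * t₀) (hmN : m * b ≤ N) (hb : 0 < b) (hy : 1 ≤ y)
    (hqy : 1 ≤ y ^ 2 * (1 - p) ^ m) (ht : 0 ≤ t) (htt : 2 * t ≤ t₀)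
    (hty : 2 * (m : ℝ) ^ 2 * y < t ^ 2 * b) (hIN : 2 * ωr 4 a ≤ N)
    (hκ : 7 ≤ p * (ωr 4 a * (γ + 1) : ℕ))
    (hq₁ : (1 - p) ^ (ωr 4 a * (γ + 1)) ≤ 1 / 2) (hq₂ : (1 - p) ^ (ωr 4 a * γ) ≤ 1 / 2)
    (hθ : ((ωr 4 a * (γ + 1) : ℕ) : ℝ) ^ 2 ≤ n / 8)
    (hM₀ : 0 < M₀)
    (hM : ∀ l k : ℕ, l ≤ ωr 4 a * γ → k ≤ ωr 4 a → s₀ < l + k →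
      (1 - p)⁻¹ ^ (l + k).choose 2 * ((((ωr 4 a * (γ + 1) : ℕ) : ℝ) / (n / 8)) ^ l *
        (((ωr 4 a * (γ + 1) : ℕ) : ℝ) / N) ^ k) ≤ M₀)
    (hε : 0 < ε)
    (hL : largeRatio (ωr 4 a * (γ + 1)) (ωr 4 a * γ) (ωr 4 a) n (a * N) b m p M₀ ≤ ε ^ 2) :
    1 - failProb γ a n N m s₀ r p t ε ≤ prob n p (fun G => ∃ s : Set (Fin n),
      IsInducedCopy (WG γ a) G s ∧ ∀ v ∉ s, ∃ u ∈ s, G.Adj v u) := by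
  have hn' : (0 : ℝ) < n := by exact_mod_cast hn
  have hq0 : 0 < 1 - p := by linarith
  have : Nonempty (Fin n) := ⟨⟨0, hn⟩⟩
  set R : ℕ → Finset (Fin n) := fun j => {v | (v : ℕ) ∈ Finset.Ico (j * r) ((j + 1) * r)} with hR
  have hRdis : Pairwise fun i j => Disjoint (R i) (R j) := by
    have haux : ∀ i j, i < j → Disjoint (R i) (R j) := by
      intro i j hij
      refine disjoint_left.mpr fun v hv hv' => ?_
      have h1 := (Finset.mem_Ico.mp (mem_filter.mp hv).2).2
      have h2 := (Finset.mem_Ico.mp (mem_filter.mp hv').2).1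
      have h3 : (i + 1) * r ≤ j * r := Nat.mul_le_mul_right _ hij
      omega
    intro i j hij
    rcases lt_or_gt_of_ne hij with h | h
    · exact haux i j h
    · exact (haux j i h).symm
  have hRcard : ∀ j < a, #(R j) = r := by
    intro j hj
    have h1 : (j + 1) * r ≤ a * r := Nat.mul_le_mul_right _ hj
    have h2 : (R j).map Fin.valEmbedding = Finset.Ico (j * r) ((j + 1) * r) := by
      ext v
      simp only [hR, Finset.mem_map, mem_filter, mem_univ, true_and, Fin.valEmbedding_apply]
      refine ⟨?_, fun hv => ?_⟩
      · rintro ⟨w, hw, rfl⟩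
        exact hw
      · have hv2 := (Finset.mem_Ico.mp hv).2
        exact ⟨⟨v, by omega⟩, hv, rfl⟩
    rw [← Finset.card_map Fin.valEmbedding, h2, Nat.card_Ico, add_mul, one_mul, Nat.add_sub_cancel_left]
  set Rt : Finset (Fin n) := (range a).biUnion R with hRt
  have hRtc : #Rt ≤ a * r := by
    refine (card_biUnion_le).trans ?_
    rw [Finset.sum_congr rfl fun j hj => hRcard j (mem_range.mp hj)]
    simp
  set W : Finset (Fin n) := univ \ Rt with hW
  have hWc : (n : ℝ) / 2 ≤ #W := by
    have h1 : #W = n - #Rt := by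
      rw [hW, card_sdiff_of_subset (subset_univ _)]; simp
    have h2 : n ≤ 2 * #W := by omega
    have h3 : (n : ℝ) ≤ 2 * #W := by exact_mod_cast h2
    linarith
  have hWpos : (0 : ℝ) < #W := by linarith [half_pos hn']
  have hW0 : W.Nonempty := card_pos.mp (by exact_mod_cast hWpos)
  set εB : ℝ := (a + 1) * (16 / (n * p)) with hεB
  set δ : ℝ := (2 * Real.exp (-t ^ 2 / (2 * m)) + ε) +
      (1 - (1 - ((ωr 4 a * (γ + 1) : ℕ) : ℝ) ^ 2 / (n / 8)) ^ 2 /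
        (Real.exp (smallExp (ωr 4 a * (γ + 1)) (ωr 4 a * γ) n (a * N) s₀ p) + ε)) with hδ
  have hδ0 : 0 ≤ δ := by
    have h1 := Real.one_le_exp (smallExp_nonneg (κ := ωr 4 a * (γ + 1)) (l := ωr 4 a * γ) (n := n)
      (B := a * N) (s₀ := s₀) hp0 hp1)
    have h2 : ((ωr 4 a * (γ + 1) : ℕ) : ℝ) ^ 2 / (n / 8) ≤ 1 := by
      rw [div_le_one (by positivity)]; exact hθ
    have h3 : 0 ≤ ((ωr 4 a * (γ + 1) : ℕ) : ℝ) ^ 2 / (n / 8) := by positivity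
    have h4 : (1 - ((ωr 4 a * (γ + 1) : ℕ) : ℝ) ^ 2 / (n / 8)) ^ 2 /
        (Real.exp (smallExp (ωr 4 a * (γ + 1)) (ωr 4 a * γ) n (a * N) s₀ p) + ε) ≤ 1 := by
      rw [div_le_one (by positivity)]
      nlinarith
    have h5 := Real.exp_pos (-t ^ 2 / (2 * m))
    linarith
  rw [prob_eq_pr, failProb, add_assoc, ← hεB, ← hδ, ← sub_sub]
  refine pr_ge_of_glue hp0.le hp1.le (prs Rt : Set (Sym2 (Fin n))) (by positivity)
    (pr_pathEvent_ge hp0.le hp1.le hRdis (fun j hj => (hRcard j hj).ge) le_rfl) ?_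
  rintro ω₁ ⟨x, hxR, hxx⟩
  have hx : ∀ i < a, ∀ j < a, x i = x j → i = j := by
    intro i hi j hj h
    by_contra hij
    exact disjoint_left.mp (hRdis hij) (hxR i hi) (h ▸ hxR j hj)
  set U : Finset (Fin n) := (range a).image x with hU
  have hUc : #U = a := by
    rw [hU, card_image_of_injOn, card_range]
    exact fun i hi j hj h => hx i (by simpa using hi) j (by simpa using hj) h
  have hUR : U ⊆ Rt := by
    intro v hv
    obtain ⟨i, hi, rfl⟩ := mem_image.mp hv
    exact mem_biUnion.mpr ⟨i, hi, hxR i (mem_range.mp hi)⟩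
  have hWU : Disjoint W U := disjoint_left.mpr fun v hv hvU => (Finset.mem_sdiff.mp hv).2 (hUR hvU)
  have hB := pr_neighbourhoods_ge hp0 hp1 hWU hW0
  rw [hUc] at hB
  rw [← sub_sub]
  refine pr_ge_of_glue hp0.le hp1.le {e | ∃ v ∈ W, ∃ u ∈ U, s(v, u) = e} hδ0
    (le_trans ?_ hB) ?_
  · have h1 : n * p / 4 ≤ #W * (p * (1 - p) ^ a) := by
      calc n * p / 4 = (n / 2 : ℝ) * (p * (1 / 2)) := by ring
        _ ≤ _ := by gcongr
    have h2 : 4 / (#W * (p * (1 - p) ^ a)) ≤ 4 / (n * p / 4) := by gcongr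
    have h3 : 4 / (n * p / 4) = 16 / (n * p) := by field_simp; norm_num
    rw [hεB]
    rw [h3] at h2
    gcongr
  rintro ω₂ ⟨hpriv, hnon⟩
  have hNpriv : ∀ c : Fin a, N ≤ #(privateNbrs W U (x c) ω₂) := by
    intro c
    have h1 := hpriv (x c) (mem_image_of_mem _ (mem_range.mpr c.2))
    have h2 : n * p / 8 ≤ #W * (p * (1 - p) ^ a) / 2 := by
      calc n * p / 8 = (n / 2 : ℝ) * (p * (1 / 2)) / 2 := by ring
        _ ≤ _ := by gcongr
    exact_mod_cast hNn.trans (h2.trans h1)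
  set ν : Fin a → Fin N → Fin n := fun c j =>
    (privateNbrs W U (x c) ω₂).orderEmbOfCardLe (hNpriv c) j with hν
  have hνmem : ∀ (c : Fin a) (j : Fin N), ν c j ∈ privateNbrs W U (x c) ω₂ := fun c j =>
    Finset.orderEmbOfCardLe_mem _ _ _
  have hνinj : Function.Injective fun q : Fin a × Fin N => ν q.1 q.2 := by
    rintro ⟨c, j⟩ ⟨c', j'⟩ h
    simp only at h
    have h1 := (mem_privateNbrs.mp (hνmem c j)).2
    have h2 := (mem_privateNbrs.mp (hνmem c' j')).2
    have hc : c = c' := by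
      by_contra hcc
      have hne : x c ≠ x c' := fun hxc => hcc (Fin.ext (hx _ c.2 _ c'.2 hxc))
      have h3 := h1.2 (x c') (mem_erase.mpr ⟨hne.symm,
        mem_image_of_mem _ (mem_range.mpr c'.2)⟩)
      rw [h, h2.1] at h3
      exact Bool.noConfusion h3
    subst hc
    exact Prod.ext rfl ((Finset.orderEmbOfCardLe _ (hNpriv c)).injective h)
  set NS : Finset (Fin n) := univ.image fun q : Fin a × Fin N => ν q.1 q.2 with hNS
  have hNSW : NS ⊆ W := by
    intro v hv
    obtain ⟨q, _, rfl⟩ := mem_image.mp hv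
    exact (mem_privateNbrs.mp (hνmem q.1 q.2)).1
  set D : Finset (Fin n) := univ \ (U ∪ NS) with hD
  have hDN : Disjoint D NS :=
    disjoint_left.mpr fun v hv h => (Finset.mem_sdiff.mp hv).2 (mem_union_right _ h)
  have hP₃ : nonNbrs W U ω₂ ⊆ D := by
    intro v hv
    obtain ⟨hvW, hvU⟩ := mem_nonNbrs.mp hv
    refine Finset.mem_sdiff.mpr ⟨mem_univ _, fun h => ?_⟩
    rcases mem_union.mp h with h | h
    · exact disjoint_left.mp hWU hvW h
    · obtain ⟨q, _, rfl⟩ := mem_image.mp h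
      have h1 := (mem_privateNbrs.mp (hνmem q.1 q.2)).2.1
      rw [hvU _ (mem_image_of_mem _ (mem_range.mpr q.1.2))] at h1
      exact Bool.noConfusion h1
  have hmain := pr_labelled_event_ge (D := D) (P₃ := nonNbrs W U ω₂) (ε := ε) hγ ha hp0 hp1 hνinj
    hNS hDN hP₃ hn ((card_le_univ D).trans (by simp)) (le_trans ?_ hnon) hm hmN hb hy hqy ht htt
    hty hIN hκ hq₁ hq₂ hθ hM₀ hM hε hL
  · rw [sub_sub, ← hδ] at hmain
    refine hmain.trans (pr_mono hp0.le hp1.le ?_)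
    rintro ω₃ ⟨g, hg, hgl, hgi, hE, hI⟩
    refine exists_dominating_copy_of_pw hγ hW hU hUR hx hxx hD hNSW hg (fun y hy => ?_) hgi hE hI
    obtain ⟨c, hc⟩ := hgl y hy
    rw [hc]
    exact hνmem _ _
  · calc (n : ℝ) / 8 = (n / 2) * (1 / 2) / 2 := by ring
      _ ≤ _ := by gcongr

end Assembly

section Growth

open Topology

/-- `u i = exp ((x + o(1)) * L i)`. -/
structure Growth (L u : ℕ → ℝ) (x : ℝ) : Prop where
  pos : ∀ᶠ i in atTop, 0 < u i
  lim : Tendsto (fun i => Real.log (u i) / L i) atTop (𝓝 x)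

namespace Growth

variable {L u v : ℕ → ℝ} {x x' c : ℝ}

lemma mul (hu : Growth L u x) (hv : Growth L v x') : Growth L (fun i => u i * v i) (x + x') where
  pos := by filter_upwards [hu.pos, hv.pos] with i h h' using mul_pos h h'
  lim := by
    refine (hu.lim.add hv.lim).congr' ?_
    filter_upwards [hu.pos, hv.pos] with i h h'
    rw [Real.log_mul h.ne' h'.ne', add_div]

lemma inv (hu : Growth L u x) : Growth L (fun i => (u i)⁻¹) (-x) where
  pos := by filter_upwards [hu.pos] with i h using inv_pos.mpr h
  lim := by
    refine hu.lim.neg.congr fun i => ?_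
    rw [Real.log_inv, neg_div]

lemma div (hu : Growth L u x) (hv : Growth L v x') : Growth L (fun i => u i / v i) (x - x') := by
  simpa only [div_eq_mul_inv, sub_eq_add_neg] using hu.mul hv.inv

lemma pow (hu : Growth L u x) (k : ℕ) : Growth L (fun i => u i ^ k) (k * x) where
  pos := by filter_upwards [hu.pos] with i h using pow_pos h k
  lim := by
    refine (hu.lim.const_mul (k : ℝ)).congr fun i => ?_
    rw [Real.log_pow, mul_div_assoc]

lemma const (hL : Tendsto L atTop atTop) (hc : 0 < c) : Growth L (fun _ => c) 0 where
  pos := Eventually.of_forall fun _ => hc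
  lim := tendsto_const_nhds.div_atTop hL

lemma const_mul (hL : Tendsto L atTop atTop) (hc : 0 < c) (hu : Growth L u x) :
    Growth L (fun i => c * u i) x := by
  simpa using (const hL hc).mul hu

lemma of_exp (h : Tendsto (fun i => v i / L i) atTop (𝓝 x)) :
    Growth L (fun i => Real.exp (v i)) x where
  pos := Eventually.of_forall fun _ => Real.exp_pos _
  lim := by simpa using h

lemma exp_mul (hL : Tendsto L atTop atTop) (x : ℝ) : Growth L (fun i => Real.exp (x * L i)) x := by
  refine of_exp (tendsto_const_nhds.congr' ?_)
  filter_upwards [hL.eventually_gt_atTop 0] with i hi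
  rw [mul_div_cancel_right₀ _ hi.ne']

lemma tendsto_atTop (hL : Tendsto L atTop atTop) (hu : Growth L u x) (hx : 0 < x) :
    Tendsto u atTop atTop := by
  have h : Tendsto (fun i => Real.log (u i) / L i * L i) atTop atTop := hu.lim.pos_mul_atTop hx hL
  refine (Real.tendsto_exp_atTop.comp h).congr' ?_
  filter_upwards [hu.pos, hL.eventually_gt_atTop 0] with i hi hl
  simp only [Function.comp]
  rw [div_mul_cancel₀ _ hl.ne', Real.exp_log hi]

lemma tendsto_zero (hL : Tendsto L atTop atTop) (hu : Growth L u x) (hx : x < 0) :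
    Tendsto u atTop (𝓝 0) := by
  have h := (hu.inv.tendsto_atTop hL (neg_pos.mpr hx)).inv_tendsto_atTop
  refine h.congr fun i => ?_
  simp

lemma eventually_lt (hL : Tendsto L atTop atTop) (hu : Growth L u x) (hv : Growth L v x')
    (h : x < x') : ∀ᶠ i in atTop, u i < v i := by
  filter_upwards [((hv.div hu).tendsto_atTop hL (by linarith)).eventually_gt_atTop 1, hu.pos]
    with i h1 h2
  rwa [lt_div_iff₀ h2, one_mul] at h1

lemma of_ratio (hL : Tendsto L atTop atTop) (hu : Growth L u x) (hc : 0 < c)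
    (h : Tendsto (fun i => v i / u i) atTop (𝓝 c)) : Growth L v x where
  pos := by
    filter_upwards [hu.pos, h.eventually_const_lt hc] with i h1 h2
    exact (div_pos_iff_of_pos_right h1).mp h2
  lim := by
    have h0 : Tendsto (fun i => Real.log (v i / u i) / L i) atTop (𝓝 0) :=
      (h.log hc.ne').div_atTop hL
    have h1 := h0.add hu.lim
    rw [zero_add] at h1
    refine h1.congr' ?_
    filter_upwards [hu.pos, h.eventually_const_lt hc] with i h1 h2
    rw [← add_div, ← Real.log_mul h2.ne' h1.ne', div_mul_cancel₀ _ h1.ne']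

lemma of_bounds (hL : Tendsto L atTop atTop) (hu : Growth L u x) {C : ℝ} (hc : 0 < c)
    (h₁ : ∀ᶠ i in atTop, c * u i ≤ v i) (h₂ : ∀ᶠ i in atTop, v i ≤ C * u i) : Growth L v x where
  pos := by
    filter_upwards [hu.pos, h₁] with i h h' using (mul_pos hc h).trans_le h'
  lim := by
    have hC : 0 < C := by
      obtain ⟨i, h, h', h''⟩ := (hu.pos.and (h₁.and h₂)).exists
      exact pos_of_mul_pos_left (((mul_pos hc h).trans_le h').trans_le h'') h.le
    refine tendsto_of_tendsto_of_tendsto_of_le_of_le' (const_mul hL hc hu).lim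
      (const_mul hL hC hu).lim ?_ ?_
    · filter_upwards [hu.pos, h₁, hL.eventually_gt_atTop 0] with i h h' hl
      have := mul_pos hc h
      gcongr
    · filter_upwards [hu.pos, h₁, h₂, hL.eventually_gt_atTop 0] with i h h' h'' hl
      have := (mul_pos hc h).trans_le h'
      gcongr

lemma floor (hL : Tendsto L atTop atTop) (hu : Growth L u x) (hx : 0 < x) :
    Growth L (fun i => (⌊u i⌋₊ : ℝ)) x :=
  of_ratio hL hu one_pos ((tendsto_nat_floor_div_atTop (R := ℝ)).comp (hu.tendsto_atTop hL hx))

lemma ceil (hL : Tendsto L atTop atTop) (hu : Growth L u x) (hx : 0 < x) :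
    Growth L (fun i => (⌈u i⌉₊ : ℝ)) x :=
  of_ratio hL hu one_pos ((tendsto_nat_ceil_div_atTop (R := ℝ)).comp (hu.tendsto_atTop hL hx))

lemma self (hL : Tendsto L atTop atTop) : Growth L L 0 where
  pos := hL.eventually_gt_atTop 0
  lim := by
    have h := Real.isLittleO_log_id_atTop.tendsto_div_nhds_zero.comp hL
    exact h

end Growth

end Growth

section Asymptotics

open Topology

variable {L p : ℕ → ℝ} {α ν X Y η : ℝ}

lemma tendsto_log_one_sub_div (hp : Tendsto p atTop (𝓝 0)) (hp0 : ∀ᶠ i in atTop, 0 < p i) :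
    Tendsto (fun i => Real.log (1 - p i) / p i) atTop (𝓝 (-1)) := by
  have hd : HasDerivAt (fun x : ℝ => Real.log (1 - x)) (-1) 0 := by
    have h := ((hasDerivAt_id (0 : ℝ)).const_sub 1).log (by simp)
    simpa using h
  have h := (hasDerivAt_iff_tendsto_slope.mp hd).comp
    (tendsto_nhdsWithin_iff.mpr ⟨hp, hp0.mono fun i hi => hi.ne'⟩)
  refine h.congr fun i => ?_
  simp [slope_def_field]

lemma tendsto_mul_log_one_sub {k : ℕ → ℝ} (hp : Tendsto p atTop (𝓝 0))
    (hp0 : ∀ᶠ i in atTop, 0 < p i) (hk : Tendsto (fun i => p i * k i / L i) atTop (𝓝 X)) :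
    Tendsto (fun i => k i * Real.log (1 - p i) / L i) atTop (𝓝 (-X)) := by
  have h := (tendsto_log_one_sub_div hp hp0).mul hk
  rw [neg_one_mul] at h
  refine h.congr' ?_
  filter_upwards [hp0] with i hi
  field_simp

lemma growth_one_sub_pow {k : ℕ → ℕ} (hp : Tendsto p atTop (𝓝 0))
    (hp0 : ∀ᶠ i in atTop, 0 < p i) (hk : Tendsto (fun i => p i * k i / L i) atTop (𝓝 X)) :
    Growth L (fun i => (1 - p i) ^ k i) (-X) where
  pos := by
    filter_upwards [hp.eventually_lt_const one_pos] with i hi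
    have : 0 < 1 - p i := by linarith
    positivity
  lim := by
    refine (tendsto_mul_log_one_sub hp hp0 hk).congr fun i => ?_
    rw [Real.log_pow]

lemma growth_inv_one_sub_pow {k : ℕ → ℕ} (hp : Tendsto p atTop (𝓝 0))
    (hp0 : ∀ᶠ i in atTop, 0 < p i) (hk : Tendsto (fun i => p i * k i / L i) atTop (𝓝 X)) :
    Growth L (fun i => (1 - p i)⁻¹ ^ k i) X := by
  have h := (growth_one_sub_pow hp hp0 hk).inv
  simpa only [inv_pow, neg_neg] using h

lemma tendsto_smallExp (hL : Tendsto L atTop atTop) {κ l n B s₀ : ℕ → ℕ}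
    (hp : Growth L p (-α)) (hn : Growth L (fun i => (n i : ℝ)) 1)
    (hκ : Growth L (fun i => (κ i : ℝ)) α) (hB : Growth L (fun i => (B i : ℝ)) ν)
    (hq₁ : Growth L (fun i => (1 - p i) ^ κ i) (-X)) (hq₂ : Growth L (fun i => (1 - p i) ^ l i) (-Y))
    (hz : Growth L (fun i => (1 - p i)⁻¹ ^ s₀ i) η) (h₁ : 2 * α - 1 + η < 0)
    (h₂ : 1 - 2 * X + η < 0) (h₃ : α - X < 0) (h₄ : ν - 2 * Y + η < 0) :
    Tendsto (fun i => smallExp (κ i) (l i) (n i) (B i) (s₀ i) (p i)) atTop (𝓝 0) := by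
  have h4 : (0 : ℝ) < 4 := by norm_num
  have hE := Growth.const_mul hL (Real.exp_pos 4) hz
  have hn8 := Growth.const_mul hL (c := 8⁻¹) (by norm_num) hn
  have t1 := ((hκ.mul (Growth.const_mul hL two_pos ((hE.mul hκ).div hn8))).tendsto_zero hL
    (by linarith))
  have t2 := ((hκ.mul (hE.div (hp.mul hn8))).tendsto_zero hL (by linarith))
  have t3 := ((hκ.mul ((hE.pow 2).div ((hp.pow 3).mul (hn8.pow 2)))).tendsto_zero hL
    (by push_cast; linarith))
  have t4 := (((Growth.const_mul hL h4 hn).mul (hq₁.pow 2)).mul hz).tendsto_zero hL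
    (by push_cast; linarith)
  have t5 := ((Growth.const_mul hL h4 hκ).mul hq₁).tendsto_zero hL (by linarith)
  have t6 := (((Growth.const_mul hL h4 hB).mul (hq₂.pow 2)).mul hz).tendsto_zero hL
    (by push_cast; linarith)
  have h := ((t1.add t2).add t3).add ((t4.add t5).add t6)
  simp only [add_zero] at h
  refine h.congr fun i => ?_
  unfold smallExp
  rw [show (n i : ℝ) / 8 = 8⁻¹ * n i by ring]
  ring

/-- Two squares of a bilinear form are dominated by a linear form on the unit square as soon as this
holds at its vertices. -/
lemma sq_le_linear_of_vertices {X g A B u v : ℝ} (hX : 0 ≤ X) (hA : X * g ^ 2 ≤ A) (hB : X ≤ B)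
    (hAB : X * (g + 1) ^ 2 ≤ A + B) (hu : 0 ≤ u) (hu1 : u ≤ 1) (hv : 0 ≤ v) (hv1 : v ≤ 1) :
    X * (g * u + v) ^ 2 ≤ A * u + B * v := by
  have h1 : (g * u + v) ^ 2 ≤ (1 - u) * v ^ 2 + u * (g + v) ^ 2 := by
    nlinarith [mul_nonneg (mul_nonneg hu (sub_nonneg.mpr hu1)) (sq_nonneg g)]
  have h2 : v ^ 2 ≤ v := by nlinarith
  have h3 : (g + v) ^ 2 ≤ (1 - v) * g ^ 2 + v * (g + 1) ^ 2 := by nlinarith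
  calc X * (g * u + v) ^ 2 ≤ X * ((1 - u) * v + u * ((1 - v) * g ^ 2 + v * (g + 1) ^ 2)) := by
        refine mul_le_mul_of_nonneg_left (h1.trans ?_) hX
        have : 0 ≤ 1 - u := by linarith
        gcongr
    _ = (1 - u) * v * X + u * (1 - v) * (X * g ^ 2) + u * v * (X * (g + 1) ^ 2) := by ring
    _ ≤ (1 - u) * v * B + u * (1 - v) * A + u * v * (A + B) := by
        have : 0 ≤ 1 - u := by linarith
        have : 0 ≤ 1 - v := by linarith
        gcongr
    _ = _ := by ring

lemma overlap_weight_le {γ w s₀ n N l k : ℕ} {p X ν α c L δ₁ : ℝ} (hγ : 0 < γ) (hw : 0 < w)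
    (hn : 0 < n) (hN : 0 < N) (hp1 : p < 1) (hL : 0 ≤ L) (hc : 0 ≤ c) (hX : 0 ≤ X)
    (h₁ : (w * (γ + 1) : ℕ) * -Real.log (1 - p) ≤ (X + c) * L)
    (h₂ : Real.log ((w * (γ + 1) : ℕ) / (n / 8)) ≤ (α - 1 + c) * L)
    (h₃ : Real.log ((w * (γ + 1) : ℕ) / N) ≤ (α - ν + c) * L)
    (hs₀ : δ₁ * (w * (γ + 1) : ℕ) ≤ s₀ + 1)
    (hA : (X + c) * γ ≤ 2 * (γ + 1) * (1 - α - 2 * c))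
    (hB : X + c ≤ 2 * (γ + 1) * (ν - α - 2 * c))
    (hAB : (X + c) * (γ + 1) ≤ 2 * (γ * (1 - α - 2 * c) + (ν - α - 2 * c)))
    (hl : l ≤ w * γ) (hk : k ≤ w) (hlk : s₀ < l + k) :
    (1 - p)⁻¹ ^ (l + k).choose 2 * ((((w * (γ + 1) : ℕ) : ℝ) / (n / 8)) ^ l *
      (((w * (γ + 1) : ℕ) : ℝ) / N) ^ k) ≤ Real.exp (-(c * δ₁) * ((w * (γ + 1) : ℕ) * L)) := by
  have hq : 0 < 1 - p := by linarith
  have hwr : (0 : ℝ) < w := by exact_mod_cast hw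
  have hγr : (0 : ℝ) < γ := by exact_mod_cast hγ
  have hnr : (0 : ℝ) < n := by exact_mod_cast hn
  have hNr : (0 : ℝ) < N := by exact_mod_cast hN
  have hκ : ((w * (γ + 1) : ℕ) : ℝ) = w * (γ + 1) := by push_cast; ring
  rw [hκ] at h₁ h₂ h₃ hs₀ ⊢
  have hlog : (1 - p)⁻¹ ^ (l + k).choose 2 * (((w * (γ + 1) : ℝ) / (n / 8)) ^ l *
      ((w * (γ + 1) : ℝ) / N) ^ k) = Real.exp ((l + k).choose 2 * -Real.log (1 - p) +
        (l * Real.log ((w * (γ + 1) : ℝ) / (n / 8)) + k * Real.log ((w * (γ + 1) : ℝ) / N))) := by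
    rw [Real.exp_add, Real.exp_add, Real.exp_nat_mul, Real.exp_nat_mul, Real.exp_nat_mul,
      Real.exp_neg, Real.exp_log hq, Real.exp_log (by positivity), Real.exp_log (by positivity)]
  rw [hlog]
  refine Real.exp_le_exp.mpr ?_
  have hlr : (l : ℝ) ≤ w * γ := by exact_mod_cast hl
  have hkr : (k : ℝ) ≤ w := by exact_mod_cast hk
  have hconv := sq_le_linear_of_vertices (X := X + c) (g := γ)
    (A := 2 * (γ + 1) * (1 - α - 2 * c) * γ) (B := 2 * (γ + 1) * (ν - α - 2 * c))
    (u := l / (w * γ)) (v := k / w) (by positivity)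
    (by nlinarith) hB (by nlinarith) (by positivity) (by rw [div_le_one (by positivity)]; exact hlr)
    (by positivity) (by rw [div_le_one (by positivity)]; exact hkr)
  have hs : (γ : ℝ) * (l / (w * γ)) + k / w = (l + k) / w := by field_simp
  rw [hs] at hconv
  have hquad : (X + c) * (l + k) ^ 2 / (2 * (w * (γ + 1))) ≤
      (1 - α - 2 * c) * l + (ν - α - 2 * c) * k := by
    have h4 := mul_le_mul_of_nonneg_right hconv (show 0 ≤ w / (2 * ((γ : ℝ) + 1)) by positivity)
    calc _ = (X + c) * ((l + k) / w) ^ 2 * (w / (2 * ((γ : ℝ) + 1))) := by field_simp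
      _ ≤ _ := h4
      _ = _ := by field_simp
  have hch : (((l + k).choose 2 : ℕ) : ℝ) * -Real.log (1 - p) ≤
      (X + c) * (l + k) ^ 2 / (2 * (w * (γ + 1))) * L := by
    by_cases hneg : -Real.log (1 - p) ≤ 0
    · have h5 : (((l + k).choose 2 : ℕ) : ℝ) * -Real.log (1 - p) ≤ 0 :=
        mul_nonpos_of_nonneg_of_nonpos (by positivity) hneg
      exact h5.trans (by positivity)
    · rw [not_le] at hneg
      have h6 : (((l + k).choose 2 : ℕ) : ℝ) ≤ (l + k) ^ 2 / 2 := by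
        rw [Nat.cast_choose_two]
        push_cast
        nlinarith [(l.cast_nonneg : (0 : ℝ) ≤ l), (k.cast_nonneg : (0 : ℝ) ≤ k)]
      calc _ ≤ ((l + k) ^ 2 / 2 : ℝ) * -Real.log (1 - p) := by gcongr
        _ = (l + k) ^ 2 / (2 * (w * (γ + 1))) * (w * (γ + 1) * -Real.log (1 - p)) := by
          field_simp
        _ ≤ (l + k) ^ 2 / (2 * (w * (γ + 1))) * ((X + c) * L) :=
          mul_le_mul_of_nonneg_left h₁ (by positivity)
        _ = _ := by ring
  have hsr : δ₁ * (w * (γ + 1)) ≤ l + k := by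
    have : ((s₀ : ℝ) + 1) ≤ l + k := by exact_mod_cast hlk
    linarith
  calc _ ≤ ((1 - α - 2 * c) * l + (ν - α - 2 * c) * k) * L +
        (l * ((α - 1 + c) * L) + k * ((α - ν + c) * L)) := by
        have h7 := mul_le_mul_of_nonneg_right hquad hL
        exact add_le_add (hch.trans h7) (add_le_add (mul_le_mul_of_nonneg_left h₂ (by positivity))
          (mul_le_mul_of_nonneg_left h₃ (by positivity)))
    _ = -(c * (l + k) * L) := by ring
    _ ≤ -(c * (δ₁ * (w * (γ + 1))) * L) := by gcongr
    _ = _ := by ring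

lemma eventually_largeRatio_le (hL : Tendsto L atTop atTop) {κ l w n B b m : ℕ → ℕ} {ρ β c : ℝ}
    (hα : 0 < α) (hp : Tendsto p atTop (𝓝 0)) (hp0 : ∀ᶠ i in atTop, 0 < p i)
    (hX : Tendsto (fun i => p i * κ i / L i) atTop (𝓝 X))
    (hn : Growth L (fun i => (n i : ℝ)) 1)
    (hκ : Growth L (fun i => (κ i : ℝ)) α) (hB : Growth L (fun i => (B i : ℝ)) ν)
    (hq₁ : Growth L (fun i => (1 - p i) ^ κ i) (-X)) (hq₂ : Growth L (fun i => (1 - p i) ^ l i) (-Y))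
    (hw : ∀ i, (w i : ℝ) = ρ * κ i) (hρ : 0 < ρ)
    (hm : Tendsto (fun i => (m i : ℝ) / κ i) atTop (𝓝 ρ)) (hb : Growth L (fun i => (b i : ℝ)) β)
    (h₁ : 1 - X < α) (h₂ : ν - Y < α) (hX0 : 0 < X) (hc : 2 * ρ * β < X * ρ ^ 2 + c) :
    ∀ᶠ i in atTop, largeRatio (κ i) (l i) (w i) (n i) (B i) (b i) (m i) (p i)
      (Real.exp (-c * (κ i * L i))) ≤ Real.exp (-L i) ^ 2 := by
  have hκt := hκ.tendsto_atTop hL hα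
  have hκL : Growth L (fun i => κ i * L i) α := by simpa using hκ.mul (Growth.self hL)
  have hinv := hL.inv_tendsto_atTop
  have e1 : Tendsto (fun i => 2 * ((w i * (w i - 1) / 2 : ℝ) * Real.log (1 - p i)) / (κ i * L i))
      atTop (𝓝 (ρ * (ρ * -X))) := by
    have h1 : Tendsto (fun i => p i * (w i - 1) / L i) atTop (𝓝 (ρ * X - 0)) := by
      have h2 : Tendsto (fun i => p i / L i) atTop (𝓝 0) := hp.div_atTop hL
      refine ((hX.const_mul ρ).sub h2).congr fun i => ?_
      rw [hw]; ring
    rw [sub_zero] at h1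
    have h3 := (tendsto_mul_log_one_sub hp hp0 h1).const_mul ρ
    rw [show ρ * -(ρ * X) = ρ * (ρ * -X) by ring] at h3
    refine h3.congr' ?_
    filter_upwards [hκ.pos, hL.eventually_gt_atTop 0] with i hi hl
    rw [show 2 * ((w i * (w i - 1) / 2 : ℝ) * Real.log (1 - p i)) =
      w i * ((w i - 1 : ℝ) * Real.log (1 - p i)) by ring, hw]
    field_simp
  have e2 : Tendsto (fun i => (4 * n i * (1 - p i) ^ κ i + 4 * κ i * (1 - p i) ^ κ i +
      4 * B i * (1 - p i) ^ l i + 4 * κ i) / (κ i * L i)) atTop (𝓝 0) := by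
    have h4 : (0 : ℝ) < 4 := by norm_num
    have a1 := (((Growth.const_mul hL h4 hn).mul hq₁).div hκL).tendsto_zero hL (by linarith)
    have a2 := (((Growth.const_mul hL h4 hκ).mul hq₁).div hκL).tendsto_zero hL (by linarith)
    have a3 := (((Growth.const_mul hL h4 hB).mul hq₂).div hκL).tendsto_zero hL (by linarith)
    have a4 := hinv.const_mul 4
    have h := ((a1.add a2).add a3).add a4
    simp only [add_zero, mul_zero] at h
    refine h.congr' ?_
    filter_upwards [hκ.pos, hL.eventually_gt_atTop 0] with i hi hl
    simp only [Pi.inv_apply]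
    field_simp
  have e3 : Tendsto (fun i => (κ i * Real.log 2) / (κ i * L i)) atTop (𝓝 0) := by
    have h : Tendsto (fun i => Real.log 2 / L i) atTop (𝓝 0) := tendsto_const_nhds.div_atTop hL
    refine h.congr' ?_
    filter_upwards [hκ.pos] with i hi
    rw [mul_div_mul_left _ _ hi.ne']
  have e4 : Tendsto (fun i => (w i * Real.log 4 + Real.log 4) / (κ i * L i)) atTop (𝓝 0) := by
    have h : Tendsto (fun i => ρ * (Real.log 4 / L i)) atTop (𝓝 (ρ * 0)) :=
      (tendsto_const_nhds.div_atTop hL).const_mul ρ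
    have h' : Tendsto (fun i => Real.log 4 / (κ i * L i)) atTop (𝓝 0) :=
      tendsto_const_nhds.div_atTop (hκL.tendsto_atTop hL hα)
    have h2 := h.add h'
    rw [mul_zero, add_zero] at h2
    refine h2.congr' ?_
    filter_upwards [hκ.pos, hL.eventually_gt_atTop 0] with i hi hl
    rw [hw]
    field_simp
  have e5 : Tendsto (fun i => (2 * m i * Real.log (2 * b i)) / (κ i * L i)) atTop
      (𝓝 (2 * ρ * β)) := by
    have h := (hm.const_mul 2).mul (Growth.const_mul hL two_pos hb).lim
    refine h.congr fun i => ?_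
    rw [← div_mul_div_comm, mul_div_assoc]
  have e6 : Tendsto (fun i => (-c * (κ i * L i)) / (κ i * L i)) atTop (𝓝 (-c)) := by
    refine tendsto_const_nhds.congr' ?_
    filter_upwards [hκL.pos] with i hi
    rw [mul_div_cancel_right₀ _ hi.ne']
  have e := ((e1.add (e6.add e2)).add e3).add (e4.add e5)
  set y := ρ * (ρ * -X) + (-c + 0) + 0 + (0 + 2 * ρ * β) with hy
  have hy0 : y < y / 2 := by rw [hy]; nlinarith
  filter_upwards [e.eventually_lt_const hy0, hκL.pos, hκt.eventually_gt_atTop (-4 / y),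
    hL.eventually_gt_atTop 0, hp.eventually_lt_const one_pos, hb.pos] with i h hκLi hκi hl hp1 hbi
  have hyn : y < 0 := by linarith
  have hq : 0 < 1 - p i := by linarith
  rw [← add_div, ← add_div, ← add_div, ← add_div, ← add_div, div_lt_iff₀ hκLi] at h
  have hE : largeRatio (κ i) (l i) (w i) (n i) (B i) (b i) (m i) (p i)
      (Real.exp (-c * (κ i * L i))) = Real.exp (2 * ((w i * (w i - 1) / 2 : ℝ) *
        Real.log (1 - p i)) + (-c * (κ i * L i) + (4 * n i * (1 - p i) ^ κ i +
        4 * κ i * (1 - p i) ^ κ i + 4 * B i * (1 - p i) ^ l i + 4 * κ i)) + κ i * Real.log 2 +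
        (w i * Real.log 4 + Real.log 4 + 2 * m i * Real.log (2 * b i))) := by
    unfold largeRatio
    generalize 4 * (n i : ℝ) * (1 - p i) ^ κ i + 4 * κ i * (1 - p i) ^ κ i +
      4 * B i * (1 - p i) ^ l i + 4 * κ i = G
    simp only [Real.exp_add]
    rw [← Nat.cast_choose_two, show (2 : ℝ) * (((w i).choose 2 : ℕ) * Real.log (1 - p i)) =
        Real.log (((1 - p i) ^ (w i).choose 2) ^ 2) by rw [Real.log_pow, Real.log_pow]; norm_num,
      show (2 * m i * Real.log (2 * b i) : ℝ) = Real.log ((2 * b i) ^ (2 * m i)) by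
        rw [Real.log_pow]; push_cast; ring, ← Real.log_pow, ← Real.log_pow,
      Real.exp_log (by positivity), Real.exp_log (by positivity), Real.exp_log (by positivity),
      Real.exp_log (by positivity), Real.exp_log (by positivity)]
    ring
  rw [hE, ← Real.exp_nat_mul]
  refine Real.exp_le_exp.mpr (h.le.trans ?_)
  rw [div_lt_iff_of_neg hyn] at hκi
  push_cast
  nlinarith

/-- The exponents chosen in the asymptotic analysis. -/
lemma exists_exponents {α X : ℝ} {γ : ℕ} (hα0 : 0 < α) (hα : α < 1 / 2) (hγ : 3 ≤ γ)
    (hγα : α < (γ + 1) * (1 - 2 * α)) (hX₁ : 1 - α < X) (hX₂ : X < 2 * (1 - α - α / (γ + 1))) :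
    ∃ ν c δ₁ δ : ℝ, 0 < c ∧ 0 < δ₁ ∧ 0 < δ ∧ ν < 1 - α ∧ α + X / (2 * (γ + 1)) + δ < ν ∧
      ν - X * γ / (γ + 1) < α ∧ (X + c) * γ ≤ 2 * (γ + 1) * (1 - α - 2 * c) ∧
      X + c ≤ 2 * (γ + 1) * (ν - α - 2 * c) ∧
      (X + c) * (γ + 1) ≤ 2 * (γ * (1 - α - 2 * c) + (ν - α - 2 * c)) ∧
      2 * α - 1 + X * δ₁ < 0 ∧ 1 - 2 * X + X * δ₁ < 0 ∧ ν - 2 * (X * γ / (γ + 1)) + X * δ₁ < 0 ∧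
      2 * (1 / (γ + 1)) * δ < c * δ₁ ∧ δ < 4 * α := by
  have hγr : (3 : ℝ) ≤ γ := by exact_mod_cast hγ
  have hg : (0 : ℝ) < γ + 1 := by positivity
  have hX0 : 0 < X := by linarith
  have hk : X * (γ + 1) < 2 * ((1 - α) * (γ + 1) - α) := by
    have h := mul_lt_mul_of_pos_right hX₂ hg
    have e : 2 * (1 - α - α / (γ + 1)) * ((γ : ℝ) + 1) = 2 * ((1 - α) * (γ + 1) - α) := by
      field_simp
    linarith
  have hXa : X < 2 * (1 - α) := by
    have : 0 < α / (γ + 1) := by positivity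
    linarith
  set u := X / (2 * ((γ : ℝ) + 1)) with hu
  have hu' : X = 2 * (γ + 1) * u := by rw [hu]; field_simp
  have hu0 : 0 < u := by positivity
  have hY : X * γ / ((γ : ℝ) + 1) = 2 * γ * u := by rw [hu]; field_simp
  rw [hY]
  obtain ⟨ν, hν₁, hν₂⟩ : ∃ ν, max (α + u) ((γ + 1) * X / 2 - (1 - α) * γ + α) < ν ∧
      ν < min (1 - α) (α + 2 * γ * u) := by
    refine exists_between (max_lt (lt_min ?_ ?_) (lt_min ?_ ?_))
    · have h1 : ((γ : ℝ) + 1) * (X * 1) < (γ + 1) * (2 * (γ + 1) * (1 - 2 * α)) := by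
        nlinarith
      have h2 : X < 2 * (γ + 1) * (1 - 2 * α) := by
        have := lt_of_mul_lt_mul_left h1 hg.le
        linarith
      have : u < 1 - 2 * α := by
        rw [hu, div_lt_iff₀ (by positivity)]
        linarith
      linarith
    · nlinarith
    · nlinarith
    · have h1 : X * (((γ : ℝ) + 1) / 2) - 2 * γ * u < (1 - α) * γ := by
        have h2 : X * (((γ : ℝ) + 1) / 2) - 2 * γ * u = u * (γ ^ 2 + 1) := by rw [hu']; ring
        have h3 : u * (γ + 1) < 1 - α := by linarith
        have h4 : u * (γ + 1) * (γ ^ 2 + 1) < (1 - α) * (γ ^ 2 + 1) := by gcongr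
        have h5 : (1 - α) * (γ ^ 2 + 1 : ℝ) ≤ (1 - α) * γ * (γ + 1) := by
          nlinarith
        rw [h2]
        refine lt_of_mul_lt_mul_right (a := (γ : ℝ) + 1) ?_ hg.le
        nlinarith
      linarith
  obtain ⟨hν1, hν2⟩ := max_lt_iff.mp hν₁
  obtain ⟨hν3, hν4⟩ := lt_min_iff.mp hν₂
  have pos : ∀ᶠ x in 𝓝[>] (0 : ℝ), 0 < x := self_mem_nhdsWithin
  have ev : ∀ {f h : ℝ → ℝ}, Continuous f → Continuous h → f 0 < h 0 →
      ∀ᶠ x in 𝓝[>] (0 : ℝ), f x < h x := fun hf hh hlt =>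
    nhdsWithin_le_nhds (hf.continuousAt.eventually_lt hh.continuousAt hlt)
  obtain ⟨c, hc, c1, c2, c3⟩ := (pos.and
    ((ev (f := fun c => (X + c) * γ) (h := fun c => 2 * (γ + 1) * (1 - α - 2 * c))
      (by fun_prop) (by fun_prop) (by nlinarith)).and
    ((ev (f := fun c => X + c) (h := fun c => 2 * (γ + 1) * (ν - α - 2 * c))
      (by fun_prop) (by fun_prop) (by nlinarith)).and
    (ev (f := fun c => (X + c) * (γ + 1))
      (h := fun c => 2 * (γ * (1 - α - 2 * c) + (ν - α - 2 * c)))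
      (by fun_prop) (by fun_prop) (by nlinarith))))).exists
  obtain ⟨δ₁, hδ₁, d1, d2, d3⟩ := (pos.and
    ((ev (f := fun d => 2 * α - 1 + X * d) (h := fun _ => 0)
      (by fun_prop) (by fun_prop) (by linarith)).and
    ((ev (f := fun d => 1 - 2 * X + X * d) (h := fun _ => 0)
      (by fun_prop) (by fun_prop) (by linarith)).and
    (ev (f := fun d => ν - 2 * (2 * γ * u) + X * d) (h := fun _ => 0)
      (by fun_prop) (by fun_prop) (by nlinarith))))).exists
  obtain ⟨δ, hδ, e1, e2, e3⟩ := (pos.and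
    ((ev (f := fun d => α + u + d) (h := fun _ => ν)
      (by fun_prop) (by fun_prop) (by linarith)).and
    ((ev (f := fun d => 2 * (1 / ((γ : ℝ) + 1)) * d) (h := fun _ => c * δ₁)
      (by fun_prop) (by fun_prop) (by simpa using mul_pos hc hδ₁)).and
    (ev (f := fun d => d) (h := fun _ => 4 * α)
      (by fun_prop) (by fun_prop) (by linarith))))).exists
  exact ⟨ν, c, δ₁, δ, hc, hδ₁, hδ, hν3, e1, by linarith, c1.le, c2.le, c3.le, d1, d2, d3, e2, e3⟩

lemma prob_le_one {n : ℕ} {p : ℝ} (hp0 : 0 ≤ p) (hp1 : p ≤ 1) (Q : SimpleGraph (Fin n) → Prop) :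
    prob n p Q ≤ 1 := by
  rw [prob_eq_pr]
  exact pr_le_one hp0 hp1 _

lemma tendsto_failProb {α δ : ℝ} {γ : ℕ} {L p : ℕ → ℝ} {n a N m s₀ r t₀ : ℕ → ℕ}
    (hα0 : 0 < α) (hα : α < 1 / 2) (hL : Tendsto L atTop atTop) (hp : Growth L p (-α))
    (hn : Growth L (fun i => (n i : ℝ)) 1) (ha : Growth L (fun i => (a i : ℝ)) 0)
    (ha1 : ∀ i, 1 ≤ a i)
    (hr : Growth L (fun i => (r i : ℝ)) 1) (ht₀ : Growth L (fun i => (t₀ i : ℝ)) (α - δ / 8))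
    (hm : Growth L (fun i => (m i : ℝ)) α) (hδ : δ < 4 * α)
    (hκ : Growth L (fun i => ((ωr 4 (a i) * (γ + 1) : ℕ) : ℝ)) α)
    (hpa : ∀ᶠ i in atTop, 1 / 2 ≤ (1 - p i) ^ a i)
    (hs : Tendsto (fun i => smallExp (ωr 4 (a i) * (γ + 1)) (ωr 4 (a i) * γ) (n i) (a i * N i)
      (s₀ i) (p i)) atTop (𝓝 0)) :
    Tendsto (fun i => failProb γ (a i) (n i) (N i) (m i) (s₀ i) (r i) (p i) (t₀ i / 2)
      (Real.exp (-L i))) atTop (𝓝 0) := by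
  have hp' := hp.tendsto_zero hL (by linarith)
  have hx : Growth L (fun i => 2⁻¹ * (p i * r i)) (1 - α) := by
    have h := Growth.const_mul hL (c := 2⁻¹) (by norm_num) (hp.mul hr)
    rwa [show -α + 1 = 1 - α by ring] at h
  have T1 : Tendsto (fun i => (a i : ℝ) * (1 - p i * (1 - p i) ^ a i) ^ r i) atTop (𝓝 0) := by
    have h := (Real.tendsto_pow_mul_exp_neg_atTop_nhds_zero 1).comp
      (hx.tendsto_atTop hL (by linarith))
    refine tendsto_of_tendsto_of_tendsto_of_le_of_le' tendsto_const_nhds h ?_ ?_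
    · filter_upwards [hp'.eventually_lt_const one_pos, hp.pos] with i h1 h2
      have h3 : (1 - p i) ^ a i ≤ 1 := pow_le_one₀ (by linarith) (by linarith)
      have h4 : 0 ≤ 1 - p i * (1 - p i) ^ a i := by nlinarith
      positivity
    · filter_upwards [hp'.eventually_lt_const one_pos, hp.pos, hpa,
        ha.eventually_lt hL hx (by linarith)] with i h1 h2 h3 h4
      have h5 : (1 - p i) ^ a i ≤ 1 := pow_le_one₀ (by linarith) (by linarith)
      have h6 : 0 ≤ 1 - p i * (1 - p i) ^ a i := by nlinarith
      have h7 : 1 - p i * (1 - p i) ^ a i ≤ Real.exp (-(2⁻¹ * p i)) := by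
        have := Real.add_one_le_exp (-(2⁻¹ * p i))
        nlinarith
      simp only [Function.comp, pow_one]
      calc _ ≤ (2⁻¹ * (p i * r i)) * Real.exp (-(2⁻¹ * p i)) ^ r i := by gcongr
        _ = _ := by rw [← Real.exp_nat_mul]; congr 2; ring
  have T2 : Tendsto (fun i => ((a i : ℝ) + 1) * (16 / (n i * p i))) atTop (𝓝 0) := by
    have h1 : Growth L (fun i => (a i : ℝ) + 1) 0 := by
      refine Growth.of_bounds hL ha (C := 2) one_pos (Eventually.of_forall fun i => ?_)
        (Eventually.of_forall fun i => ?_)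
      · linarith
      · have : (1 : ℝ) ≤ a i := by exact_mod_cast ha1 i
        linarith
    exact (h1.mul ((Growth.const hL (c := 16) (by norm_num)).div (hn.mul hp))).tendsto_zero hL
      (by linarith)
  have T3 : Tendsto (fun i => 2 * Real.exp (-((t₀ i : ℝ) / 2) ^ 2 / (2 * m i))) atTop (𝓝 0) := by
    have h1 := ((Growth.const_mul hL (c := 8⁻¹) (by norm_num) (ht₀.pow 2)).div hm).tendsto_atTop hL
      (by push_cast; linarith)
    have h2 := (Real.tendsto_exp_neg_atTop_nhds_zero.comp h1).const_mul 2
    rw [mul_zero] at h2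
    refine h2.congr fun i => ?_
    simp only [Function.comp]
    congr 2
    ring
  have Tε : Tendsto (fun i => Real.exp (-L i)) atTop (𝓝 0) :=
    Real.tendsto_exp_neg_atTop_nhds_zero.comp hL
  have T5 : Tendsto (fun i => ((ωr 4 (a i) * (γ + 1) : ℕ) : ℝ) ^ 2 / ((n i : ℝ) / 8)) atTop
      (𝓝 0) := by
    have h := ((Growth.const_mul hL (c := 8) (by norm_num) (hκ.pow 2)).div hn).tendsto_zero hL
      (by push_cast; linarith)
    refine h.congr fun i => ?_
    rw [div_div_eq_mul_div, mul_comm]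
  have T6 := ((T5.const_sub 1).pow 2).div ((Real.continuous_exp.tendsto _ |>.comp hs).add Tε)
    (by simp)
  have h := (T1.add T2).add ((T3.add Tε).add (T6.const_sub 1))
  simp only [Function.comp, Real.exp_zero] at h
  norm_num at h
  refine h.congr fun i => ?_
  unfold failProb
  push_cast
  rfl

set_option maxHeartbeats 2000000 in
lemma tendsto_prob_dominating_copy {α X : ℝ} {γ : ℕ} {n a : ℕ → ℕ} (hα0 : 0 < α) (hα : α < 1 / 2)
    (hγ : 3 ≤ γ) (hγα : α < (γ + 1) * (1 - 2 * α)) (hn : Tendsto n atTop atTop)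
    (ha1 : ∀ i, 1 ≤ a i) (ha : Growth (fun i => Real.log (n i)) (fun i => (a i : ℝ)) 0)
    (hX : Tendsto (fun i => (n i : ℝ) ^ (-α) * (ωr 4 (a i) * (γ + 1) : ℕ) / Real.log (n i)) atTop
      (𝓝 X)) (hX₁ : 1 - α < X) (hX₂ : X < 2 * (1 - α - α / (γ + 1))) :
    Tendsto (fun i => prob (n i) ((n i : ℝ) ^ (-α)) fun G => ∃ s : Set (Fin (n i)),
      IsInducedCopy (WG γ (a i)) G s ∧ ∀ v ∉ s, ∃ u ∈ s, G.Adj v u) atTop (𝓝 1) := by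
  obtain ⟨ν, c, δ₁, δ, hc, hδ₁, hδ, hν1, hν2, hν3, hA, hB, hAB, hη1, hη2, hη3, hδc, hδα⟩ :=
    exists_exponents hα0 hα hγ hγα hX₁ hX₂
  set L : ℕ → ℝ := fun i => Real.log (n i) with hLdef
  set p : ℕ → ℝ := fun i => (n i : ℝ) ^ (-α) with hpdef
  have hX0 : 0 < X := by linarith
  have hγr : (3 : ℝ) ≤ γ := by exact_mod_cast hγ
  have hg : (0 : ℝ) < γ + 1 := by positivity
  set u := X / (2 * ((γ : ℝ) + 1)) with hu
  have hu0 : 0 < u := by positivity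
  set ρ : ℝ := 1 / (γ + 1) with hρ
  have hρ0 : 0 < ρ := by positivity
  have huρ : ρ * X = 2 * u := by rw [hu, hρ]; field_simp
  have hnt : Tendsto (fun i => (n i : ℝ)) atTop atTop := tendsto_natCast_atTop_atTop.comp hn
  have hL : Tendsto L atTop atTop := Real.tendsto_log_atTop.comp hnt
  have hnG : Growth L (fun i => (n i : ℝ)) 1 := by
    refine ⟨hnt.eventually_gt_atTop 0, tendsto_const_nhds.congr' ?_⟩
    filter_upwards [hL.eventually_gt_atTop 0] with i hi
    exact (div_self hi.ne').symm
  have hpG : Growth L p (-α) := by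
    refine ⟨hnG.pos.mono fun i hi => Real.rpow_pos_of_pos hi _, ?_⟩
    refine (hnG.lim.const_mul (-α)).congr' ?_ |>.trans_eq (by rw [mul_one])
    filter_upwards [hnG.pos] with i hi
    rw [hpdef, Real.log_rpow hi, mul_div_assoc]
  have hp := hpG.tendsto_zero hL (by linarith)
  set κ : ℕ → ℕ := fun i => ωr 4 (a i) * (γ + 1) with hκdef
  set w : ℕ → ℕ := fun i => ωr 4 (a i) with hwdef
  have hκG : Growth L (fun i => (κ i : ℝ)) α := by
    have h1 := (Growth.self hL).div hpG
    rw [zero_sub, neg_neg] at h1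
    refine h1.of_ratio hL hX0 (hX.congr fun i => ?_)
    rw [div_div_eq_mul_div, mul_comm]
  have hwκ : ∀ i, (w i : ℝ) = ρ * κ i := fun i => by
    rw [hρ]
    simp only [hκdef, hwdef]
    push_cast
    field_simp
  have hwG : Growth L (fun i => (w i : ℝ)) α := by
    simpa only [hwκ] using Growth.const_mul hL hρ0 hκG
  set N : ℕ → ℕ := fun i => ⌊Real.exp (ν * L i)⌋₊ with hN
  have hNG : Growth L (fun i => (N i : ℝ)) ν :=
    (Growth.exp_mul hL ν).floor hL (by linarith)
  set b : ℕ → ℕ := fun i => ⌈Real.exp ((u + δ) * L i)⌉₊ with hb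
  have hbG : Growth L (fun i => (b i : ℝ)) (u + δ) :=
    (Growth.exp_mul hL (u + δ)).ceil hL (by linarith)
  set t₀ : ℕ → ℕ := fun i => ⌈w i * Real.exp (-δ / 8 * L i)⌉₊ with ht₀
  have htG : Growth L (fun i => (t₀ i : ℝ)) (α - δ / 8) := by
    have h := (hwG.mul (Growth.exp_mul hL (-δ / 8))).ceil hL (by linarith)
    rwa [show α + -δ / 8 = α - δ / 8 by ring] at h
  set m : ℕ → ℕ := fun i => w i + a i * t₀ i with hm
  have hmκ : Tendsto (fun i => (m i : ℝ) / κ i) atTop (𝓝 ρ) := by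
    have h1 := ((ha.mul htG).div hκG).tendsto_zero hL (by linarith)
    have h2 := h1.const_add ρ
    rw [add_zero] at h2
    refine h2.congr' ?_
    filter_upwards [hκG.pos] with i hi
    have : (m i : ℝ) = ρ * κ i + a i * t₀ i := by
      rw [← hwκ]
      simp only [hm]
      push_cast
      ring
    rw [this, add_div, mul_div_cancel_right₀ _ hi.ne']
  have hmG : Growth L (fun i => (m i : ℝ)) α := hκG.of_ratio hL hρ0 hmκ
  have hqm : Growth L (fun i => (1 - p i) ^ m i) (-(2 * u)) := by
    refine growth_one_sub_pow hp hpG.pos ?_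
    have h := hX.mul hmκ
    rw [mul_comm X, huρ] at h
    refine h.congr' ?_
    filter_upwards [hκG.pos] with i hi
    simp only [hpdef, hLdef, hκdef] at hi ⊢
    field_simp
  set y : ℕ → ℝ := fun i => (√((1 - p i) ^ m i))⁻¹ with hy
  have hyG : Growth L y u := by
    refine ⟨hqm.pos.mono fun i hi => inv_pos.mpr (Real.sqrt_pos.mpr hi), ?_⟩
    have h := hqm.lim.const_mul (-(1 / 2))
    rw [show -(1 / 2) * -(2 * u) = u by ring] at h
    refine h.congr' ?_
    filter_upwards [hqm.pos] with i hi
    rw [hy, Real.log_inv, Real.log_sqrt hi.le]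
    ring
  set s₀ : ℕ → ℕ := fun i => ⌊δ₁ * κ i⌋₊ with hs₀
  have hz : Growth L (fun i => (1 - p i)⁻¹ ^ s₀ i) (X * δ₁) := by
    refine growth_inv_one_sub_pow hp hpG.pos ?_
    have h := hX.mul ((tendsto_nat_floor_mul_div_atTop hδ₁.le).comp (hκG.tendsto_atTop hL hα0))
    refine h.congr' ?_
    filter_upwards [hκG.pos] with i hi
    simp only [hpdef, hLdef, hκdef, hs₀, Function.comp] at hi ⊢
    field_simp
  set r : ℕ → ℕ := fun i => ⌊(n i : ℝ) / (2 * a i)⌋₊ with hr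
  have hrG : Growth L (fun i => (r i : ℝ)) 1 := by
    have h := hnG.div (Growth.const_mul hL two_pos ha)
    rw [sub_zero] at h
    exact h.floor hL one_pos
  have hq₁ : Growth L (fun i => (1 - p i) ^ κ i) (-X) := growth_one_sub_pow hp hpG.pos hX
  set Y := X * γ / ((γ : ℝ) + 1) with hY
  have hY0 : 0 < Y := by positivity
  have hq₂ : Growth L (fun i => (1 - p i) ^ (w i * γ)) (-Y) := by
    refine growth_one_sub_pow hp hpG.pos ?_
    have h := hX.mul_const ((γ : ℝ) * ρ)
    rw [show X * (γ * ρ) = Y by rw [hρ, hY]; ring] at h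
    refine h.congr fun i => ?_
    change p i * κ i / L i * (γ * ρ) = p i * ((w i * γ : ℕ) : ℝ) / L i
    have e : ((w i * γ : ℕ) : ℝ) = ρ * κ i * γ := by rw [← hwκ]; exact Nat.cast_mul _ _
    rw [e]
    ring
  have hBG : Growth L (fun i => ((a i * N i : ℕ) : ℝ)) ν := by
    simpa using ha.mul hNG
  have hpa : ∀ᶠ i in atTop, 1 / 2 ≤ (1 - p i) ^ a i := by
    have h := (ha.mul hpG).eventually_lt hL (Growth.const hL (c := 1 / 2) (by norm_num))
      (by linarith)
    filter_upwards [h, hp.eventually_lt_const one_pos] with i h1 h2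
    have h3 := one_add_mul_le_pow (a := -p i) (by linarith) (a i)
    rw [← sub_eq_add_neg] at h3
    linarith
  have hs := tendsto_smallExp hL hpG hnG hκG hBG hq₁ hq₂ hz hη1 hη2 (by linarith) hη3
  have hfail := tendsto_failProb hα0 hα hL hpG hnG ha ha1 hrG htG hmG hδα hκG hpa hs
  have hlow := hfail.const_sub 1
  rw [sub_zero] at hlow
  refine tendsto_of_tendsto_of_tendsto_of_le_of_le' hlow tendsto_const_nhds ?_ ?_
  swap
  · filter_upwards [hpG.pos, hp.eventually_lt_const one_pos] with i h1 h2
    exact prob_le_one h1.le h2.le _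
  have hLR := eventually_largeRatio_le (c := c * δ₁) hL hα0 hp hpG.pos hX hnG hκG hBG hq₁ hq₂ hwκ
    hρ0 hmκ hbG (by linarith) (by linarith) hX0 (by nlinarith)
  have E₁ : ∀ᶠ i in atTop, (κ i : ℝ) * -Real.log (1 - p i) ≤ (X + c) * L i := by
    have h := (tendsto_mul_log_one_sub hp hpG.pos hX).neg
    rw [neg_neg] at h
    filter_upwards [h.eventually_lt_const (show X < X + c by linarith),
      hL.eventually_gt_atTop 0] with i h1 h2
    rw [← neg_div, div_lt_iff₀ h2] at h1
    linarith
  have hratio : ∀ {v : ℕ → ℝ} {x : ℝ}, Growth L v x →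
      ∀ᶠ i in atTop, Real.log (v i) ≤ (x + c) * L i := by
    intro v x hv
    filter_upwards [hv.lim.eventually_lt_const (show x < x + c by linarith),
      hL.eventually_gt_atTop 0] with i h1 h2
    rw [div_lt_iff₀ h2] at h1
    exact h1.le
  have E₂ := hratio (hκG.div (Growth.const_mul hL (c := 8⁻¹) (by norm_num) hnG))
  have E₃ := hratio (hκG.div hNG)
  have E₄ := hNG.eventually_lt hL (Growth.const_mul hL (c := 8⁻¹) (by norm_num) (hnG.mul hpG))
    (by linarith)
  have E₅ := (hmG.mul hbG).eventually_lt hL hNG (by linarith)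
  have E₆ := (Growth.const_mul hL two_pos ((hmG.pow 2).mul hyG)).eventually_lt hL
    (Growth.const_mul hL (c := 4⁻¹) (by norm_num) ((htG.pow 2).mul hbG)) (by push_cast; linarith)
  have E₇ := (Growth.const_mul hL two_pos hwG).eventually_lt hL hNG (by linarith)
  have E₈ : ∀ᶠ i in atTop, 7 ≤ p i * κ i := by
    filter_upwards [(hX.pos_mul_atTop hX0 hL).eventually_ge_atTop 7, hL.eventually_gt_atTop 0]
      with i h1 h2
    rwa [div_mul_cancel₀ _ h2.ne'] at h1
  have E₉ := hq₁.eventually_lt hL (Growth.const hL (c := 1 / 2) (by norm_num)) (by linarith)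
  have E₁₀ := hq₂.eventually_lt hL (Growth.const hL (c := 1 / 2) (by norm_num)) (by linarith)
  have E₁₁ := (hκG.pow 2).eventually_lt hL (Growth.const_mul hL (c := 8⁻¹) (by norm_num) hnG)
    (by push_cast; linarith)
  filter_upwards [hLR, E₁, E₂, E₃, E₄, E₅, E₆, E₇, E₈, E₉, E₁₀, E₁₁, hpG.pos,
    hp.eventually_lt_const one_pos, hnG.pos, hpa, hbG.pos, hqm.pos, hwG.pos, hNG.pos,
    hL.eventually_gt_atTop 0] with i iLR i₁ i₂ i₃ i₄ i₅ i₆ i₇ i₈ i₉ i₁₀ i₁₁ ip0 ip1 in0 ipa ib iq iw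
      iN iL
  have in0' : 0 < n i := by exact_mod_cast in0
  have ia : (0 : ℝ) < a i := by exact_mod_cast ha1 i
  have iq1 : (1 - p i) ^ m i ≤ 1 := pow_le_one₀ (by linarith) (by linarith)
  refine prob_dominating_copy_ge (b := b i) (t₀ := t₀ i) (y := y i)
    (M₀ := Real.exp (-(c * δ₁) * (κ i * L i))) hγ (ha1 i) ip0 ip1 in0' ?_ ipa ?_ rfl ?_
    (by exact_mod_cast ib) ?_ ?_ (by positivity) (by linarith) ?_ ?_ i₈ i₉.le i₁₀.le ?_
    (Real.exp_pos _) ?_ (Real.exp_pos _) iLR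
  · have h1 := Nat.floor_le (show 0 ≤ (n i : ℝ) / (2 * a i) by positivity)
    rw [le_div_iff₀ (by positivity)] at h1
    have h2 : 2 * ((a i : ℝ) * (r i : ℝ)) ≤ n i := by
      calc _ = (r i : ℝ) * (2 * a i) := by ring
        _ ≤ _ := h1
    exact_mod_cast h2
  · linarith
  · exact_mod_cast i₅.le
  · exact (one_le_inv₀ (Real.sqrt_pos.mpr iq)).mpr (Real.sqrt_le_one.mpr iq1)
  · simp only [hy]
    rw [inv_pow, Real.sq_sqrt iq.le, inv_mul_cancel₀ iq.ne']
  · linarith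
  · exact_mod_cast i₇.le
  · linarith
  · intro l k hl hk hlk
    refine overlap_weight_le (by omega) (by exact_mod_cast iw) in0' (by exact_mod_cast iN) ip1 iL.le
      hc.le hX0.le i₁ ?_ i₃ ?_ hA hB hAB hl hk hlk
    · rw [show (n i : ℝ) / 8 = 8⁻¹ * n i by ring]
      exact i₂
    · exact (Nat.lt_floor_add_one _).le

lemma growth_rpow_neg {n : ℕ → ℕ} (α : ℝ) (hn : Tendsto n atTop atTop) :
    Growth (fun i => Real.log (n i)) (fun i => (n i : ℝ) ^ (-α)) (-α) := by
  have hnt : Tendsto (fun i => (n i : ℝ)) atTop atTop := tendsto_natCast_atTop_atTop.comp hn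
  refine ⟨(hnt.eventually_gt_atTop 0).mono fun i hi => Real.rpow_pos_of_pos hi _,
    tendsto_const_nhds.congr' ?_⟩
  filter_upwards [hnt.eventually_gt_atTop 1] with i hi
  rw [Real.log_rpow (by linarith), mul_div_cancel_right₀ _ (Real.log_pos hi).ne']

lemma three_mul_ωr_four_add_one (a : ℕ) : 3 * ωr 4 a + 1 = 4 ^ a := by
  induction a with
  | zero => simp [ωr]
  | succ a ih => rw [ωr_four_succ, pow_succ, ← ih]; ring

lemma le_ωr_four (a : ℕ) : a ≤ ωr 4 a := by
  induction a with
  | zero => simp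
  | succ a ih => rw [ωr_four_succ]; omega

lemma tendsto_tree_size {α X : ℝ} {γ : ℕ} {n a : ℕ → ℕ} (hα0 : 0 < α)
    (hn : Tendsto n atTop atTop) (ha1 : ∀ i, 1 ≤ a i) (hX0 : 0 < X)
    (hX : Tendsto (fun i => (n i : ℝ) ^ (-α) * (a i + (ωr 4 (a i) * (γ + 1) : ℕ)) /
      Real.log (n i)) atTop (𝓝 X)) :
    Growth (fun i => Real.log (n i)) (fun i => (a i : ℝ)) 0 ∧
      Tendsto (fun i => (n i : ℝ) ^ (-α) * (ωr 4 (a i) * (γ + 1) : ℕ) / Real.log (n i)) atTop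
        (𝓝 X) := by
  set L : ℕ → ℝ := fun i => Real.log (n i) with hLdef
  have hL : Tendsto L atTop atTop :=
    Real.tendsto_log_atTop.comp (tendsto_natCast_atTop_atTop.comp hn)
  have hp := growth_rpow_neg α hn
  set p : ℕ → ℝ := fun i => (n i : ℝ) ^ (-α) with hpdef
  have hs : Growth L (fun i => (a i : ℝ) + (ωr 4 (a i) * (γ + 1) : ℕ)) α := by
    have h1 := (Growth.self hL).div hp
    rw [zero_sub, neg_neg] at h1
    refine h1.of_ratio hL hX0 (hX.congr fun i => ?_)
    rw [div_div_eq_mul_div, mul_comm]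
  have hg : (1 : ℝ) ≤ γ + 1 := by simp
  have hpow : Growth L (fun i => (4 : ℝ) ^ a i) α := by
    refine hs.of_bounds hL (c := 1 / (γ + 1)) (C := 4) (by positivity)
      (Eventually.of_forall fun i => ?_) (Eventually.of_forall fun i => ?_)
    all_goals
      have h1 : (3 : ℝ) * ωr 4 (a i) + 1 = 4 ^ a i := by
        exact_mod_cast three_mul_ωr_four_add_one (a i)
      have h2 : (a i : ℝ) ≤ ωr 4 (a i) := by exact_mod_cast le_ωr_four (a i)
      have h3 : (1 : ℝ) ≤ a i := by exact_mod_cast ha1 i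
      have h4 : (0 : ℝ) ≤ γ := by positivity
      push_cast
    · rw [← h1, one_div, inv_mul_le_iff₀ (by positivity)]
      nlinarith
    · rw [← h1]
      nlinarith
  have ha : Growth L (fun i => (a i : ℝ)) 0 := by
    have h4 : 0 < Real.log 4 := Real.log_pos (by norm_num)
    refine (Growth.self hL).of_ratio hL (c := α / Real.log 4) (by positivity) ?_
    refine (hpow.lim.div_const (Real.log 4)).congr fun i => ?_
    rw [Real.log_pow]
    field_simp
  refine ⟨ha, ?_⟩
  have h := hX.sub (((hp.mul ha).div (Growth.self hL)).tendsto_zero hL (by linarith))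
  rw [sub_zero] at h
  refine h.congr fun i => ?_
  ring

end Asymptotics

/-- Lemma 1.2: Let α ∈ (0,1/2), γ > max{9, (3α−1)/(1−2α)},
(1−α)/k_γ < C₁ < C₂ < 1, and let (n_i) be a strictly increasing sequence of positive
integers with integers a_i ≥ 1 satisfying
C₁·k_γ·f(n_i) ≤ a_i + (γ+1)(4^{a_i}−1)/3 ≤ C₂·k_γ·f(n_i). Then the probability that
G(n_i, n_i^{−α}) contains an induced copy F of W_{a_i}^γ such that every vertex outside F
has a neighbor in F tends to 1. -/
theorem stmt4 (α : ℝ) (hα0 : 0 < α) (hα : α < 1 / 2) (γ : ℕ)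
    (hγ : (γ : ℝ) > max 9 ((3 * α - 1) / (1 - 2 * α)))
    (C₁ C₂ : ℝ) (hC1 : (1 - α) / kcoef α γ < C₁) (hC12 : C₁ < C₂) (hC2 : C₂ < 1)
    (n : ℕ → ℕ) (hmono : StrictMono n) (hpos : ∀ i, 0 < n i)
    (a : ℕ → ℕ) (ha1 : ∀ i, 1 ≤ a i)
    (ha : ∀ i,
        C₁ * kcoef α γ * ff α (n i) ≤ (a i : ℝ) + ((γ : ℝ) + 1) * ((4 : ℝ) ^ a i - 1) / 3 ∧
        (a i : ℝ) + ((γ : ℝ) + 1) * ((4 : ℝ) ^ a i - 1) / 3 ≤ C₂ * kcoef α γ * ff α (n i)) :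
    Tendsto (fun i : ℕ =>
        prob (n i) ((n i : ℝ) ^ (-α)) (fun G =>
          ∃ s : Set (Fin (n i)),
            IsInducedCopy (WG γ (a i)) G s ∧ ∀ v ∉ s, ∃ u ∈ s, G.Adj v u))
      atTop (nhds 1) := by
  obtain ⟨hγ₁, hγ₂⟩ := max_lt_iff.mp hγ
  have h3γ : 3 ≤ γ := by
    have : (3 : ℝ) ≤ γ := by linarith
    exact_mod_cast this
  have hγα : α < (γ + 1) * (1 - 2 * α) := by
    rw [div_lt_iff₀ (by linarith)] at hγ₂
    linarith
  have hk : kcoef α γ = 2 * (1 - α - α / (γ + 1)) := by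
    unfold kcoef
    field_simp
    ring
  have hk0 : 0 < kcoef α γ := by
    rw [hk]
    have : α / ((γ : ℝ) + 1) ≤ α := div_le_self hα0.le (by linarith)
    nlinarith
  rw [div_lt_iff₀ hk0] at hC1
  refine tendsto_of_subseq_tendsto fun ns hns => ?_
  set q : ℕ → ℝ := fun i => (n i : ℝ) ^ (-α) * (a i + (ωr 4 (a i) * (γ + 1) : ℕ)) /
    Real.log (n i) with hq
  have hnt : Tendsto (fun i => (n i : ℝ)) atTop atTop :=
    tendsto_natCast_atTop_atTop.comp hmono.tendsto_atTop
  have hmem : ∀ᶠ i in atTop, q i ∈ Set.Icc (C₁ * kcoef α γ) (C₂ * kcoef α γ) := by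
    filter_upwards [hnt.eventually_gt_atTop 1] with i hi
    have hsize : (a i : ℝ) + ((γ : ℝ) + 1) * ((4 : ℝ) ^ a i - 1) / 3 =
        a i + (ωr 4 (a i) * (γ + 1) : ℕ) := by
      have : (3 : ℝ) * ωr 4 (a i) + 1 = 4 ^ a i := by
        exact_mod_cast three_mul_ωr_four_add_one (a i)
      rw [← this]
      push_cast
      ring
    have hl := Real.log_pos hi
    have hnα : 0 < (n i : ℝ) ^ α := Real.rpow_pos_of_pos (by linarith) _
    obtain ⟨h1, h2⟩ := ha i
    rw [hsize, ff, ← mul_assoc] at h1 h2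
    simp only [hq]
    rw [Real.rpow_neg (by linarith), ← div_eq_inv_mul, div_div]
    refine ⟨(le_div_iff₀ (by positivity)).mpr ?_, (div_le_iff₀ (by positivity)).mpr ?_⟩ <;>
      linarith
  obtain ⟨X, hX, φ, hφ, hlim⟩ := isCompact_Icc.tendsto_subseq' (hns.eventually hmem).frequently
  have hsub := hns.comp hφ.tendsto_atTop
  have hn' : Tendsto (fun i => n (ns (φ i))) atTop atTop := hmono.tendsto_atTop.comp hsub
  have hX₂ : X < kcoef α γ := hX.2.trans_lt (by nlinarith)
  have hX₁ : 1 - α < X := hC1.trans_le hX.1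
  obtain ⟨h1, h2⟩ := tendsto_tree_size hα0 hn' (fun i => ha1 (ns (φ i))) (by linarith) hlim
  exact ⟨φ, tendsto_prob_dominating_copy hα0 hα h3γ hγα hn' (fun i => ha1 (ns (φ i))) h1 h2 hX₁
    (hk ▸ hX₂)⟩
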